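/- Let p ≥ 3 be a prime number, P = 2p or p chosen so that P ≢ ±1 (mod 9), ι ∈ {1,2} defined from the fundamental unit of ℚ(P^{1/3}) as in the standing setup, and let n ≥ 5 be an integer divisible by p^ι. Then there exist infinitely many prime numbers l for which there exists an integer m ∈ {1, 2, …, p−1} such that: (1) l ≡ 2 (mod 3) and l^m ≡ 1 (mod 3); (2) l^m ≡ 1 (mod p); (3) every primitive triple (x,y,z) ∈ ℤ³ with x³ + P^ι y³ = l^m z^n satisfies x ≡ y ≡ 0 (mod l). -/

import Mathlib

/-- The real cube root of a natural number. -/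
noncomputable def cbrt (P : ℕ) : ℝ := (P : ℝ) ^ ((1 : ℝ) / 3)

/-- `u` belongs to the order `ℤ[P^{1/3}]` of `ℚ(P^{1/3})`. -/
def InOrder (P : ℕ) (u : ℝ) : Prop :=
  ∃ x y z : ℤ, u = (x : ℝ) + (y : ℝ) * cbrt P + (z : ℝ) * (cbrt P) ^ 2

/-- `u` is a unit of the order `ℤ[P^{1/3}]`. -/
def IsUnitOfOrder (P : ℕ) (u : ℝ) : Prop :=
  InOrder P u ∧ ∃ v : ℝ, InOrder P v ∧ u * v = 1

/-- `ε` is the fundamental unit of `ℚ(P^{1/3})` (whose ring of integers is `ℤ[P^{1/3}]`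
since `P ≢ ±1 mod 9`): the smallest unit greater than `1`, equivalently the generator
greater than `1` of the unit group modulo `±1`. -/
def IsFundamentalUnit (P : ℕ) (ε : ℝ) : Prop :=
  IsUnitOfOrder P ε ∧ 1 < ε ∧ ∀ u : ℝ, IsUnitOfOrder P u → 1 < u → ε ≤ u

namespace PureCubic
open NumberField Filter Topology Asymptotics

section DirichletSeries
variable {K : Type*} [Field K] [NumberField K]

lemma sum_card_absNorm_isBigO :
    (fun n : ℕ ↦ ∑ k ∈ Finset.Icc 1 n, (Nat.card {I : Ideal (𝓞 K) // Ideal.absNorm I = k} : ℝ))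
      =O[atTop] fun n ↦ (n : ℝ) ^ (1 : ℝ) := by
  refine isBigO_atTop_natCast_rpow_of_tendsto_div_rpow (a := dedekindZeta_residue K) ?_
  refine ((Ideal.tendsto_norm_le_div_atTop₀ K).comp tendsto_natCast_atTop_atTop).congr fun n ↦ ?_
  simp only [Function.comp_apply, Nat.cast_le, ← Nat.cast_sum, Real.rpow_one]
  congr
  rw [← add_left_inj 1, ← Ideal.card_norm_le_eq_card_norm_le_add_one,
    show Finset.Icc 1 n = Finset.Ioc 0 n from Finset.Icc_succ_left_eq_Ioc _ _,
    show 1 = Nat.card {I : Ideal (𝓞 K) // Ideal.absNorm I = 0} by simp [Ideal.absNorm_eq_zero_iff],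
    Finset.sum_Ioc_add_eq_sum_Icc (n.zero_le),
    ← Finset.card_preimage_eq_sum_card_image_eq (fun k _ ↦ Ideal.finite_setOfPred_absNorm_eq k)]
  simp [Set.coe_eq_subtype]

lemma summable_card_absNorm {σ : ℝ} (hσ : 1 < σ) :
    Summable fun n : ℕ ↦
      (Nat.card {I : Ideal (𝓞 K) // Ideal.absNorm I = n} : ℝ) * (n : ℝ) ^ (-σ) := by
  have h := LSeriesSummable_of_sum_norm_bigO_and_nonneg (s := (σ : ℂ))
    (sum_card_absNorm_isBigO (K := K)) (fun _ ↦ Nat.cast_nonneg _) zero_le_one (by simpa)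
  refine (h.norm).congr fun n ↦ ?_
  rcases eq_or_ne n 0 with rfl | hn
  · simp [LSeries.term, (by linarith : σ ≠ 0)]
  · rw [LSeries.norm_term_eq, if_neg hn, Real.rpow_neg (Nat.cast_nonneg _)]
    simp [div_eq_mul_inv]

lemma finite_absNorm_eq (n : ℕ) : Finite {I : Ideal (𝓞 K) // Ideal.absNorm I = n} :=
  Ideal.finite_setOfPred_absNorm_eq n

lemma summable_absNorm_rpow {σ : ℝ} (hσ : 1 < σ) :
    Summable fun I : Ideal (𝓞 K) ↦ (Ideal.absNorm I : ℝ) ^ (-σ) := by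
  rw [← (Equiv.sigmaFiberEquiv (Ideal.absNorm : Ideal (𝓞 K) → ℕ)).summable_iff]
  rw [summable_sigma_of_nonneg (fun x ↦ by simp only [Function.comp_apply]; positivity)]
  have := finite_absNorm_eq (K := K)
  refine ⟨fun n ↦ Summable.of_finite, (summable_card_absNorm (K := K) hσ).congr fun n ↦ ?_⟩
  have : Fintype {I : Ideal (𝓞 K) // Ideal.absNorm I = n} := Fintype.ofFinite _
  rw [tsum_fintype, Finset.sum_congr rfl (g := fun _ ↦ (n : ℝ) ^ (-σ)), Finset.sum_const,
    Finset.card_univ, Nat.card_eq_fintype_card, nsmul_eq_mul]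
  rintro ⟨I, hI⟩ -
  simp [Equiv.sigmaFiberEquiv, hI]

lemma tsum_absNorm_rpow {σ : ℝ} (hσ : 1 < σ) :
    ((∑' I : Ideal (𝓞 K), (Ideal.absNorm I : ℝ) ^ (-σ) : ℝ) : ℂ) = dedekindZeta K σ := by
  have hs := summable_absNorm_rpow (K := K) hσ
  rw [← (Equiv.sigmaFiberEquiv (Ideal.absNorm : Ideal (𝓞 K) → ℕ)).tsum_eq]
  rw [← (Equiv.sigmaFiberEquiv (Ideal.absNorm : Ideal (𝓞 K) → ℕ)).summable_iff,
    Function.comp_def] at hs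
  have := finite_absNorm_eq (K := K)
  rw [hs.tsum_sigma' (fun n ↦ Summable.of_finite), dedekindZeta, LSeries, Complex.ofReal_tsum]
  refine tsum_congr fun n ↦ ?_
  have : Fintype {I : Ideal (𝓞 K) // Ideal.absNorm I = n} := Fintype.ofFinite _
  rw [tsum_fintype, Finset.sum_congr rfl (g := fun _ ↦ (n : ℝ) ^ (-σ)), Finset.sum_const,
    Finset.card_univ, ← Nat.card_eq_fintype_card, nsmul_eq_mul]
  · rcases eq_or_ne n 0 with rfl | hn
    · simp [LSeries.term, (by linarith : σ ≠ 0)]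
    · rw [LSeries.term_of_ne_zero hn, Complex.ofReal_mul, Complex.ofReal_cpow (Nat.cast_nonneg _),
        div_eq_mul_inv, Complex.ofReal_neg, Complex.cpow_neg]
      simp
  · rintro ⟨I, hI⟩ -
    simp [Equiv.sigmaFiberEquiv, hI]

lemma tendsto_sub_one_mul_tsum_absNorm :
    Tendsto (fun σ : ℝ ↦ (σ - 1) * ∑' I : Ideal (𝓞 K), (Ideal.absNorm I : ℝ) ^ (-σ)) (𝓝[>] 1)
      (𝓝 (dedekindZeta_residue K)) := by
  have h := tendsto_sub_one_mul_dedekindZeta_nhdsGT K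
  have h2 := (Complex.continuous_re.tendsto _).comp h
  simp only [Complex.ofReal_re] at h2
  refine h2.congr' ?_
  filter_upwards [self_mem_nhdsWithin] with σ hσ
  rw [Function.comp_apply, ← tsum_absNorm_rpow hσ, ← Complex.ofReal_one, ← Complex.ofReal_sub,
    ← Complex.ofReal_mul, Complex.ofReal_re]

end DirichletSeries
end PureCubic

namespace PureCubic
open NumberField Filter Topology Asymptotics UniqueFactorizationMonoid

section VonMangoldt
variable {K : Type*} [Field K] [NumberField K]

open Classical in
/-- The weight `log N𝔭` of a nonzero prime ideal, and `0` for all other ideals. -/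
noncomputable def primeWeight (v : Ideal (𝓞 K)) : ℝ :=
  if Prime v then Real.log (Ideal.absNorm v) else 0

lemma primeWeight_nonneg (v : Ideal (𝓞 K)) : 0 ≤ primeWeight v := by
  unfold primeWeight
  split_ifs
  · exact Real.log_natCast_nonneg _
  · exact le_rfl

lemma primeWeight_le (v : Ideal (𝓞 K)) : primeWeight v ≤ Real.log (Ideal.absNorm v) := by
  unfold primeWeight
  split_ifs
  · exact le_rfl
  · exact Real.log_natCast_nonneg _

open Classical in
/-- The prime powers dividing `I`, weighted by the logarithm of the norm of the prime. -/
noncomputable def dvdWeight (I : Ideal (𝓞 K)) (q : Ideal (𝓞 K) × ℕ) : ℝ :=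
  if q.1 ^ (q.2 + 1) ∣ I then primeWeight q.1 else 0

lemma dvdWeight_nonneg (I : Ideal (𝓞 K)) (q : Ideal (𝓞 K) × ℕ) : 0 ≤ dvdWeight I q := by
  unfold dvdWeight
  split_ifs
  · exact primeWeight_nonneg _
  · exact le_rfl

lemma hasSum_dvdWeight {I : Ideal (𝓞 K)} (hI : I ≠ 0) :
    HasSum (dvdWeight I) (Real.log (Ideal.absNorm I)) := by
  classical
  set m := normalizedFactors I with hm
  have hmem : ∀ v ∈ m, Prime v := fun v hv ↦ prime_of_normalized_factor v hv
  have hdvd : ∀ v i, Prime v → (v ^ (i + 1) ∣ I ↔ i < m.count v) := fun v i hv ↦ by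
    rw [pow_dvd_iff_le_emultiplicity, emultiplicity_eq_count_normalizedFactors hv.irreducible hI,
      normalize_eq, Nat.cast_le, Nat.succ_le_iff]
  let S : Finset (Ideal (𝓞 K) × ℕ) := m.toFinset ×ˢ Finset.range m.card
  have h : HasSum (dvdWeight I) (∑ q ∈ S, dvdWeight I q) := hasSum_sum_of_ne_finset_zero (by
    rintro ⟨v, i⟩ hq
    unfold dvdWeight primeWeight
    split_ifs with h1 h2
    · exfalso
      rw [hdvd v i h2] at h1
      refine hq (Finset.mem_product.mpr ⟨Multiset.mem_toFinset.mpr ?_, Finset.mem_range.mpr ?_⟩)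
      · exact Multiset.count_pos.mp (by dsimp; omega)
      · exact h1.trans_le (Multiset.count_le_card _ _)
    · rfl
    · rfl)
  convert h using 1
  rw [Finset.sum_product]
  have hprod : m.prod = I := Ideal.prod_normalizedFactors_eq_self hI
  conv_lhs => rw [← hprod]
  have hlog : ∀ t : Multiset (Ideal (𝓞 K)), (∀ v ∈ t, v ≠ 0) →
      Real.log (Ideal.absNorm t.prod) =
        (t.map fun v ↦ Real.log (Ideal.absNorm v)).sum := by
    intro t
    induction t using Multiset.induction with
    | empty => simp
    | cons a t ih =>
      intro ht
      rw [Multiset.prod_cons, map_mul, Nat.cast_mul, Real.log_mul, Multiset.map_cons,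
        Multiset.sum_cons, ih fun v hv ↦ ht v (Multiset.mem_cons_of_mem hv)]
      · simpa [Ideal.absNorm_eq_zero_iff] using ht a (Multiset.mem_cons_self a t)
      · rw [Nat.cast_ne_zero, Ne, Ideal.absNorm_eq_zero_iff]
        exact Multiset.prod_ne_zero fun h0 ↦ ht 0 (Multiset.mem_cons_of_mem h0) rfl
  rw [hlog m fun v hv ↦ (hmem v hv).ne_zero, Finset.sum_multiset_map_count]
  refine Finset.sum_congr rfl fun v hv ↦ ?_
  have hv' := hmem v (Multiset.mem_toFinset.mp hv)
  simp only [dvdWeight, hdvd v _ hv', primeWeight, if_pos hv']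
  rw [← Finset.sum_filter, Finset.sum_const]
  congr 1
  rw [show (Finset.range m.card).filter (fun i ↦ i < m.count v) = Finset.range (m.count v) from ?_,
    Finset.card_range]
  ext i
  simp only [Finset.mem_filter, Finset.mem_range, and_iff_right_iff_imp]
  exact fun h ↦ h.trans_le (Multiset.count_le_card _ _)

lemma tsum_dvd_eq (g : Ideal (𝓞 K) →*₀ ℂ) {c : Ideal (𝓞 K)} (hc : c ≠ 0) (w : ℂ)
    [DecidablePred fun I : Ideal (𝓞 K) ↦ c ∣ I] :
    ∑' I : Ideal (𝓞 K), g I * (if c ∣ I then w else 0) = w * g c * ∑' I, g I := by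
  have hinj : Function.Injective fun I : Ideal (𝓞 K) ↦ c * I := mul_right_injective₀ hc
  rw [← hinj.tsum_eq, ← tsum_mul_left]
  · refine tsum_congr fun I ↦ ?_
    rw [if_pos (dvd_mul_right c I), map_mul]
    ring
  · intro I hI
    by_contra h
    refine hI ?_
    change g I * (if c ∣ I then w else 0) = 0
    rw [if_neg, mul_zero]
    rintro ⟨J, rfl⟩
    exact h ⟨J, rfl⟩

lemma summable_mul_dvdWeight (g : Ideal (𝓞 K) →*₀ ℂ)
    (hg : Summable fun I ↦ ‖g I‖ * Real.log (Ideal.absNorm I)) :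
    Summable fun x : Ideal (𝓞 K) × (Ideal (𝓞 K) × ℕ) ↦ ‖g x.1‖ * dvdWeight x.1 x.2 := by
  have h0 : ∀ I : Ideal (𝓞 K), HasSum (fun q ↦ ‖g I‖ * dvdWeight I q)
      (‖g I‖ * Real.log (Ideal.absNorm I)) := fun I ↦ by
    rcases eq_or_ne I 0 with rfl | hI
    · simp only [map_zero, norm_zero, zero_mul]
      exact hasSum_zero
    · exact (hasSum_dvdWeight hI).mul_left _
  rw [summable_prod_of_nonneg fun x ↦ mul_nonneg (norm_nonneg _) (dvdWeight_nonneg _ _)]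
  exact ⟨fun I ↦ (h0 I).summable, hg.congr fun I ↦ (h0 I).tsum_eq.symm⟩

lemma summable_primeWeight_mul (g : Ideal (𝓞 K) →*₀ ℂ)
    (hg : Summable fun I ↦ ‖g I‖ * Real.log (Ideal.absNorm I)) :
    Summable fun q : Ideal (𝓞 K) × ℕ ↦ ‖(primeWeight q.1 : ℂ) * g (q.1 ^ (q.2 + 1))‖ := by
  have h := (summable_mul_dvdWeight g hg).comp_injective
    (i := fun q : Ideal (𝓞 K) × ℕ ↦ (q.1 ^ (q.2 + 1), q)) fun _ _ h ↦ (Prod.ext_iff.mp h).2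
  refine h.congr fun q ↦ ?_
  simp only [Function.comp_apply, dvdWeight, dvd_refl, if_true, norm_mul, Complex.norm_real,
    Real.norm_eq_abs, abs_of_nonneg (primeWeight_nonneg _)]
  ring

lemma tsum_mul_log_eq (g : Ideal (𝓞 K) →*₀ ℂ)
    (hg : Summable fun I ↦ ‖g I‖ * Real.log (Ideal.absNorm I)) :
    ∑' I, g I * (Real.log (Ideal.absNorm I) : ℂ) =
      (∑' q : Ideal (𝓞 K) × ℕ, (primeWeight q.1 : ℂ) * g (q.1 ^ (q.2 + 1))) * ∑' I, g I := by
  classical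
  have hs : Summable fun x : Ideal (𝓞 K) × (Ideal (𝓞 K) × ℕ) ↦
      g x.1 * (dvdWeight x.1 x.2 : ℂ) := by
    refine Summable.of_norm ((summable_mul_dvdWeight g hg).congr fun x ↦ ?_)
    rw [norm_mul, Complex.norm_real, Real.norm_eq_abs, abs_of_nonneg (dvdWeight_nonneg _ _)]
  have h0 : ∀ I : Ideal (𝓞 K), ∑' q, g I * (dvdWeight I q : ℂ) =
      g I * (Real.log (Ideal.absNorm I) : ℂ) := fun I ↦ by
    rcases eq_or_ne I 0 with rfl | hI
    · simp only [map_zero, zero_mul, tsum_zero]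
    · rw [tsum_mul_left, ← Complex.ofReal_tsum, (hasSum_dvdWeight hI).tsum_eq]
  simp_rw [← h0]
  rw [← Summable.tsum_comm (f := fun I q ↦ g I * (dvdWeight I q : ℂ)) hs, ← tsum_mul_right]
  refine tsum_congr fun q ↦ ?_
  by_cases hq : Prime q.1
  · rw [← tsum_dvd_eq g (pow_ne_zero _ hq.ne_zero)]
    refine tsum_congr fun I ↦ ?_
    simp only [dvdWeight]
    split_ifs <;> simp
  · simp [dvdWeight, primeWeight, hq]

end VonMangoldt
end PureCubic

namespace PureCubic
open NumberField Filter Topology Asymptotics UniqueFactorizationMonoid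

section IdealL
variable {K : Type*} [Field K] [NumberField K]

/-- The function `I ↦ f(I) N(I)^{-s}`. -/
noncomputable def twist (f : Ideal (𝓞 K) →*₀ ℂ) (s : ℂ) : Ideal (𝓞 K) →*₀ ℂ where
  toFun I := f I * (Ideal.absNorm I : ℂ) ^ (-s)
  map_zero' := by rw [map_zero, zero_mul]
  map_one' := by rw [map_one, map_one, Nat.cast_one, Complex.one_cpow, one_mul]
  map_mul' I J := by
    rw [map_mul, map_mul, Nat.cast_mul, Complex.natCast_mul_natCast_cpow]
    ring

lemma twist_apply (f : Ideal (𝓞 K) →*₀ ℂ) (s : ℂ) (I : Ideal (𝓞 K)) :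
    twist f s I = f I * (Ideal.absNorm I : ℂ) ^ (-s) := rfl

/-- The `L`-series of a multiplicative function on ideals. -/
noncomputable def idealL (f : Ideal (𝓞 K) →*₀ ℂ) (s : ℂ) : ℂ := ∑' I, twist f s I

/-- The negative logarithmic derivative of `idealL`. -/
noncomputable def idealΛ (f : Ideal (𝓞 K) →*₀ ℂ) (s : ℂ) : ℂ :=
  ∑' q : Ideal (𝓞 K) × ℕ, (primeWeight q.1 : ℂ) * twist f s (q.1 ^ (q.2 + 1))

variable {f : Ideal (𝓞 K) →*₀ ℂ}

lemma norm_twist_le (hf : ∀ I, ‖f I‖ ≤ 1) (s : ℂ) (I : Ideal (𝓞 K)) :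
    ‖twist f s I‖ ≤ (Ideal.absNorm I : ℝ) ^ (-s.re) := by
  rcases eq_or_ne I 0 with rfl | hI
  · rw [map_zero, norm_zero]
    positivity
  · have h : 0 < Ideal.absNorm I := Nat.pos_of_ne_zero (by simpa [Ideal.absNorm_eq_zero_iff] using hI)
    rw [twist_apply, norm_mul, Complex.norm_natCast_cpow_of_pos h, Complex.neg_re]
    exact mul_le_of_le_one_left (by positivity) (hf I)

lemma summable_norm_twist (hf : ∀ I, ‖f I‖ ≤ 1) {s : ℂ} (hs : 1 < s.re) :
    Summable fun I ↦ ‖twist f s I‖ :=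
  (summable_absNorm_rpow hs).of_nonneg_of_le (fun _ ↦ norm_nonneg _) (norm_twist_le hf s)

lemma summable_rpow_mul_log {σ : ℝ} (hσ : 1 < σ) : Summable fun I : Ideal (𝓞 K) ↦
    (Ideal.absNorm I : ℝ) ^ (-σ) * Real.log (Ideal.absNorm I) := by
  have hδ : 0 < (σ - 1) / 2 := by linarith
  refine ((summable_absNorm_rpow (K := K) (σ := (σ + 1) / 2) (by linarith)).mul_right
    (1 / ((σ - 1) / 2))).of_nonneg_of_le
    (fun I ↦ mul_nonneg (by positivity) (Real.log_natCast_nonneg _)) fun I ↦ ?_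
  rcases (Ideal.absNorm I).eq_zero_or_pos with h | h
  · rw [h]
    simp only [Nat.cast_zero, Real.log_zero, mul_zero]
    positivity
  · have h1 := Real.log_le_rpow_div (x := (Ideal.absNorm I : ℝ)) (Nat.cast_nonneg _) hδ
    calc (Ideal.absNorm I : ℝ) ^ (-σ) * Real.log (Ideal.absNorm I)
        ≤ (Ideal.absNorm I : ℝ) ^ (-σ) * ((Ideal.absNorm I : ℝ) ^ ((σ - 1) / 2) / ((σ - 1) / 2)) := by
          gcongr
      _ = _ := by
          rw [← mul_div_assoc, ← Real.rpow_add (by exact_mod_cast h), mul_one_div]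
          congr 2
          ring

lemma summable_norm_twist_mul_log (hf : ∀ I, ‖f I‖ ≤ 1) {s : ℂ} (hs : 1 < s.re) :
    Summable fun I ↦ ‖twist f s I‖ * Real.log (Ideal.absNorm I) :=
  (summable_rpow_mul_log hs).of_nonneg_of_le
    (fun _ ↦ mul_nonneg (norm_nonneg _) (Real.log_natCast_nonneg _)) fun I ↦
    mul_le_mul_of_nonneg_right (norm_twist_le hf s I) (Real.log_natCast_nonneg _)

lemma hasDerivAt_twist (s : ℂ) (I : Ideal (𝓞 K)) :
    HasDerivAt (fun z ↦ twist f z I)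
      (-(twist f s I * (Real.log (Ideal.absNorm I) : ℂ))) s := by
  rcases eq_or_ne I 0 with rfl | hI
  · simp only [map_zero, zero_mul, neg_zero]
    exact hasDerivAt_const _ _
  · have h : (Ideal.absNorm I : ℂ) ≠ 0 := by simpa [Ideal.absNorm_eq_zero_iff] using hI
    have h1 := ((hasDerivAt_id s).neg.const_cpow (c := (Ideal.absNorm I : ℂ)) (Or.inl h)).const_mul
      (f I)
    refine h1.congr_deriv ?_
    rw [twist_apply, Complex.ofReal_log (Nat.cast_nonneg _), Complex.ofReal_natCast]
    simp only [Pi.neg_apply, id]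
    ring

lemma hasDerivAt_idealL (hf : ∀ I, ‖f I‖ ≤ 1) {s : ℂ} (hs : 1 < s.re) :
    HasDerivAt (idealL f) (-(idealΛ f s * idealL f s)) s := by
  set σ := (s.re + 1) / 2 with hσ
  have hσ1 : 1 < σ := by rw [hσ]; linarith
  have hconv : Convex ℝ {z : ℂ | σ < z.re} := convex_halfSpace_re_gt σ
  have key := hasDerivAt_tsum_of_isPreconnected (summable_rpow_mul_log (K := K) hσ1)
    (t := {z : ℂ | σ < z.re}) (isOpen_lt continuous_const Complex.continuous_re)
    hconv.isPreconnected (g := fun I z ↦ twist f z I) (y₀ := s) (y := s)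
    (fun I z _ ↦ hasDerivAt_twist z I) (fun I z hz ↦ ?_) (by simp only [Set.mem_ofPred_eq, hσ]; linarith)
    (summable_norm_twist hf hs).of_norm (by simp only [Set.mem_ofPred_eq, hσ]; linarith)
  · refine key.congr_deriv ?_
    rw [tsum_neg, tsum_mul_log_eq _ (summable_norm_twist_mul_log hf hs)]
    rfl
  · rw [norm_neg, norm_mul, Complex.norm_real, Real.norm_eq_abs,
      abs_of_nonneg (Real.log_natCast_nonneg _)]
    refine mul_le_mul_of_nonneg_right ((norm_twist_le hf z I).trans ?_) (Real.log_natCast_nonneg _)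
    rcases (Ideal.absNorm I).eq_zero_or_pos with h | h
    · rw [h, Nat.cast_zero, Real.zero_rpow, Real.zero_rpow] <;>
        simp only [Set.mem_ofPred_eq] at hz <;> linarith
    · exact Real.rpow_le_rpow_of_exponent_le (by exact_mod_cast h)
        (by simp only [Set.mem_ofPred_eq] at hz; linarith)

lemma exists_idealL_ne_zero (hf : ∀ I, ‖f I‖ ≤ 1) : ∃ s : ℂ, 1 < s.re ∧ idealL f s ≠ 0 := by
  classical
  set C := ∑' I : Ideal (𝓞 K), (Ideal.absNorm I : ℝ) ^ (-2 : ℝ) with hC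
  obtain ⟨n, hn⟩ := pow_unbounded_of_one_lt (C + 1) (one_lt_two (α := ℝ))
  refine ⟨(n + 2 : ℕ), ?_, fun h0 ↦ ?_⟩
  · rw [Complex.natCast_re]
    push_cast
    have : (0 : ℝ) ≤ n := Nat.cast_nonneg n
    linarith
  have hs : 1 < ((n + 2 : ℕ) : ℂ).re := by
    rw [Complex.natCast_re]
    push_cast
    have : (0 : ℝ) ≤ n := Nat.cast_nonneg n
    linarith
  have hsum := (summable_norm_twist hf hs).of_norm
  have h1 := hsum.tsum_eq_add_tsum_ite 1
  rw [idealL] at h0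
  rw [h0, map_one] at h1
  have h2 : ‖∑' I, (if I = 1 then 0 else twist f ((n + 2 : ℕ) : ℂ) I)‖ ≤ C / 2 ^ n := by
    rw [hC, ← tsum_div_const]
    refine tsum_of_norm_bounded ((summable_absNorm_rpow one_lt_two).div_const _).hasSum fun I ↦ ?_
    split_ifs with hI
    · rw [norm_zero]
      positivity
    · rcases eq_or_ne I 0 with rfl | hI0
      · rw [map_zero, norm_zero]
        positivity
      refine (norm_twist_le hf _ I).trans ?_
      have hpos : 0 < Ideal.absNorm I :=
        Nat.pos_of_ne_zero (by simpa [Ideal.absNorm_eq_zero_iff] using hI0)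
      have hne : Ideal.absNorm I ≠ 1 := by
        rwa [Ne, Ideal.absNorm_eq_one_iff, ← Ideal.one_eq_top]
      have h2le : (2 : ℝ) ≤ Ideal.absNorm I := by exact_mod_cast (by omega : 2 ≤ Ideal.absNorm I)
      rw [Complex.natCast_re, show (-((n + 2 : ℕ) : ℝ)) = -2 - n by push_cast; ring,
        Real.rpow_sub (by linarith), Real.rpow_natCast]
      gcongr
  have h3 : ‖(1 : ℂ)‖ ≤ C / 2 ^ n := by
    rwa [eq_neg_of_add_eq_zero_left h1.symm, norm_neg]
  rw [norm_one, le_div_iff₀ (by positivity)] at h3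
  linarith

end IdealL

section LogDeriv

lemma exists_tendsto_sub_one_mul_logDeriv {L Λ G : ℂ → ℂ}
    (hL : ∀ s : ℂ, 1 < s.re → HasDerivAt L (-(Λ s * L s)) s)
    (hne : ∃ s : ℂ, 1 < s.re ∧ L s ≠ 0) (hG : AnalyticAt ℂ G 1) (a : ℕ)
    (hGL : ∀ᶠ s in 𝓝 (1 : ℂ), 1 < s.re → G s = (s - 1) ^ a * L s) :
    ∃ r : ℕ, (r = 0 ↔ G 1 ≠ 0) ∧
      Tendsto (fun σ : ℝ ↦ ((σ : ℂ) - 1) * Λ σ) (𝓝[>] 1) (𝓝 ((a : ℂ) - r)) := by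
  have hcoe : Tendsto (fun σ : ℝ ↦ (σ : ℂ)) (𝓝[>] 1) (𝓝 1) := by
    have := (Complex.continuous_ofReal.tendsto 1).mono_left (nhdsWithin_le_nhds (s := Set.Ioi 1))
    simpa using this
  have hU : IsOpen {s : ℂ | 1 < s.re} := isOpen_lt continuous_const Complex.continuous_re
  have hLan : AnalyticOnNhd ℂ L {s : ℂ | 1 < s.re} :=
    DifferentiableOn.analyticOnNhd
      (fun s hs ↦ (hL s hs).differentiableAt.differentiableWithinAt) hU
  have hpos : ∀ᶠ σ : ℝ in 𝓝[>] 1, (1 : ℝ) < σ := self_mem_nhdsWithin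
  have hnot : ¬ ∀ᶠ z in 𝓝 (1 : ℂ), G z = 0 := by
    intro h0
    obtain ⟨s, hs, hs0⟩ := hne
    refine hs0 ?_
    have hev := (hcoe.eventually (h0.and hGL).eventually_nhds).and hpos
    obtain ⟨σ, hσ, hσ1⟩ := hev.exists
    have hσre : (1 : ℝ) < ((σ : ℂ)).re := by simpa using hσ1
    refine hLan.eqOn_zero_of_preconnected_of_eventuallyEq_zero
      (convex_halfSpace_re_gt 1).isPreconnected hσre ?_ hs
    filter_upwards [hσ, hU.mem_nhds hσre] with z hz hz1
    have h := hz.2 hz1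
    rw [hz.1, eq_comm, mul_eq_zero] at h
    refine h.resolve_left (pow_ne_zero _ fun h1 ↦ ?_)
    rw [sub_eq_zero] at h1
    simp [h1] at hz1
  obtain ⟨r, g, hg, hg1, hGg⟩ := hG.exists_eventuallyEq_pow_smul_nonzero_iff.mpr hnot
  refine ⟨r, ?_, ?_⟩
  · have := hGg.self_of_nhds
    rw [this]
    rcases eq_or_ne r 0 with rfl | hr
    · simpa using hg1
    · simp [hr]
  have hgd : ∀ᶠ z in 𝓝 (1 : ℂ), AnalyticAt ℂ g z ∧ g z ≠ 0 :=
    hg.eventually_analyticAt.and (hg.continuousAt.eventually_ne hg1)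
  have hlim : Tendsto (fun σ : ℝ ↦ (a : ℂ) - r - ((σ : ℂ) - 1) * logDeriv g σ) (𝓝[>] 1)
      (𝓝 ((a : ℂ) - r - (1 - 1) * logDeriv g 1)) := by
    refine tendsto_const_nhds.sub ((hcoe.sub tendsto_const_nhds).mul ?_)
    have hcont : ContinuousAt (logDeriv g) 1 := by
      unfold logDeriv
      exact hg.deriv.continuousAt.div hg.continuousAt hg1
    exact hcont.tendsto.comp hcoe
  rw [sub_self, zero_mul, sub_zero] at hlim
  refine hlim.congr' ?_
  filter_upwards [hcoe.eventually (hgd.and ((hGg.and hGL).eventually_nhds)), hpos] with σ hσ hσ1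
  obtain ⟨⟨hga, hg0⟩, hev⟩ := hσ
  have hσre : (1 : ℝ) < ((σ : ℂ)).re := by simpa using hσ1
  have hz0 : (σ : ℂ) - 1 ≠ 0 := by
    rw [sub_ne_zero]
    exact_mod_cast hσ1.ne'
  have e1 : (fun z : ℂ ↦ (z - 1) ^ a * L z) =ᶠ[𝓝 (σ : ℂ)] fun z ↦ (z - 1) ^ r * g z := by
    filter_upwards [hev, hU.mem_nhds hσre] with z hz hz1
    rw [← hz.2 hz1, hz.1, smul_eq_mul]
  have hL0 : L σ ≠ 0 := by
    intro h
    have := e1.self_of_nhds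
    simp only [h, mul_zero] at this
    exact mul_ne_zero (pow_ne_zero _ hz0) hg0 this.symm
  have hpow : ∀ n : ℕ, HasDerivAt (fun z : ℂ ↦ (z - 1) ^ n) (n * ((σ : ℂ) - 1) ^ (n - 1) * 1) σ :=
    fun n ↦ ((hasDerivAt_id (σ : ℂ)).sub_const 1).pow n
  have hlp : ∀ n : ℕ, logDeriv (fun z : ℂ ↦ (z - 1) ^ n) σ = n / ((σ : ℂ) - 1) := fun n ↦ by
    rw [logDeriv_apply, (hpow n).deriv]
    rcases n with _ | n
    · simp
    · rw [Nat.add_sub_cancel, mul_one, pow_succ, ← div_div, mul_div_assoc,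
        div_self (pow_ne_zero _ hz0), mul_one]
  have e2 : logDeriv (fun z : ℂ ↦ (z - 1) ^ a * L z) (σ : ℂ) =
      logDeriv (fun z : ℂ ↦ (z - 1) ^ r * g z) (σ : ℂ) := by
    rw [logDeriv_apply, logDeriv_apply, e1.deriv_eq]
    exact congrArg _ e1.self_of_nhds
  rw [logDeriv_mul (f := fun z : ℂ ↦ (z - 1) ^ a) (σ : ℂ) (pow_ne_zero _ hz0) hL0 (hpow a).differentiableAt
      (hL _ hσre).differentiableAt,
    logDeriv_mul (f := fun z : ℂ ↦ (z - 1) ^ r) (σ : ℂ) (pow_ne_zero _ hz0) hg0 (hpow r).differentiableAt hga.differentiableAt,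
    hlp, hlp, logDeriv_apply L, (hL _ hσre).deriv] at e2
  field_simp at e2 ⊢
  linear_combination e2

end LogDeriv
end PureCubic

namespace PureCubic
open Filter Topology

section Tent

/-- The tent function of width `η`. -/
noncomputable def tent (η u : ℝ) : ℝ := max 0 (1 - |u| / η)

lemma tent_nonneg (η u : ℝ) : 0 ≤ tent η u := le_max_left _ _

lemma tent_le_one {η : ℝ} (hη : 0 < η) (u : ℝ) : tent η u ≤ 1 :=
  max_le zero_le_one (by have := div_nonneg (abs_nonneg u) hη.le; linarith)

lemma abs_lt_of_tent_ne_zero {η : ℝ} (hη : 0 < η) {u : ℝ} (h : tent η u ≠ 0) : |u| < η := by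
  by_contra hu
  refine h (max_eq_left ?_)
  rw [sub_nonpos, le_div_iff₀ hη]
  linarith

lemma abs_tent_sub_le {η : ℝ} (hη : 0 < η) (u v : ℝ) : |tent η u - tent η v| ≤ |u - v| / η := by
  refine (abs_max_sub_max_le_max _ _ _ _).trans ?_
  rw [sub_self, abs_zero, max_eq_right (abs_nonneg _)]
  rw [show 1 - |u| / η - (1 - |v| / η) = (|v| - |u|) / η by ring, abs_div, abs_of_pos hη]
  rw [abs_sub_comm u v]
  exact div_le_div_of_nonneg_right (abs_abs_sub_abs_le _ _) hη.le

lemma hasSum_tent {η : ℝ} (hη : 0 < η) (u : ℝ) :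
    HasSum (fun k : ℤ ↦ tent η (u + k * η)) 1 := by
  set k₀ : ℤ := -⌊u / η⌋ with hk₀
  set v := Int.fract (u / η) with hv
  have hv0 : 0 ≤ v := Int.fract_nonneg _
  have hv1 : v < 1 := Int.fract_lt_one _
  have hu : u = (v - k₀) * η := by
    rw [hk₀, hv, Int.cast_neg, sub_neg_eq_add, Int.fract_add_floor, div_mul_cancel₀ _ hη.ne']
  have hval : ∀ k : ℤ, tent η (u + k * η) = max 0 (1 - |v + (k - k₀ : ℤ)|) := fun k ↦ by
    unfold tent
    rw [hu, show (v - k₀) * η + k * η = (v + (k - k₀ : ℤ)) * η by push_cast; ring, abs_mul,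
      abs_of_pos hη, mul_div_assoc, div_self hη.ne', mul_one]
  have h := hasSum_sum_of_ne_finset_zero (L := .unconditional ℤ)
    (f := fun k : ℤ ↦ tent η (u + k * η)) (s := {k₀, k₀ - 1}) (by
    intro k hk
    simp only [Finset.mem_insert, Finset.mem_singleton, not_or] at hk
    rw [hval, max_eq_left]
    rw [sub_nonpos]
    rcases lt_or_ge k k₀ with h | h
    · have h1 : k - k₀ ≤ -2 := by omega
      have h2 : ((k - k₀ : ℤ) : ℝ) ≤ -2 := by exact_mod_cast h1
      rw [abs_of_neg (by linarith)]
      linarith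
    · have h1 : 1 ≤ k - k₀ := by omega
      have h2 : (1 : ℝ) ≤ ((k - k₀ : ℤ) : ℝ) := by exact_mod_cast h1
      rw [abs_of_pos (by linarith)]
      linarith)
  convert h using 1
  rw [Finset.sum_pair (by omega), hval, hval, sub_self, Int.cast_zero, add_zero, abs_of_nonneg hv0,
    show k₀ - 1 - k₀ = -1 by ring, Int.cast_neg, Int.cast_one, abs_of_neg (by linarith),
    max_eq_right (by linarith), max_eq_right (by linarith)]
  ring

lemma abs_log_sub_log_le {a b d : ℝ} (ha : 0 < a) (h : |b - a| ≤ d) (hd : 2 * d ≤ a) :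
    0 < b ∧ |Real.log b - Real.log a| ≤ 2 * d / a := by
  obtain ⟨h1, h2⟩ := abs_le.mp h
  have hd0 : 0 ≤ d := (abs_nonneg _).trans h
  have hb : a / 2 ≤ b := by linarith
  have hb0 : 0 < b := by linarith
  refine ⟨hb0, abs_le.mpr ⟨?_, ?_⟩⟩
  · have h3 := Real.log_le_sub_one_of_pos (div_pos ha hb0)
    rw [Real.log_div ha.ne' hb0.ne'] at h3
    have h4 : a / b - 1 ≤ 2 * d / a := by
      rw [div_sub_one hb0.ne', div_le_div_iff₀ hb0 ha]
      nlinarith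
    linarith
  · have h3 := Real.log_le_sub_one_of_pos (div_pos hb0 ha)
    rw [Real.log_div hb0.ne' ha.ne'] at h3
    have h4 : b / a - 1 ≤ 2 * d / a := by
      rw [div_sub_one ha.ne']
      gcongr
      linarith
    linarith

/-- A smooth version of the summand of the zeta function, cut off to a cone. -/
noncomputable def cone (η : ℝ) (s : ℂ) (a t : ℝ) : ℂ :=
  if 0 < a then (tent η (Real.log a - Real.log t) : ℂ) * ((a * t ^ 2 : ℝ) : ℂ) ^ (-s) else 0

lemma norm_cone_le {η : ℝ} (hη : 0 < η) {s : ℂ} {a t : ℝ} (h : 0 < a → 1 ≤ a * t ^ 2) :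
    ‖cone η s a t‖ ≤ (a * t ^ 2) ^ (-s.re) ∨ cone η s a t = 0 := by
  unfold cone
  split_ifs with ha
  · left
    have h1 := h ha
    rw [norm_mul, Complex.norm_real, Real.norm_eq_abs, abs_of_nonneg (tent_nonneg _ _),
      Complex.norm_cpow_eq_rpow_re_of_pos (by linarith), Complex.neg_re]
    exact mul_le_of_le_one_left (by positivity) (tent_le_one hη _)
  · right
    rfl

lemma norm_cone_le_one {η : ℝ} (hη : 0 < η) {s : ℂ} (hs : 0 ≤ s.re) {a t : ℝ}
    (h : 0 < a → 1 ≤ a * t ^ 2) : ‖cone η s a t‖ ≤ 1 := by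
  by_cases ha : 0 < a
  · rcases norm_cone_le (s := s) hη h with h1 | h1
    · exact h1.trans (Real.rpow_le_one_of_one_le_of_nonpos (h ha) (by linarith))
    · simp [h1]
  · simp [cone, ha]

lemma mem_cone_of_ne_zero {η : ℝ} (hη : 0 < η) {s : ℂ} {a t : ℝ} (ht : 0 ≤ t)
    (h : 0 < a → 1 ≤ a * t ^ 2) (h0 : cone η s a t ≠ 0) :
    0 < a ∧ 0 < t ∧ a + t ≤ (1 + Real.exp η) * a ∧ a + t ≤ (1 + Real.exp η) * t := by
  unfold cone at h0
  split_ifs at h0 with ha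
  · have h1 := h ha
    have ht0 : 0 < t := by
      rcases ht.eq_or_lt with rfl | ht
      · norm_num at h1
      · exact ht
    have h2 : |Real.log a - Real.log t| < η := by
      refine abs_lt_of_tent_ne_zero hη fun h3 ↦ h0 ?_
      rw [h3, Complex.ofReal_zero, zero_mul]
    rw [abs_lt] at h2
    have h3 : a ≤ Real.exp η * t := by
      rw [← Real.log_le_log_iff ha (by positivity), Real.log_mul (Real.exp_pos _).ne' ht0.ne',
        Real.log_exp]
      linarith
    have h4 : t ≤ Real.exp η * a := by
      rw [← Real.log_le_log_iff ht0 (by positivity), Real.log_mul (Real.exp_pos _).ne' ha.ne',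
        Real.log_exp]
      linarith
    exact ⟨ha, ht0, by linarith, by linarith⟩
  · exact absurd rfl h0

lemma rpow_le_of_mem_cone {E : ℝ} (hE1 : 1 < E) {σ τ : ℝ} (hσ : 0 ≤ σ) (hs : σ ≤ τ)
    {a t : ℝ} (ha : 0 < a) (ht0 : 0 < t) (h1 : a + t ≤ E * a) (h2 : a + t ≤ E * t)
    (h3 : 1 ≤ a * t ^ 2) :
    (a * t ^ 2) ^ (-τ) ≤ (E * 2) ^ (3 * σ) * (1 + a + t) ^ (-(3 * σ)) := by
  have hbase : ((1 + a + t) / (E * 2)) ^ 3 ≤ a * t ^ 2 := by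
    have h5 : 1 ≤ a + t := by
      by_contra hlt
      have ha1 : a < 1 := by linarith
      have ht1 : t < 1 := by linarith
      nlinarith [mul_pos ha ht0, mul_pos ht0 ht0]
    have h6 : (1 + a + t) / (E * 2) ≤ a := by
      rw [div_le_iff₀ (by positivity)]
      nlinarith
    have h7 : (1 + a + t) / (E * 2) ≤ t := by
      rw [div_le_iff₀ (by positivity)]
      nlinarith
    have h8 : 0 ≤ (1 + a + t) / (E * 2) := by positivity
    calc ((1 + a + t) / (E * 2)) ^ 3
        = (1 + a + t) / (E * 2) * ((1 + a + t) / (E * 2)) ^ 2 := by ring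
      _ ≤ a * t ^ 2 := by gcongr
  calc (a * t ^ 2) ^ (-τ)
    _ ≤ (a * t ^ 2) ^ (-σ) := Real.rpow_le_rpow_of_exponent_le h3 (by linarith)
    _ ≤ (((1 + a + t) / (E * 2)) ^ 3) ^ (-σ) :=
        Real.rpow_le_rpow_of_nonpos (by positivity) hbase (by linarith)
    _ = _ := by
        rw [← Real.rpow_natCast, ← Real.rpow_mul (by positivity),
          Real.div_rpow (by positivity) (by positivity)]
        push_cast
        rw [mul_neg, Real.rpow_neg (x := E * 2) (by positivity), div_inv_eq_mul, mul_comm]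

lemma norm_cone_le_rpow {η : ℝ} (hη : 0 < η) {s : ℂ} {σ : ℝ} (hσ : 0 ≤ σ) (hs : σ ≤ s.re)
    {a t : ℝ} (ht : 0 ≤ t) (h : 0 < a → 1 ≤ a * t ^ 2) :
    ‖cone η s a t‖ ≤ ((1 + Real.exp η) * 2) ^ (3 * σ) * (1 + |a| + t) ^ (-(3 * σ)) := by
  rcases eq_or_ne (cone η s a t) 0 with h0 | h0
  · rw [h0, norm_zero]
    positivity
  obtain ⟨ha, ht0, h1, h2⟩ := mem_cone_of_ne_zero hη ht h h0
  rw [abs_of_pos ha]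
  exact ((norm_cone_le (s := s) hη h).resolve_right h0).trans
    (rpow_le_of_mem_cone (by linarith [Real.exp_pos η]) hσ hs ha ht0 h1 h2 (h ha))

lemma cone_eq_exp {η : ℝ} {s : ℂ} {a t : ℝ} (ha : 0 < a) (ht : 0 < t) :
    cone η s a t = (tent η (Real.log a - Real.log t) : ℂ) *
      Complex.exp (-s * ((Real.log a + 2 * Real.log t : ℝ) : ℂ)) := by
  have h : a * t ^ 2 ≠ 0 := by positivity
  rw [cone, if_pos ha, Complex.cpow_def_of_ne_zero (by exact_mod_cast h), ← Complex.ofReal_log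
    (by positivity), Real.log_mul ha.ne' (by positivity), Real.log_pow]
  push_cast
  ring_nf

lemma norm_cone_sub_le_of_far {η : ℝ} (hη : 0 < η) {V : ℝ} (hV : 0 ≤ V) {s : ℂ}
    (hs1 : 5 / 6 ≤ s.re) (hs2 : ‖s‖ ≤ 7 / 6) {a t a' t' : ℝ} (ha : |a' - a| ≤ V)
    (ht : |t' - t| ≤ V) (ht0 : 0 ≤ t) (h : 0 < a → 1 ≤ a * t ^ 2) (h0 : cone η s a t ≠ 0)
    (hfar : 16 * V * (1 + Real.exp η) + 1 ≤ a + t) :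
    ‖cone η s a' t' - cone η s a t‖ ≤
      (((1 + Real.exp η) * 2) ^ (5 / 2 : ℝ) * (4 * V * (1 + Real.exp η) * (7 + 2 / η))) *
        (1 + |a| + t) ^ (-(7 / 2) : ℝ) := by
  set E := 1 + Real.exp η with hE
  have hE1 : 1 < E := by rw [hE]; linarith [Real.exp_pos η]
  obtain ⟨ha0, ht0, h1, h2⟩ := mem_cone_of_ne_zero hη ht0 h h0
  have hρ : 0 < a + t := by positivity
  set d := 2 * V * E / (a + t) with hd
  have hd0 : 0 ≤ d := by positivity
  have hd8 : d ≤ 1 / 8 := by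
    rw [hd, div_le_iff₀ hρ]
    nlinarith
  have hda : 2 * V / a ≤ d := by
    rw [hd, div_le_div_iff₀ ha0 hρ]
    nlinarith [mul_le_mul_of_nonneg_left h1 (by positivity : 0 ≤ 2 * V)]
  have hdt : 2 * V / t ≤ d := by
    rw [hd, div_le_div_iff₀ ht0 hρ]
    nlinarith [mul_le_mul_of_nonneg_left h2 (by positivity : 0 ≤ 2 * V)]
  have hVa : 2 * V ≤ a := by
    have := hda.trans hd8
    rw [div_le_iff₀ ha0] at this
    linarith
  have hVt : 2 * V ≤ t := by
    have := hdt.trans hd8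
    rw [div_le_iff₀ ht0] at this
    linarith
  obtain ⟨ha'0, hla⟩ := abs_log_sub_log_le ha0 ha hVa
  obtain ⟨ht'0, hlt⟩ := abs_log_sub_log_le ht0 ht hVt
  have hla' := abs_le.mp (hla.trans hda)
  have hlt' := abs_le.mp (hlt.trans hdt)
  rw [cone_eq_exp ha0 ht0, cone_eq_exp ha'0 ht'0]
  set u := Real.log a - Real.log t
  set u' := Real.log a' - Real.log t'
  set w := Real.log a + 2 * Real.log t with hw
  set w' := Real.log a' + 2 * Real.log t' with hw'
  have hu : |u' - u| ≤ 2 * d := abs_le.mpr ⟨by linarith, by linarith⟩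
  have hww : |w' - w| ≤ 3 * d := abs_le.mpr ⟨by linarith, by linarith⟩
  have hexp : ‖Complex.exp (-s * (w : ℂ))‖ ≤ (E * 2) ^ (5 / 2 : ℝ) * (1 + a + t) ^ (-(5 / 2) : ℝ) := by
    have h5 := rpow_le_of_mem_cone hE1 (by norm_num) hs1 ha0 ht0 h1 h2 (h ha0)
    norm_num at h5
    refine le_trans (le_of_eq ?_) h5
    rw [Complex.norm_exp, Real.rpow_def_of_pos (by positivity), Real.log_mul ha0.ne' (by positivity),
      Real.log_pow]
    congr 1
    simp [hw]
    ring
  have hsw : ‖-s * ((w' - w : ℝ) : ℂ)‖ ≤ 7 / 2 * d := by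
    rw [norm_mul, norm_neg, Complex.norm_real, Real.norm_eq_abs]
    calc ‖s‖ * |w' - w| ≤ 7 / 6 * (3 * d) := by gcongr
      _ = _ := by ring
  have hdiff : ‖Complex.exp (-s * (w' : ℂ)) - Complex.exp (-s * (w : ℂ))‖ ≤
      ‖Complex.exp (-s * (w : ℂ))‖ * (7 * d) := by
    rw [show Complex.exp (-s * (w' : ℂ)) - Complex.exp (-s * (w : ℂ)) =
      Complex.exp (-s * (w : ℂ)) * (Complex.exp (-s * ((w' - w : ℝ) : ℂ)) - 1) by
        rw [mul_sub, ← Complex.exp_add]; push_cast; ring_nf, norm_mul]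
    gcongr
    refine (Complex.norm_exp_sub_one_le (by linarith)).trans ?_
    linarith
  have htent := (abs_tent_sub_le hη u' u).trans (div_le_div_of_nonneg_right hu hη.le)
  have hpow : (1 + a + t) ^ (-(5 / 2) : ℝ) * d ≤
      4 * V * E * (1 + a + t) ^ (-(7 / 2) : ℝ) := by
    rw [show (-(7 / 2) : ℝ) = -(5 / 2) - 1 by norm_num, Real.rpow_sub_one (by positivity), hd]
    rw [← mul_div_assoc, ← mul_div_assoc, div_le_div_iff₀ hρ (by positivity)]
    have h6 : 1 + a + t ≤ 2 * (a + t) := by nlinarith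
    have h7 : 0 ≤ (1 + a + t) ^ (-(5 / 2) : ℝ) * (2 * V * E) := by positivity
    nlinarith [mul_le_mul_of_nonneg_left h6 h7]
  rw [show (tent η u' : ℂ) * Complex.exp (-s * (w' : ℂ)) - tent η u * Complex.exp (-s * (w : ℂ)) =
    tent η u' * (Complex.exp (-s * (w' : ℂ)) - Complex.exp (-s * (w : ℂ))) +
      ((tent η u' - tent η u : ℝ) : ℂ) * Complex.exp (-s * (w : ℂ)) by push_cast; ring]
  calc _ ≤ 1 * (‖Complex.exp (-s * (w : ℂ))‖ * (7 * d)) +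
        2 * d / η * ‖Complex.exp (-s * (w : ℂ))‖ := by
        refine (norm_add_le _ _).trans (add_le_add ?_ ?_)
        · rw [norm_mul, Complex.norm_real, Real.norm_eq_abs, abs_of_nonneg (tent_nonneg _ _)]
          exact mul_le_mul (tent_le_one hη _) hdiff (norm_nonneg _) zero_le_one
        · rw [norm_mul, Complex.norm_real, Real.norm_eq_abs]
          gcongr
    _ = ‖Complex.exp (-s * (w : ℂ))‖ * d * (7 + 2 / η) := by ring
    _ ≤ (E * 2) ^ (5 / 2 : ℝ) * (1 + a + t) ^ (-(5 / 2) : ℝ) * d * (7 + 2 / η) := by gcongr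
    _ = (E * 2) ^ (5 / 2 : ℝ) * ((1 + a + t) ^ (-(5 / 2) : ℝ) * d) * (7 + 2 / η) := by ring
    _ ≤ (E * 2) ^ (5 / 2 : ℝ) * (4 * V * E * (1 + a + t) ^ (-(7 / 2) : ℝ)) * (7 + 2 / η) := by
        gcongr
    _ = _ := by rw [abs_of_pos ha0]; ring

lemma exists_norm_cone_sub_le_of_ne_zero {η : ℝ} (hη : 0 < η) {V : ℝ} (hV : 0 ≤ V) :
    ∃ C : ℝ, 0 ≤ C ∧ ∀ s : ℂ, 5 / 6 ≤ s.re → ‖s‖ ≤ 7 / 6 → ∀ a t a' t' : ℝ, |a' - a| ≤ V →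
      |t' - t| ≤ V → 0 ≤ t → (0 < a → 1 ≤ a * t ^ 2) → (0 < a' → 1 ≤ a' * t' ^ 2) →
      cone η s a t ≠ 0 →
      ‖cone η s a' t' - cone η s a t‖ ≤ C * (1 + |a| + t) ^ (-(7 / 2) : ℝ) := by
  set R := 16 * V * (1 + Real.exp η) + 2 with hR
  have hR0 : 0 < R := by positivity
  refine ⟨max (((1 + Real.exp η) * 2) ^ (5 / 2 : ℝ) * (4 * V * (1 + Real.exp η) * (7 + 2 / η)))
    (2 * R ^ (7 / 2 : ℝ)), le_max_of_le_right (by positivity), ?_⟩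
  intro s hs1 hs2 a t a' t' ha ht ht0 h h' h0
  have ha0 := (mem_cone_of_ne_zero hη ht0 h h0).1
  rcases le_or_gt (16 * V * (1 + Real.exp η) + 1) (a + t) with hfar | hnear
  · refine (norm_cone_sub_le_of_far hη hV hs1 hs2 ha ht ht0 h h0 hfar).trans ?_
    gcongr
    exact le_max_left _ _
  · have h1 := norm_cone_le_one (s := s) hη (by linarith) h
    have h2 := norm_cone_le_one (s := s) hη (by linarith) h'
    have h3 : ‖cone η s a' t' - cone η s a t‖ ≤ 2 := (norm_sub_le _ _).trans (by linarith)
    have h4 : 1 + |a| + t ≤ R := by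
      rw [abs_of_pos ha0, hR]
      linarith
    have h5 : 0 < 1 + |a| + t := by positivity
    calc _ ≤ 2 := h3
      _ = 2 * (R ^ (7 / 2 : ℝ) * R ^ (-(7 / 2) : ℝ)) := by
          rw [← Real.rpow_add hR0]
          norm_num
      _ ≤ 2 * (R ^ (7 / 2 : ℝ) * (1 + |a| + t) ^ (-(7 / 2) : ℝ)) := by
          have := Real.rpow_le_rpow_of_nonpos h5 h4 (by norm_num : (-(7 / 2) : ℝ) ≤ 0)
          gcongr
      _ = 2 * R ^ (7 / 2 : ℝ) * (1 + |a| + t) ^ (-(7 / 2) : ℝ) := by ring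
      _ ≤ _ := by
          gcongr
          exact le_max_right _ _

/-- The cut-off zeta summand varies slowly, uniformly for `s` in a neighbourhood of `1`. -/
lemma exists_norm_cone_sub_le {η : ℝ} (hη : 0 < η) {V : ℝ} (hV : 0 ≤ V) :
    ∃ C : ℝ, 0 ≤ C ∧ ∀ s : ℂ, 5 / 6 ≤ s.re → ‖s‖ ≤ 7 / 6 → ∀ a t a' t' : ℝ, |a' - a| ≤ V →
      |t' - t| ≤ V → 0 ≤ t → 0 ≤ t' → (0 < a → 1 ≤ a * t ^ 2) → (0 < a' → 1 ≤ a' * t' ^ 2) →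
      ‖cone η s a' t' - cone η s a t‖ ≤ C * (1 + |a| + t) ^ (-(7 / 2) : ℝ) := by
  obtain ⟨C, hC0, hC⟩ := exists_norm_cone_sub_le_of_ne_zero hη hV
  have hV1 : 0 < 1 + 2 * V := by positivity
  refine ⟨max C (C * (1 + 2 * V) ^ (7 / 2 : ℝ)), le_max_of_le_left hC0, ?_⟩
  intro s hs1 hs2 a t a' t' ha ht ht0 ht'0 h h'
  rcases ne_or_eq (cone η s a t) 0 with h0 | h0
  · refine (hC s hs1 hs2 a t a' t' ha ht ht0 h h' h0).trans ?_
    gcongr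
    exact le_max_left _ _
  rcases ne_or_eq (cone η s a' t') 0 with h0' | h0'
  · rw [norm_sub_rev]
    refine (hC s hs1 hs2 a' t' a t (abs_sub_comm a a' ▸ ha) (abs_sub_comm t t' ▸ ht) ht'0 h' h
      h0').trans ?_
    have h1 : (1 + |a| + t) / (1 + 2 * V) ≤ 1 + |a'| + t' := by
      rw [div_le_iff₀ hV1]
      have h2 : |a| ≤ |a'| + V := by
        have := abs_sub_abs_le_abs_sub a a'
        rw [abs_sub_comm] at this
        linarith
      have h3 : t ≤ t' + V := by linarith [(abs_le.mp ht).1]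
      nlinarith [mul_nonneg hV (abs_nonneg a'), mul_nonneg hV ht'0]
    have h2 : 0 < (1 + |a| + t) / (1 + 2 * V) := by positivity
    have h3 := Real.rpow_le_rpow_of_nonpos h2 h1 (by norm_num : (-(7 / 2) : ℝ) ≤ 0)
    rw [Real.div_rpow (by positivity) hV1.le, Real.rpow_neg hV1.le, div_inv_eq_mul] at h3
    calc _ ≤ C * ((1 + |a| + t) ^ (-(7 / 2) : ℝ) * (1 + 2 * V) ^ (7 / 2 : ℝ)) := by gcongr
      _ = C * (1 + 2 * V) ^ (7 / 2 : ℝ) * (1 + |a| + t) ^ (-(7 / 2) : ℝ) := by ring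
      _ ≤ _ := by
          gcongr
          exact le_max_right _ _
  · rw [h0, h0', sub_self, norm_zero]
    positivity

end Tent
end PureCubic

namespace PureCubic
open NumberField Filter Topology

/-- A number field with one real embedding `A`, one complex embedding `T` (up to conjugation), and
unit rank one, together with a generator of the units which are positive under `A`. -/
structure CubicData (K : Type*) [Field K] [NumberField K] where
  A : 𝓞 K →+* ℝ
  T : 𝓞 K →+* ℂ
  ε : (𝓞 K)ˣ
  absNorm_span : ∀ x, (Ideal.absNorm (Ideal.span {x}) : ℝ) = |A x| * ‖T x‖ ^ 2
  summable_rpow : ∀ τ : ℝ, 3 < τ → Summable fun x ↦ (1 + |A x| + ‖T x‖) ^ (-τ)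
  one_lt : 1 < A ε
  exists_zpow : ∀ u : (𝓞 K)ˣ, 0 < A u → ∃ k : ℤ, u = ε ^ k

namespace CubicData
variable {K : Type*} [Field K] [NumberField K] (D : CubicData K)

lemma one_le_norm {x : 𝓞 K} (hx : x ≠ 0) : 1 ≤ |D.A x| * ‖D.T x‖ ^ 2 := by
  rw [← D.absNorm_span, Nat.one_le_cast, Nat.one_le_iff_ne_zero, Ne, Ideal.absNorm_eq_zero_iff]
  simpa using hx

lemma one_le_of_pos {x : 𝓞 K} (hx : 0 < D.A x) : 1 ≤ D.A x * ‖D.T x‖ ^ 2 := by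
  have := D.one_le_norm (x := x) (by rintro rfl; simp at hx)
  rwa [abs_of_pos hx] at this

lemma A_ne_zero {x : 𝓞 K} (hx : x ≠ 0) : D.A x ≠ 0 := fun h ↦ by
  have := D.one_le_norm hx
  norm_num [h] at this

lemma norm_T_pos {x : 𝓞 K} (hx : x ≠ 0) : 0 < ‖D.T x‖ := norm_pos_iff.mpr fun h ↦ by
  have := D.one_le_norm hx
  norm_num [h] at this

/-- The width of a fundamental domain for the action of the units in logarithmic coordinates. -/
noncomputable def η : ℝ := Real.log (D.A D.ε) - Real.log ‖D.T D.ε‖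

lemma norm_ε : D.A D.ε * ‖D.T D.ε‖ ^ 2 = 1 := by
  have h := D.absNorm_span (D.ε : 𝓞 K)
  rw [(Ideal.span_singleton_eq_top (x := (D.ε : 𝓞 K))).mpr D.ε.isUnit, Ideal.absNorm_top,
    Nat.cast_one, abs_of_pos (by linarith [D.one_lt])] at h
  exact h.symm

lemma η_pos : 0 < D.η := by
  have h := D.norm_ε
  have h1 := D.one_lt
  have h2 : 0 < ‖D.T D.ε‖ := D.norm_T_pos D.ε.ne_zero
  have h3 : ‖D.T D.ε‖ < 1 := by
    by_contra h3
    have : 1 ≤ ‖D.T D.ε‖ ^ 2 := one_le_pow₀ (not_lt.mp h3)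
    nlinarith
  have := Real.log_pos h1
  have := Real.log_neg h2 h3
  unfold η
  linarith

/-- The summand of the smoothed zeta function. -/
noncomputable def term (s : ℂ) (x : 𝓞 K) : ℂ := cone D.η s (D.A x) ‖D.T x‖

lemma term_of_nonpos {x : 𝓞 K} (s : ℂ) (hx : ¬ 0 < D.A x) : D.term s x = 0 := if_neg hx

lemma summable_term {s : ℂ} (hs : 1 < s.re) : Summable fun x ↦ ‖D.term s x‖ :=
  ((D.summable_rpow (3 * s.re) (by linarith)).mul_left _).of_nonneg_of_le (fun _ ↦ norm_nonneg _)
    fun _ ↦ norm_cone_le_rpow D.η_pos (by linarith) le_rfl (norm_nonneg _) fun h ↦ D.one_le_of_pos h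

lemma differentiable_term (x : 𝓞 K) : Differentiable ℂ fun s ↦ D.term s x := by
  unfold term cone
  by_cases hx : 0 < D.A x
  · simp only [if_pos hx]
    have h := D.one_le_of_pos hx
    have h0 : ((D.A x * ‖D.T x‖ ^ 2 : ℝ) : ℂ) ≠ 0 := by
      rw [Complex.ofReal_ne_zero]
      linarith
    exact fun s ↦ (differentiableAt_id.neg.const_cpow (Or.inl h0)).const_mul _
  · simp only [if_neg hx]
    exact differentiable_const 0

lemma differentiableOn_tsum_shift {c g : 𝓞 K → ℂ} (hc : ∀ x, ‖c x‖ ≤ 1) (hg : ∀ x, ‖g x‖ ≤ 1)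
    (v : 𝓞 K) (hv : ∀ x, 0 < D.A x → 0 < D.A (x + v) → g (x + v) = g x) :
    DifferentiableOn ℂ
      (fun s ↦ ∑' x, c x * (g (x + v) * D.term s (x + v) - g x * D.term s x))
      (Metric.ball 1 (1 / 6)) := by
  obtain ⟨C, hC0, hC⟩ := exists_norm_cone_sub_le D.η_pos (V := |D.A v| + ‖D.T v‖) (by positivity)
  refine Complex.differentiableOn_tsum_of_summable_norm
    ((D.summable_rpow (7 / 2) (by norm_num)).mul_left C) (fun x ↦ ?_) Metric.isOpen_ball
    fun x s hs ↦ ?_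
  · exact ((((D.differentiable_term _).const_mul _).sub
      ((D.differentiable_term _).const_mul _)).const_mul _).differentiableOn
  rw [Metric.mem_ball, dist_eq_norm] at hs
  have hs1 : 5 / 6 ≤ s.re := by
    have h1 := (Complex.abs_re_le_norm (s - 1)).trans hs.le
    rw [Complex.sub_re, Complex.one_re, abs_le] at h1
    linarith [h1.1]
  have hs2 : ‖s‖ ≤ 7 / 6 := by
    have := norm_add_le (s - 1) 1
    rw [sub_add_cancel, norm_one] at this
    linarith
  have key := hC s hs1 hs2 (D.A x) ‖D.T x‖ (D.A (x + v)) ‖D.T (x + v)‖ (by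
      rw [map_add, add_sub_cancel_left]
      linarith [norm_nonneg (D.T v)]) (by
      have := abs_norm_sub_norm_le (D.T (x + v)) (D.T x)
      rw [map_add, add_sub_cancel_left] at this
      rw [map_add]
      linarith [abs_nonneg (D.A v)]) (norm_nonneg _) (norm_nonneg _)
      (fun h ↦ D.one_le_of_pos h) (fun h ↦ D.one_le_of_pos h)
  refine le_trans ?_ key
  rw [norm_mul]
  refine (mul_le_of_le_one_left (norm_nonneg _) (hc x)).trans ?_
  change ‖g (x + v) * D.term s (x + v) - g x * D.term s x‖ ≤ ‖D.term s (x + v) - D.term s x‖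
  by_cases h1 : 0 < D.A x
  · by_cases h2 : 0 < D.A (x + v)
    · rw [hv x h1 h2, ← mul_sub, norm_mul]
      exact mul_le_of_le_one_left (norm_nonneg _) (hg x)
    · rw [D.term_of_nonpos s h2, mul_zero, zero_sub, zero_sub, norm_neg, norm_neg, norm_mul]
      exact mul_le_of_le_one_left (norm_nonneg _) (hg x)
  · rw [D.term_of_nonpos s h1, mul_zero, sub_zero, sub_zero, norm_mul]
    exact mul_le_of_le_one_left (norm_nonneg _) (hg _)

lemma A_zpow (k : ℤ) : D.A ((D.ε ^ k : (𝓞 K)ˣ) : 𝓞 K) = D.A D.ε ^ k := by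
  have := congrArg Units.val (map_zpow (Units.map (D.A : 𝓞 K →* ℝ)) D.ε k)
  rw [Units.val_zpow_eq_zpow_val] at this
  exact this

lemma T_zpow (k : ℤ) : D.T ((D.ε ^ k : (𝓞 K)ˣ) : 𝓞 K) = D.T D.ε ^ k := by
  have := congrArg Units.val (map_zpow (Units.map (D.T : 𝓞 K →* ℂ)) D.ε k)
  rw [Units.val_zpow_eq_zpow_val] at this
  exact this

lemma hasSum_term_zpow_mul (s : ℂ) {x : 𝓞 K} (hx : 0 < D.A x) :
    HasSum (fun k : ℤ ↦ D.term s (((D.ε ^ k : (𝓞 K)ˣ) : 𝓞 K) * x))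
      ((Ideal.absNorm (Ideal.span {x}) : ℂ) ^ (-s)) := by
  have hx0 : x ≠ 0 := by rintro rfl; simp at hx
  have hT := D.norm_T_pos hx0
  have hAε : 0 < D.A D.ε := by linarith [D.one_lt]
  have hTε : 0 < ‖D.T D.ε‖ := D.norm_T_pos D.ε.ne_zero
  have hN : (Ideal.absNorm (Ideal.span {x}) : ℂ) = ((D.A x * ‖D.T x‖ ^ 2 : ℝ) : ℂ) := by
    have := D.absNorm_span x
    rw [abs_of_pos hx] at this
    exact_mod_cast congrArg (fun t : ℝ ↦ (t : ℂ)) this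
  have h := ((Complex.hasSum_ofReal.mpr (hasSum_tent D.η_pos
    (Real.log (D.A x) - Real.log ‖D.T x‖))).mul_right
      (((D.A x * ‖D.T x‖ ^ 2 : ℝ) : ℂ) ^ (-s)))
  rw [Complex.ofReal_one, one_mul] at h
  rw [hN]
  refine h.congr_fun fun k ↦ ?_
  have hA : D.A (((D.ε ^ k : (𝓞 K)ˣ) : 𝓞 K) * x) = D.A D.ε ^ k * D.A x := by
    rw [map_mul, D.A_zpow]
  have hT' : ‖D.T (((D.ε ^ k : (𝓞 K)ˣ) : 𝓞 K) * x)‖ = ‖D.T D.ε‖ ^ k * ‖D.T x‖ := by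
    rw [map_mul, D.T_zpow, norm_mul, norm_zpow]
  have hprod : D.A D.ε ^ k * D.A x * (‖D.T D.ε‖ ^ k * ‖D.T x‖) ^ 2 = D.A x * ‖D.T x‖ ^ 2 := by
    have : (D.A D.ε * ‖D.T D.ε‖ ^ 2) ^ k = 1 := by rw [D.norm_ε, one_zpow]
    rw [mul_zpow, ← zpow_natCast, ← zpow_mul, mul_comm ((2 : ℕ) : ℤ), zpow_mul, zpow_natCast] at this
    linear_combination (D.A x * ‖D.T x‖ ^ 2) * this
  rw [term, cone, hA, hT', if_pos (mul_pos (zpow_pos hAε k) hx), hprod,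
    Real.log_mul (zpow_pos hAε k).ne' hx.ne', Real.log_mul (zpow_pos hTε k).ne' hT.ne',
    Real.log_zpow, Real.log_zpow]
  congr 3
  unfold η
  ring

lemma exists_pos_generator {I : Ideal (𝓞 K)} (hI : I ≠ 0) (hp : I.IsPrincipal) :
    ∃ x, 0 < D.A x ∧ Ideal.span {x} = I := by
  obtain ⟨x, hx⟩ := hp
  rw [Ideal.submodule_span_eq] at hx
  have hx0 : x ≠ 0 := by
    rintro rfl
    exact hI (by simpa using hx)
  rcases lt_or_gt_of_ne (D.A_ne_zero hx0) with h | h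
  · exact ⟨-x, by simpa using h, by rw [Ideal.span_singleton_neg, hx]⟩
  · exact ⟨x, h, hx.symm⟩

open Classical in
lemma hasSum_fiber (s : ℂ) (I : Ideal (𝓞 K)) :
    HasSum (fun x : (fun x : 𝓞 K ↦ Ideal.span {x}) ⁻¹' {I} ↦ D.term s x)
      (if I ≠ 0 ∧ I.IsPrincipal then (Ideal.absNorm I : ℂ) ^ (-s) else 0) := by
  split_ifs with h
  · obtain ⟨x, hx, rfl⟩ := D.exists_pos_generator h.1 h.2
    have hx0 : x ≠ 0 := by rintro rfl; simp at hx
    let i : ℤ → (fun x : 𝓞 K ↦ Ideal.span {x}) ⁻¹' {Ideal.span {x}} := fun k ↦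
      ⟨((D.ε ^ k : (𝓞 K)ˣ) : 𝓞 K) * x,
        Ideal.span_singleton_mul_left_unit (D.ε ^ k).isUnit x⟩
    have hi : Function.Injective i := fun k l hkl ↦ by
      have h1 := mul_right_cancel₀ hx0 (Subtype.ext_iff.mp hkl)
      have h2 := congrArg D.A h1
      rw [D.A_zpow, D.A_zpow] at h2
      exact zpow_right_injective₀ (by linarith [D.one_lt]) D.one_lt.ne' h2
    rw [← hi.hasSum_iff]
    · exact D.hasSum_term_zpow_mul s hx
    · rintro ⟨y, hy⟩ hyi
      by_cases hAy : 0 < D.A y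
      · exfalso
        obtain ⟨u, hu⟩ := Ideal.span_singleton_eq_span_singleton.mp
          (show Ideal.span {x} = Ideal.span {y} from Eq.symm hy)
        have hAu : 0 < D.A u := by
          rw [← hu, map_mul] at hAy
          exact pos_of_mul_pos_right hAy hx.le
        obtain ⟨k, rfl⟩ := D.exists_zpow u hAu
        exact hyi ⟨k, Subtype.ext ((mul_comm _ _).trans hu)⟩
      · exact D.term_of_nonpos s hAy
  · convert hasSum_zero with x
    obtain ⟨x, hx⟩ := x
    by_cases hAx : 0 < D.A x
    · refine absurd ⟨?_, ⟨x, (Eq.symm hx)⟩⟩ h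
      rintro rfl
      have : x = 0 := by simpa using hx
      simp [this] at hAx
    · exact D.term_of_nonpos s hAx

open Classical in
/-- The smoothed sum over elements equals the sum over principal ideals. -/
lemma tsum_mul_term {s : ℂ} (hs : 1 < s.re) {h : Ideal (𝓞 K) → ℂ} (hh : ∀ I, ‖h I‖ ≤ 1) :
    ∑' x, h (Ideal.span {x}) * D.term s x =
      ∑' I : Ideal (𝓞 K), if I ≠ 0 ∧ I.IsPrincipal then h I * (Ideal.absNorm I : ℂ) ^ (-s) else 0 := by
  have hsum : Summable fun x ↦ h (Ideal.span {x}) * D.term s x :=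
    Summable.of_norm ((D.summable_term hs).of_nonneg_of_le (fun _ ↦ norm_nonneg _) fun x ↦ by
      rw [norm_mul]
      exact mul_le_of_le_one_left (norm_nonneg _) (hh _))
  rw [← (hsum.hasSum.tsum_fiberwise fun x : 𝓞 K ↦ Ideal.span {x}).tsum_eq]
  refine tsum_congr fun I ↦ ?_
  have := ((D.hasSum_fiber s I).mul_left (h I)).tsum_eq
  rw [mul_ite, mul_zero] at this
  rw [← this]
  refine tsum_congr fun x ↦ ?_
  rw [show Ideal.span {(x : 𝓞 K)} = I from x.2]

end CubicData
end PureCubic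

namespace PureCubic
open NumberField Filter Topology

section
variable {K : Type*} [Field K] [NumberField K]

open Classical in
/-- The part of the `L`-series of `Ψ` supported on the ideals `𝔞` for which `𝔟 * 𝔞` is principal. -/
noncomputable def partialL (Ψ : Ideal (𝓞 K) →*₀ ℂ) (𝔟 : Ideal (𝓞 K)) (s : ℂ) : ℂ :=
  ∑' 𝔞 : Ideal (𝓞 K), if (𝔟 * 𝔞).IsPrincipal then twist Ψ s 𝔞 else 0

lemma sum_partialL {Ψ : Ideal (𝓞 K) →*₀ ℂ} (hΨ : ∀ I, ‖Ψ I‖ ≤ 1) {s : ℂ} (hs : 1 < s.re)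
    {𝔟 : ClassGroup (𝓞 K) → Ideal (𝓞 K)}
    (h𝔟 : ∀ 𝔞 ≠ 0, ∃ C, ∀ C', (𝔟 C' * 𝔞).IsPrincipal ↔ C' = C) :
    ∑ C, partialL Ψ (𝔟 C) s = idealL Ψ s := by
  classical
  unfold partialL
  rw [← Summable.tsum_finsetSum]
  · refine tsum_congr fun 𝔞 ↦ ?_
    rcases eq_or_ne 𝔞 0 with rfl | h
    · simp only [map_zero, ite_self, Finset.sum_const_zero]
    · obtain ⟨C, hC⟩ := h𝔟 𝔞 h
      simp [hC]
  · intro C _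
    refine Summable.of_norm ((summable_norm_twist hΨ hs).of_nonneg_of_le
      (fun _ ↦ norm_nonneg _) fun 𝔞 ↦ ?_)
    split_ifs
    · exact le_rfl
    · rw [norm_zero]
      exact norm_nonneg _

lemma exists_residue_lift {R : Type*} [CommRing R] {m : R} {𝔟 𝔠 : Ideal R} (h𝔟𝔠 : IsCoprime 𝔟 𝔠)
    (hm𝔠 : IsCoprime (Ideal.span {m}) 𝔠) : ∃ v : R ⧸ 𝔠 → R, (∀ κ, m ∣ v κ) ∧
      ∀ x κ, x - v κ ∈ 𝔠 * 𝔟 ↔ x ∈ 𝔟 ∧ Ideal.Quotient.mk 𝔠 x = κ := by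
  obtain ⟨a, ha, b, hb, hab⟩ := Ideal.isCoprime_iff_exists.mp (hm𝔠.mul_left h𝔟𝔠)
  have hvb (κ : R ⧸ 𝔠) : a * κ.out ∈ 𝔟 := Ideal.mul_mem_right _ _ (Ideal.mul_le_right ha)
  have hvc (κ : R ⧸ 𝔠) : Ideal.Quotient.mk 𝔠 (a * κ.out) = κ := by
    have h1 : Ideal.Quotient.mk 𝔠 a = 1 := by
      rw [← map_one (Ideal.Quotient.mk 𝔠), ← hab, map_add, Ideal.Quotient.eq_zero_iff_mem.mpr hb,
        add_zero]
    rw [map_mul, h1, one_mul]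
    exact Quotient.out_eq κ
  refine ⟨fun κ ↦ a * κ.out, fun κ ↦ Ideal.mem_span_singleton.mp
    (Ideal.mul_mem_right _ _ (Ideal.mul_le_left ha)), fun x κ ↦ ?_⟩
  rw [Ideal.mul_eq_inf_of_isCoprime h𝔟𝔠.symm, Ideal.mem_inf, ← Ideal.Quotient.eq, hvc, and_comm,
    sub_eq_add_neg, Ideal.add_mem_iff_left _ (neg_mem (hvb κ))]

lemma isPrincipal_mul_iff (𝔞 𝔟 : nonZeroDivisors (Ideal (𝓞 K))) :
    ((𝔟 : Ideal (𝓞 K)) * 𝔞).IsPrincipal ↔ ClassGroup.mk0 𝔟 = (ClassGroup.mk0 𝔞)⁻¹ := by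
  rw [eq_inv_iff_mul_eq_one, ← map_mul]
  exact (ClassGroup.mk0_eq_one_iff (SetLike.coe_mem (𝔟 * 𝔞))).symm

lemma exists_mk0_eq_of_isCoprime {𝔪 : Ideal (𝓞 K)} (h𝔪 : 𝔪 ≠ 0) (C : ClassGroup (𝓞 K)) :
    ∃ 𝔟 : nonZeroDivisors (Ideal (𝓞 K)), ClassGroup.mk0 𝔟 = C ∧ IsCoprime (𝔟 : Ideal (𝓞 K)) 𝔪 := by
  by_cases h1 : 𝔪 = ⊤
  · obtain ⟨𝔟, rfl⟩ := ClassGroup.mk0_surjective C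
    exact ⟨𝔟, rfl, by rw [Ideal.isCoprime_iff_sup_eq, h1, sup_top_eq]⟩
  obtain ⟨J, hJ⟩ := ClassGroup.mk0_surjective C⁻¹
  have hJ0 : (J : Ideal (𝓞 K)) ≠ 0 := nonZeroDivisors.ne_zero J.2
  obtain ⟨a, ha⟩ := IsDedekindDomain.exists_sup_span_eq
    (Ideal.mul_le_right : 𝔪 * (J : Ideal (𝓞 K)) ≤ J) (mul_ne_zero h𝔪 hJ0)
  obtain ⟨𝔟, h𝔟⟩ := Ideal.dvd_iff_le.mpr (le_sup_right.trans ha.le)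
  have hsup : 𝔟 ⊔ 𝔪 = ⊤ := by
    apply mul_left_cancel₀ hJ0
    rw [Ideal.mul_sup, ← h𝔟, mul_comm (J : Ideal (𝓞 K)) 𝔪, sup_comm, ha, ← Ideal.one_eq_top, mul_one]
  have h𝔟0 : 𝔟 ≠ 0 := by
    rintro rfl
    exact h1 (by simpa using hsup)
  refine ⟨⟨𝔟, mem_nonZeroDivisors_of_ne_zero h𝔟0⟩, ?_, Ideal.isCoprime_iff_sup_eq.mpr hsup⟩
  rw [← inv_inv C, ← hJ]
  refine (isPrincipal_mul_iff J _).mp ⟨a, ?_⟩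
  rw [Ideal.submodule_span_eq, h𝔟, mul_comm]

lemma analyticAt_twist (Ψ : Ideal (𝓞 K) →*₀ ℂ) (I : Ideal (𝓞 K)) (s : ℂ) :
    AnalyticAt ℂ (fun s ↦ twist Ψ s I) s :=
  (Differentiable.analyticAt (f := fun s ↦ twist Ψ s I)
    (fun z ↦ (hasDerivAt_twist z I).differentiableAt) s)

end

namespace CubicData
variable {K : Type*} [Field K] [NumberField K] (D : CubicData K) {Ψ : Ideal (𝓞 K) →*₀ ℂ}

open Classical in
/-- The sum of the terms of the `L`-series of `Ψ` over the cone, restricted to elements of `𝔟`. -/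
noncomputable def coneL (Ψ : Ideal (𝓞 K) →*₀ ℂ) (𝔟 : Ideal (𝓞 K)) (s : ℂ) : ℂ :=
  ∑' x : 𝓞 K, (if x ∈ 𝔟 then 1 else 0) * (Ψ (Ideal.span {x}) * D.term s x)

lemma coneL_eq (hΨ : ∀ I, ‖Ψ I‖ ≤ 1) {𝔟 : Ideal (𝓞 K)} (h𝔟 : 𝔟 ≠ 0) {s : ℂ} (hs : 1 < s.re) :
    D.coneL Ψ 𝔟 s = twist Ψ s 𝔟 * partialL Ψ 𝔟 s := by
  classical
  have h := D.tsum_mul_term hs (h := fun I ↦ if I ≤ 𝔟 then Ψ I else 0) fun I ↦ by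
    split_ifs
    · exact hΨ I
    · simp
  have h1 : D.coneL Ψ 𝔟 s = ∑' x : 𝓞 K,
      (if Ideal.span {x} ≤ 𝔟 then Ψ (Ideal.span {x}) else 0) * D.term s x := by
    refine tsum_congr fun x ↦ ?_
    rw [Ideal.span_singleton_le_iff_mem]
    split_ifs <;> simp
  rw [h1, h, partialL, ← tsum_mul_left, ← (mul_right_injective₀ h𝔟).tsum_eq]
  · refine tsum_congr fun 𝔞 ↦ ?_
    rcases eq_or_ne 𝔞 0 with rfl | h0
    · simp only [mul_zero, map_zero, ne_eq, not_true, false_and, if_false, ite_self]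
    · rw [if_pos (Ideal.mul_le_left : 𝔟 * 𝔞 ≤ 𝔟), ← twist_apply, map_mul, mul_ite, mul_zero]
      simp only [ne_eq, mul_ne_zero h𝔟 h0, not_false_eq_true, true_and]
  · intro I hI
    rw [Function.mem_support] at hI
    have : I ≤ 𝔟 := by
      by_contra h
      simp [h] at hI
    obtain ⟨J, rfl⟩ := Ideal.dvd_iff_le.mpr this
    exact ⟨J, rfl⟩

lemma summable_indicator_mul_term (hΨ : ∀ I, ‖Ψ I‖ ≤ 1) {c : 𝓞 K → ℂ} (hc : ∀ x, ‖c x‖ ≤ 1)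
    {s : ℂ} (hs : 1 < s.re) : Summable fun x ↦ c x * (Ψ (Ideal.span {x}) * D.term s x) :=
  Summable.of_norm ((D.summable_term hs).of_nonneg_of_le (fun _ ↦ norm_nonneg _) fun x ↦ by
    rw [norm_mul, norm_mul]
    exact (mul_le_of_le_one_left (by positivity) (hc x)).trans
      (mul_le_of_le_one_left (norm_nonneg _) (hΨ _)))

lemma exists_differentiableOn_coneL_sub (hΨ : ∀ I, ‖Ψ I‖ ≤ 1) {m : 𝓞 K}
    (hper : ∀ x y, m ∣ x - y → 0 < D.A x → 0 < D.A y → Ψ (Ideal.span {x}) = Ψ (Ideal.span {y}))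
    {𝔟 𝔠 : Ideal (𝓞 K)} (h𝔠 : 𝔠 ≠ 0) (h𝔟𝔠 : IsCoprime 𝔟 𝔠) (hm𝔠 : IsCoprime (Ideal.span {m}) 𝔠) :
    ∃ H : ℂ → ℂ, DifferentiableOn ℂ H (Metric.ball 1 (1 / 6)) ∧ ∀ s : ℂ, 1 < s.re →
      D.coneL Ψ 𝔟 s - Ideal.absNorm 𝔠 * D.coneL Ψ (𝔠 * 𝔟) s = H s := by
  classical
  have := Ideal.finiteQuotientOfFreeOfNeBot 𝔠 h𝔠
  have := Fintype.ofFinite (𝓞 K ⧸ 𝔠)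
  obtain ⟨v, hvm, hiff⟩ := exists_residue_lift h𝔟𝔠 hm𝔠
  have hnorm (p : Prop) [Decidable p] : ‖(if p then 1 else 0 : ℂ)‖ ≤ 1 := by
    split_ifs <;> simp
  refine ⟨fun s ↦ ∑ κ, ∑' x, (if x ∈ 𝔠 * 𝔟 then 1 else 0) *
    (Ψ (Ideal.span {x + v κ}) * D.term s (x + v κ) - Ψ (Ideal.span {x}) * D.term s x),
    DifferentiableOn.fun_sum fun κ _ ↦ ?_, fun s hs ↦ ?_⟩
  · refine D.differentiableOn_tsum_shift (g := fun x ↦ Ψ (Ideal.span {x})) (fun _ ↦ hnorm _)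
      (fun _ ↦ hΨ _) (v κ) fun x h1 h2 ↦ hper _ _ ?_ h2 h1
    rw [add_sub_cancel_left]
    exact hvm κ
  · have h1 : D.coneL Ψ 𝔟 s = ∑ κ, ∑' x, (if x ∈ 𝔠 * 𝔟 then 1 else 0) *
        (Ψ (Ideal.span {x + v κ}) * D.term s (x + v κ)) := by
      calc _ = ∑' x, ∑ κ, (if x - v κ ∈ 𝔠 * 𝔟 then 1 else 0) *
            (Ψ (Ideal.span {x}) * D.term s x) := by
            refine tsum_congr fun x ↦ ?_
            rw [← Finset.sum_mul]
            congr 1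
            simp only [hiff]
            by_cases hx : x ∈ 𝔟 <;> simp [hx]
        _ = ∑ κ, ∑' x, (if x - v κ ∈ 𝔠 * 𝔟 then 1 else 0) *
            (Ψ (Ideal.span {x}) * D.term s x) :=
            Summable.tsum_finsetSum fun κ _ ↦
              D.summable_indicator_mul_term hΨ (fun _ ↦ hnorm _) hs
        _ = _ := by
            refine Finset.sum_congr rfl fun κ _ ↦ ?_
            rw [← (Equiv.addRight (v κ)).tsum_eq]
            simp
    have h2 : (Ideal.absNorm 𝔠 : ℂ) * D.coneL Ψ (𝔠 * 𝔟) s = ∑ κ : 𝓞 K ⧸ 𝔠, ∑' x,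
        (if x ∈ 𝔠 * 𝔟 then 1 else 0) * (Ψ (Ideal.span {x}) * D.term s x) := by
      rw [Finset.sum_const, nsmul_eq_mul, Finset.card_univ, ← Nat.card_eq_fintype_card,
        Ideal.absNorm_apply, Submodule.cardQuot_apply]
      rfl
    rw [h1, h2, ← Finset.sum_sub_distrib]
    refine Finset.sum_congr rfl fun κ _ ↦ ?_
    rw [← Summable.tsum_sub _ (D.summable_indicator_mul_term hΨ (fun _ ↦ hnorm _) hs)]
    · simp only [mul_sub]
    · have := (Equiv.addRight (v κ)).summable_iff.mpr (D.summable_indicator_mul_term hΨ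
        (c := fun x ↦ if x - v κ ∈ 𝔠 * 𝔟 then 1 else 0) (fun _ ↦ hnorm _) hs)
      simpa [Function.comp_def] using this

/-- The `L`-series of `Ψ`, multiplied by a suitable Euler factor, is analytic at `1`. -/
lemma exists_analyticAt_mul_idealL (hΨ : ∀ I, ‖Ψ I‖ ≤ 1) {m : 𝓞 K} (hm : m ≠ 0)
    (hper : ∀ x y, m ∣ x - y → 0 < D.A x → 0 < D.A y → Ψ (Ideal.span {x}) = Ψ (Ideal.span {y}))
    (hcop : ∀ 𝔟 ≠ 0, IsCoprime 𝔟 (Ideal.span {m}) → Ψ 𝔟 ≠ 0)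
    {𝔠 : Ideal (𝓞 K)} (h𝔠 : 𝔠 ≠ 0) (hm𝔠 : IsCoprime 𝔠 (Ideal.span {m})) :
    ∃ H : ℂ → ℂ, AnalyticAt ℂ H 1 ∧ ∀ s : ℂ, 1 < s.re →
      (1 - Ideal.absNorm 𝔠 * twist Ψ s 𝔠) * idealL Ψ s = H s := by
  have hm' : Ideal.span {m} ≠ 0 := by simpa using hm
  choose 𝔟 h𝔟 hcop𝔟 using exists_mk0_eq_of_isCoprime (mul_ne_zero hm' h𝔠)
  have h𝔟0 (C) : (𝔟 C : Ideal (𝓞 K)) ≠ 0 := nonZeroDivisors.ne_zero (𝔟 C).2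
  have htw (C s) : twist Ψ s (𝔟 C : Ideal (𝓞 K)) ≠ 0 := by
    rw [twist_apply]
    refine mul_ne_zero (hcop _ (h𝔟0 C) (hcop𝔟 C).of_mul_right_left) ?_
    rw [Ne, Complex.cpow_eq_zero_iff, Nat.cast_eq_zero, Ideal.absNorm_eq_zero_iff]
    exact fun h ↦ h𝔟0 C h.1
  choose H hH hHs using fun C ↦ D.exists_differentiableOn_coneL_sub hΨ hper h𝔠
    (hcop𝔟 C).of_mul_right_right hm𝔠.symm
  refine ⟨fun s ↦ ∑ C, H C s / twist Ψ s (𝔟 C), Finset.analyticAt_fun_sum _ fun C _ ↦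
    ((hH C).analyticAt (Metric.ball_mem_nhds _ (by norm_num))).fun_div (analyticAt_twist _ _ _)
      (htw C 1), fun s hs ↦ ?_⟩
  have h1 := sum_partialL hΨ hs (𝔟 := fun C ↦ (𝔟 C : Ideal (𝓞 K))) fun 𝔞 h ↦
    ⟨(ClassGroup.mk0 ⟨𝔞, mem_nonZeroDivisors_of_ne_zero h⟩)⁻¹, fun C ↦ by
      have := isPrincipal_mul_iff ⟨𝔞, mem_nonZeroDivisors_of_ne_zero h⟩ (𝔟 C)
      rwa [h𝔟] at this⟩
  have h2 := sum_partialL hΨ hs (𝔟 := fun C ↦ 𝔠 * (𝔟 C : Ideal (𝓞 K))) fun 𝔞 h ↦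
    ⟨(ClassGroup.mk0 ⟨𝔠 * 𝔞, mem_nonZeroDivisors_of_ne_zero (mul_ne_zero h𝔠 h)⟩)⁻¹, fun C ↦ by
      have := isPrincipal_mul_iff ⟨𝔠 * 𝔞, mem_nonZeroDivisors_of_ne_zero (mul_ne_zero h𝔠 h)⟩ (𝔟 C)
      rw [h𝔟] at this
      rwa [mul_comm 𝔠, mul_assoc]⟩
  rw [sub_mul, one_mul]
  nth_rewrite 1 [← h1]
  rw [← h2, Finset.mul_sum, ← Finset.sum_sub_distrib]
  refine Finset.sum_congr rfl fun C _ ↦ ?_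
  rw [← hHs C s hs, D.coneL_eq hΨ (h𝔟0 C) hs, D.coneL_eq hΨ (mul_ne_zero h𝔠 (h𝔟0 C)) hs, map_mul,
    eq_div_iff (htw C s)]
  ring

end CubicData
end PureCubic

namespace PureCubic
open NumberField Filter Topology

section
variable {K : Type*} [Field K] [NumberField K]

/-- The terms of the Dirichlet series of the von Mangoldt function, indexed by prime powers. -/
noncomputable def primePow (σ : ℝ) (q : Ideal (𝓞 K) × ℕ) : ℝ :=
  primeWeight q.1 * (Ideal.absNorm (q.1 ^ (q.2 + 1)) : ℝ) ^ (-σ)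

lemma primePow_nonneg (σ : ℝ) (q : Ideal (𝓞 K) × ℕ) : 0 ≤ primePow σ q :=
  mul_nonneg (primeWeight_nonneg _) (by positivity)

lemma primePow_of_not_prime (σ : ℝ) {q : Ideal (𝓞 K) × ℕ} (hq : ¬ Prime q.1) : primePow σ q = 0 := by
  rw [primePow, primeWeight, if_neg hq, zero_mul]

lemma two_le_absNorm {v : Ideal (𝓞 K)} (hv : Prime v) : 2 ≤ Ideal.absNorm v := by
  have h0 : Ideal.absNorm v ≠ 0 := by
    rw [Ne, Ideal.absNorm_eq_zero_iff]
    exact hv.ne_zero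
  have h1 : Ideal.absNorm v ≠ 1 := by
    rw [Ne, Ideal.absNorm_eq_one_iff, ← Ideal.isUnit_iff]
    exact hv.not_isUnit
  omega

lemma primePow_anti {σ τ : ℝ} (h : τ ≤ σ) (q : Ideal (𝓞 K) × ℕ) : primePow σ q ≤ primePow τ q := by
  by_cases hq : Prime q.1
  · refine mul_le_mul_of_nonneg_left (Real.rpow_le_rpow_of_exponent_le ?_ (by linarith))
      (primeWeight_nonneg _)
    rw [map_pow]
    exact_mod_cast Nat.one_le_pow _ _ (by have := two_le_absNorm hq; omega)
  · rw [primePow_of_not_prime σ hq, primePow_of_not_prime τ hq]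

lemma primePow_mul (f : Ideal (𝓞 K) →*₀ ℂ) (σ : ℝ) (q : Ideal (𝓞 K) × ℕ) :
    (primePow σ q : ℂ) * f (q.1 ^ (q.2 + 1)) = (primeWeight q.1 : ℂ) * twist f σ (q.1 ^ (q.2 + 1)) := by
  rw [twist_apply, primePow, Complex.ofReal_mul, Complex.ofReal_cpow (by positivity)]
  push_cast
  ring

lemma idealΛ_ofReal (f : Ideal (𝓞 K) →*₀ ℂ) (σ : ℝ) :
    idealΛ f σ = ∑' q : Ideal (𝓞 K) × ℕ, (primePow σ q : ℂ) * f (q.1 ^ (q.2 + 1)) :=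
  tsum_congr fun q ↦ (primePow_mul f σ q).symm

open Classical in
/-- The multiplicative function equal to one on nonzero ideals. -/
noncomputable def oneHom : Ideal (𝓞 K) →*₀ ℂ where
  toFun I := if I = 0 then 0 else 1
  map_zero' := if_pos rfl
  map_one' := if_neg one_ne_zero
  map_mul' I J := by
    rcases eq_or_ne I 0 with rfl | hI
    · simp only [zero_mul, if_true]
    rcases eq_or_ne J 0 with rfl | hJ
    · simp only [mul_zero, if_true]
    rw [if_neg hI, if_neg hJ, if_neg (mul_ne_zero hI hJ), one_mul]

omit [NumberField K] in
lemma oneHom_apply {I : Ideal (𝓞 K)} (hI : I ≠ 0) : oneHom I = 1 := if_neg hI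

omit [NumberField K] in
lemma norm_oneHom_le (I : Ideal (𝓞 K)) : ‖oneHom I‖ ≤ 1 := by
  rcases eq_or_ne I 0 with rfl | hI
  · simp only [map_zero, norm_zero, zero_le_one]
  · rw [oneHom_apply hI, norm_one]

lemma primePow_mul_oneHom (σ : ℝ) (q : Ideal (𝓞 K) × ℕ) :
    (primePow σ q : ℂ) * oneHom (q.1 ^ (q.2 + 1)) = primePow σ q := by
  by_cases hq : Prime q.1
  · rw [oneHom_apply (pow_ne_zero _ hq.ne_zero), mul_one]
  · rw [primePow_of_not_prime σ hq, Complex.ofReal_zero, zero_mul]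

lemma summable_primePow {σ : ℝ} (hσ : 1 < σ) : Summable (primePow (K := K) σ) := by
  have h := summable_primeWeight_mul (twist (K := K) oneHom σ)
    (summable_norm_twist_mul_log norm_oneHom_le (by simpa using hσ))
  refine h.congr fun q ↦ ?_
  rw [← primePow_mul, primePow_mul_oneHom, Complex.norm_real, Real.norm_of_nonneg (primePow_nonneg _ _)]

lemma summable_primePow_mul {g : Ideal (𝓞 K) → ℂ} (hg : ∀ I, ‖g I‖ ≤ 1) {σ : ℝ} (hσ : 1 < σ) :
    Summable fun q : Ideal (𝓞 K) × ℕ ↦ (primePow σ q : ℂ) * g (q.1 ^ (q.2 + 1)) :=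
  Summable.of_norm ((summable_primePow hσ).of_nonneg_of_le (fun _ ↦ norm_nonneg _) fun q ↦ by
    rw [norm_mul, Complex.norm_real, Real.norm_of_nonneg (primePow_nonneg _ _)]
    exact mul_le_of_le_one_right (primePow_nonneg _ _) (hg _))

lemma summable_primePow_add_one : Summable fun q : Ideal (𝓞 K) × ℕ ↦ primePow 1 (q.1, q.2 + 1) := by
  have h := (summable_rpow_mul_log (K := K) one_lt_two).mul_of_nonneg
    (summable_geometric_two) (fun I ↦ mul_nonneg (by positivity) (Real.log_natCast_nonneg _))
    (fun _ ↦ by positivity)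
  refine h.of_nonneg_of_le (fun _ ↦ primePow_nonneg _ _) fun ⟨v, i⟩ ↦ ?_
  by_cases hv : Prime v
  · have h2 := two_le_absNorm hv
    have h2' : (2 : ℝ) ≤ Ideal.absNorm v := by exact_mod_cast h2
    have e : (Ideal.absNorm (v ^ (i + 1 + 1)) : ℝ) ^ (-1 : ℝ) =
        (Ideal.absNorm v : ℝ) ^ (-2 : ℝ) * (1 / (Ideal.absNorm v : ℝ)) ^ i := by
      rw [map_pow, Real.rpow_neg_one, Real.rpow_neg (by positivity), Real.rpow_two, one_div, inv_pow,
        ← mul_inv, Nat.cast_pow]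
      ring
    dsimp only
    rw [primePow, e, mul_comm, mul_right_comm]
    gcongr
    exact primeWeight_le _
  · rw [primePow_of_not_prime 1 hv]
    have := Real.log_natCast_nonneg (Ideal.absNorm v)
    dsimp only
    positivity

/-- Prime powers in a set whose first-degree part is sparse do not contribute to the residue. -/
lemma tendsto_sub_one_mul_tsum_indicator {S : Set (Ideal (𝓞 K) × ℕ)}
    (hS : Summable fun v : Ideal (𝓞 K) ↦ S.indicator (primePow 1) (v, 0)) :
    Tendsto (fun σ : ℝ ↦ (σ - 1) * ∑' q, S.indicator (primePow σ) q) (𝓝[>] 1) (𝓝 0) := by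
  have hsum : Summable (S.indicator (primePow (K := K) 1)) := by
    let e : Ideal (𝓞 K) ⊕ Ideal (𝓞 K) × ℕ ≃ Ideal (𝓞 K) × ℕ :=
      { toFun := Sum.elim (fun v ↦ (v, 0)) fun q ↦ (q.1, q.2 + 1)
        invFun := fun q ↦ match q with
          | (v, 0) => Sum.inl v
          | (v, i + 1) => Sum.inr (v, i)
        left_inv := by rintro (v | ⟨v, i⟩) <;> rfl
        right_inv := by rintro ⟨v, _ | i⟩ <;> rfl }
    rw [← e.summable_iff]
    refine Summable.sum _ hS ?_
    refine summable_primePow_add_one.of_nonneg_of_le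
      (fun q ↦ Set.indicator_nonneg (fun _ _ ↦ primePow_nonneg _ _) _)
      fun q ↦ Set.indicator_le_self' (fun _ _ ↦ primePow_nonneg _ _) _
  have h1 : Tendsto (fun σ : ℝ ↦ (σ - 1) * ∑' q, S.indicator (primePow (K := K) 1) q)
      (𝓝[>] 1) (𝓝 0) := by
    have : Tendsto (fun σ : ℝ ↦ (σ - 1) * ∑' q, S.indicator (primePow (K := K) 1) q) (𝓝 1)
        (𝓝 ((1 - 1) * ∑' q, S.indicator (primePow (K := K) 1) q)) := by
      exact Continuous.tendsto (by fun_prop) 1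
    rw [sub_self, zero_mul] at this
    exact this.mono_left nhdsWithin_le_nhds
  refine tendsto_of_tendsto_of_tendsto_of_le_of_le' tendsto_const_nhds h1 ?_ ?_
  · filter_upwards [self_mem_nhdsWithin] with σ (hσ : 1 < σ)
    exact mul_nonneg (by linarith)
      (tsum_nonneg fun q ↦ Set.indicator_nonneg (fun _ _ ↦ primePow_nonneg _ _) _)
  · filter_upwards [self_mem_nhdsWithin] with σ (hσ : 1 < σ)
    refine mul_le_mul_of_nonneg_left (Summable.tsum_le_tsum (fun q ↦ ?_)
      ((summable_primePow hσ).indicator S) hsum) (by linarith)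
    exact Set.indicator_le_indicator (primePow_anti hσ.le q)

end

namespace CubicData
variable {K : Type*} [Field K] [NumberField K] (D : CubicData K) {Ψ : Ideal (𝓞 K) →*₀ ℂ}

lemma tendsto_sub_one_mul_idealΛ_of_ne_one (hΨ : ∀ I, ‖Ψ I‖ ≤ 1) {m : 𝓞 K} (hm : m ≠ 0)
    (hper : ∀ x y, m ∣ x - y → 0 < D.A x → 0 < D.A y → Ψ (Ideal.span {x}) = Ψ (Ideal.span {y}))
    (hcop : ∀ 𝔟 ≠ 0, IsCoprime 𝔟 (Ideal.span {m}) → Ψ 𝔟 ≠ 0)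
    {𝔠 : Ideal (𝓞 K)} (h𝔠 : 𝔠 ≠ 0) (hm𝔠 : IsCoprime 𝔠 (Ideal.span {m})) (hΨ𝔠 : Ψ 𝔠 ≠ 1) :
    ∃ r : ℕ, Tendsto (fun σ : ℝ ↦ ((σ : ℂ) - 1) * idealΛ Ψ σ) (𝓝[>] 1) (𝓝 (-(r : ℂ))) := by
  obtain ⟨H, hH, hHs⟩ := D.exists_analyticAt_mul_idealL hΨ hm hper hcop h𝔠 hm𝔠
  set k : ℂ → ℂ := fun s ↦ 1 - Ideal.absNorm 𝔠 * twist Ψ s 𝔠 with hk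
  have hka : AnalyticAt ℂ k 1 := analyticAt_const.fun_sub
    (analyticAt_const.fun_mul (analyticAt_twist _ _ _))
  have hN : (Ideal.absNorm 𝔠 : ℂ) ≠ 0 := by
    rw [Nat.cast_ne_zero, Ne, Ideal.absNorm_eq_zero_iff]
    exact h𝔠
  have hk1 : k 1 ≠ 0 := by
    rw [hk]
    dsimp only
    rw [twist_apply, Complex.cpow_neg_one, mul_comm (Ψ 𝔠), mul_inv_cancel_left₀ hN]
    exact sub_ne_zero.mpr hΨ𝔠.symm
  obtain ⟨r, -, hr⟩ := exists_tendsto_sub_one_mul_logDeriv (fun s hs ↦ hasDerivAt_idealL hΨ hs)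
    (exists_idealL_ne_zero hΨ) (hH.fun_div hka hk1) 0 (by
      filter_upwards [hka.continuousAt.eventually_ne hk1] with s hs h1
      rw [← hHs s h1, pow_zero, one_mul, mul_div_cancel_left₀ _ hs])
  exact ⟨r, by simpa using hr⟩

lemma exists_analyticAt_eq_sub_one_mul_idealL (hΨ : ∀ I, ‖Ψ I‖ ≤ 1) {m : 𝓞 K} (hm : m ≠ 0)
    (hper : ∀ x y, m ∣ x - y → 0 < D.A x → 0 < D.A y → Ψ (Ideal.span {x}) = Ψ (Ideal.span {y}))
    (hcop : ∀ 𝔟 ≠ 0, IsCoprime 𝔟 (Ideal.span {m}) → Ψ 𝔟 ≠ 0)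
    {𝔠 : Ideal (𝓞 K)} (hm𝔠 : IsCoprime 𝔠 (Ideal.span {m})) (hΨ𝔠 : Ψ 𝔠 = 1)
    (hN1 : 1 < Ideal.absNorm 𝔠) :
    ∃ G : ℂ → ℂ, AnalyticAt ℂ G 1 ∧ ∀ᶠ s in 𝓝 (1 : ℂ), 1 < s.re → G s = (s - 1) ^ 1 * idealL Ψ s := by
  have h𝔠 : 𝔠 ≠ 0 := by
    rintro rfl
    simp at hN1
  obtain ⟨H, hH, hHs⟩ := D.exists_analyticAt_mul_idealL hΨ hm hper hcop h𝔠 hm𝔠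
  set k : ℂ → ℂ := fun s ↦ 1 - Ideal.absNorm 𝔠 * twist Ψ s 𝔠 with hk
  have hka : AnalyticAt ℂ k 1 := analyticAt_const.fun_sub
    (analyticAt_const.fun_mul (analyticAt_twist _ _ _))
  have hN : (Ideal.absNorm 𝔠 : ℂ) ≠ 0 := by
    rw [Nat.cast_ne_zero]
    omega
  have ht : (Ideal.absNorm 𝔠 : ℂ) * twist Ψ 1 𝔠 = 1 := by
    rw [twist_apply, hΨ𝔠, one_mul, Complex.cpow_neg_one, mul_inv_cancel₀ hN]
  have hk1 : k 1 = 0 := by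
    rw [hk]
    dsimp only
    rw [ht, sub_self]
  have hkd : dslope k 1 1 ≠ 0 := by
    rw [dslope_same]
    have : HasDerivAt k (-(Ideal.absNorm 𝔠 * -(twist Ψ 1 𝔠 * (Real.log (Ideal.absNorm 𝔠) : ℂ)))) 1 :=
      ((hasDerivAt_twist 1 𝔠).const_mul _).const_sub 1
    rw [this.deriv, mul_neg, neg_neg, ← mul_assoc, ht, one_mul, Complex.ofReal_ne_zero]
    exact (Real.log_pos (by exact_mod_cast hN1)).ne'
  have hda : AnalyticAt ℂ (dslope k 1) 1 := by
    obtain ⟨q, hq⟩ := hka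
    exact ⟨q.fslope, hq.has_fpower_series_dslope_fslope⟩
  refine ⟨_, hH.fun_div hda hkd, ?_⟩
  filter_upwards [hda.continuousAt.eventually_ne hkd] with s hs h1
  have := sub_smul_dslope k 1 s
  rw [hk1, sub_zero, smul_eq_mul] at this
  rw [← hHs s h1, div_eq_iff hs, pow_one, show 1 - (Ideal.absNorm 𝔠 : ℂ) * twist Ψ s 𝔠 = k s from rfl,
    ← this]
  ring

lemma tendsto_sub_one_mul_tsum_primePow (D : CubicData K) {𝔠 : Ideal (𝓞 K)}
    (h𝔠 : 1 < Ideal.absNorm 𝔠) :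
    Tendsto (fun σ : ℝ ↦ (σ - 1) * ∑' q, primePow (K := K) σ q) (𝓝[>] 1) (𝓝 1) := by
  have h0 : 𝔠 ≠ 0 := by
    rintro rfl
    simp at h𝔠
  have hx (x : 𝓞 K) (hx : 0 < D.A x) : Ideal.span {x} ≠ 0 := by
    rw [Ne, Ideal.zero_eq_bot, Ideal.span_singleton_eq_bot]
    rintro rfl
    simp at hx
  obtain ⟨G, hG, hGs⟩ := D.exists_analyticAt_eq_sub_one_mul_idealL norm_oneHom_le
    (m := 1) one_ne_zero (fun x y _ h h' ↦ by rw [oneHom_apply (hx x h), oneHom_apply (hx y h')])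
    (fun 𝔟 h _ ↦ by rw [oneHom_apply h]; exact one_ne_zero) (𝔠 := 𝔠)
    (by rw [Ideal.span_singleton_one, ← Ideal.one_eq_top]; exact isCoprime_one_right)
    (oneHom_apply h0) h𝔠
  obtain ⟨r, hr0, hr⟩ := exists_tendsto_sub_one_mul_logDeriv
    (fun s hs ↦ hasDerivAt_idealL norm_oneHom_le hs)
    (exists_idealL_ne_zero norm_oneHom_le) hG 1 hGs
  have hcoe : Tendsto (fun σ : ℝ ↦ (σ : ℂ)) (𝓝[>] 1) (𝓝 1) :=
    (Complex.continuous_ofReal.tendsto 1).mono_left nhdsWithin_le_nhds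
  have hG1 : G 1 = (dedekindZeta_residue K : ℂ) := by
    refine tendsto_nhds_unique (hG.continuousAt.tendsto.comp hcoe) ?_
    refine ((Complex.continuous_ofReal.tendsto _).comp
      (tendsto_sub_one_mul_tsum_absNorm (K := K))).congr' ?_
    filter_upwards [hcoe.eventually hGs, self_mem_nhdsWithin] with σ h (hσ : 1 < σ)
    rw [Function.comp_apply, Function.comp_apply, h (by simpa using hσ), pow_one, idealL]
    push_cast
    congr 1
    refine tsum_congr fun I ↦ ?_
    rcases eq_or_ne I 0 with rfl | hI
    · rw [map_zero, map_zero, Nat.cast_zero, Real.zero_rpow (by linarith), Complex.ofReal_zero]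
    · rw [twist_apply, oneHom_apply hI, one_mul, Complex.ofReal_cpow (by positivity)]
      push_cast
      rfl
  have hr1 : r = 0 := by
    rw [hr0, hG1, Complex.ofReal_ne_zero]
    exact (dedekindZeta_residue_pos K).ne'
  have := (Complex.continuous_re.tendsto _).comp hr
  rw [hr1, Nat.cast_one, Nat.cast_zero, sub_zero, Complex.one_re] at this
  refine this.congr' ?_
  filter_upwards [self_mem_nhdsWithin] with σ (hσ : 1 < σ)
  rw [Function.comp_apply, idealΛ_ofReal]
  simp_rw [primePow_mul_oneHom]
  rw [← Complex.ofReal_tsum, ← Complex.ofReal_one, ← Complex.ofReal_sub, ← Complex.ofReal_mul,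
    Complex.ofReal_re]

end CubicData
end PureCubic

namespace PureCubic
open NumberField Filter Topology

section
variable {K : Type*} [Field K] [NumberField K]

/-- Nonzero ideals coprime to `m`. -/
def CoprimeTo (m : 𝓞 K) (I : Ideal (𝓞 K)) : Prop := I ≠ 0 ∧ IsCoprime I (Ideal.span {m})

omit [NumberField K] in
lemma coprimeTo_one (m : 𝓞 K) : CoprimeTo m 1 := ⟨one_ne_zero, isCoprime_one_left⟩

omit [NumberField K] in
lemma coprimeTo_mul_iff {m : 𝓞 K} {I J : Ideal (𝓞 K)} :
    CoprimeTo m (I * J) ↔ CoprimeTo m I ∧ CoprimeTo m J := by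
  unfold CoprimeTo
  rw [IsCoprime.mul_left_iff, mul_ne_zero_iff]
  tauto

lemma absNorm_mod_three_ne_zero {m : 𝓞 K} (hm3 : (3 : 𝓞 K) ∣ m) {I : Ideal (𝓞 K)}
    (hI : CoprimeTo m I) : Ideal.absNorm I % 3 ≠ 0 := by
  intro h
  have := Ideal.finiteQuotientOfFreeOfNeBot I hI.1
  obtain ⟨a, ha, b, hb, hab⟩ := Ideal.isCoprime_iff_exists.mp hI.2
  obtain ⟨d, rfl⟩ := Ideal.mem_span_singleton.mp hb
  obtain ⟨e, rfl⟩ := hm3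
  have hcard : 3 ∣ Nat.card (𝓞 K ⧸ I) := by
    rw [← Submodule.cardQuot_apply, ← Ideal.absNorm_apply]
    omega
  have : Fact (Nat.Prime 3) := ⟨Nat.prime_three⟩
  obtain ⟨x, hx⟩ := exists_prime_addOrderOf_dvd_card' 3 hcard
  have h3 : (3 : 𝓞 K ⧸ I) * x = 0 := by
    have := addOrderOf_nsmul_eq_zero x
    rw [hx, nsmul_eq_mul] at this
    exact_mod_cast this
  have h1 : (Ideal.Quotient.mk I (3 * e * d)) = 1 := by
    rw [← map_one (Ideal.Quotient.mk I), ← hab, map_add, Ideal.Quotient.eq_zero_iff_mem.mpr ha,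
      zero_add]
  have hx0 : x = 0 := by
    rw [← one_mul x, ← h1, map_mul, map_mul, map_ofNat]
    linear_combination Ideal.Quotient.mk I e * Ideal.Quotient.mk I d * h3
  rw [hx0, addOrderOf_zero] at hx
  omega

omit [NumberField K] in
lemma coprimeTo_span_congr {m x y : 𝓞 K} (h : m ∣ x - y) (hx : x ≠ 0) (hy : y ≠ 0) :
    CoprimeTo m (Ideal.span {x}) ↔ CoprimeTo m (Ideal.span {y}) := by
  obtain ⟨d, hd⟩ := h
  obtain rfl : x = y + m * d := by rw [← hd]; ring
  unfold CoprimeTo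
  simp only [Ideal.isCoprime_span_singleton_iff, IsCoprime.add_mul_left_left_iff, ne_eq,
    Ideal.zero_eq_bot, Ideal.span_singleton_eq_bot, hx, hy, not_false_eq_true, true_and]

/-- The quadratic character modulo three of the norm. -/
noncomputable def normSign (I : Ideal (𝓞 K)) : ℂ :=
  ((quadraticChar (ZMod 3) (Ideal.absNorm I : ZMod 3) : ℤ) : ℂ)

lemma normSign_of_eq_one {I : Ideal (𝓞 K)} (h : Ideal.absNorm I % 3 = 1) : normSign I = 1 := by
  rw [normSign, ← ZMod.natCast_mod, h, Nat.cast_one, map_one, Int.cast_one]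

lemma normSign_of_eq_two {I : Ideal (𝓞 K)} (h : Ideal.absNorm I % 3 = 2) : normSign I = -1 := by
  rw [normSign, ← ZMod.natCast_mod, h, show quadraticChar (ZMod 3) ((2 : ℕ) : ZMod 3) = -1 by decide,
    Int.cast_neg, Int.cast_one]

lemma normSign_sq {m : 𝓞 K} (hm3 : (3 : 𝓞 K) ∣ m) {I : Ideal (𝓞 K)} (hI : CoprimeTo m I) :
    normSign I ^ 2 = 1 := by
  have := absNorm_mod_three_ne_zero hm3 hI
  have : Ideal.absNorm I % 3 = 1 ∨ Ideal.absNorm I % 3 = 2 := by omega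
  rcases this with h | h
  · rw [normSign_of_eq_one h, one_pow]
  · rw [normSign_of_eq_two h]
    norm_num

lemma normSign_mul (I J : Ideal (𝓞 K)) : normSign (I * J) = normSign I * normSign J := by
  unfold normSign
  rw [map_mul, Nat.cast_mul, map_mul, Int.cast_mul]

lemma normSign_one : normSign (1 : Ideal (𝓞 K)) = 1 :=
  normSign_of_eq_one (by rw [map_one, Nat.one_mod])

/-- An additive function on the ideals coprime to `m`. -/
structure IdealLog (m : 𝓞 K) (p : ℕ) where
  toFun : Ideal (𝓞 K) → ZMod p
  apply_mul : ∀ I J, CoprimeTo m I → CoprimeTo m J → toFun (I * J) = toFun I + toFun J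

namespace IdealLog
variable {m : 𝓞 K} {p : ℕ} [NeZero p] (φ : IdealLog m p)

omit [NumberField K] [NeZero p] in
lemma apply_one : φ.toFun 1 = 0 := by
  have := φ.apply_mul 1 1 (coprimeTo_one m) (coprimeTo_one m)
  rwa [mul_one, left_eq_add] at this

open Classical in
/-- The character `I ↦ e(k φ(I) / p) (N(I) / 3)^j` on ideals coprime to `m`. -/
noncomputable def char (k : ZMod p) (j : ℕ) : Ideal (𝓞 K) →*₀ ℂ where
  toFun I := if CoprimeTo m I then ZMod.stdAddChar (k * φ.toFun I) * normSign I ^ j else 0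
  map_zero' := if_neg fun h ↦ h.1 rfl
  map_one' := by
    rw [if_pos (coprimeTo_one m), φ.apply_one, mul_zero, AddChar.map_zero_eq_one,
      normSign_one, one_pow, one_mul]
  map_mul' I J := by
    by_cases hI : CoprimeTo m I
    · by_cases hJ : CoprimeTo m J
      · rw [if_pos hI, if_pos hJ, if_pos (coprimeTo_mul_iff.mpr ⟨hI, hJ⟩), φ.apply_mul I J hI hJ,
          mul_add, AddChar.map_add_eq_mul, normSign_mul]
        ring
      · rw [if_neg hJ, mul_zero, if_neg fun h ↦ hJ (coprimeTo_mul_iff.mp h).2]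
    · rw [if_neg hI, zero_mul, if_neg fun h ↦ hI (coprimeTo_mul_iff.mp h).1]

lemma char_of_coprime (k : ZMod p) (j : ℕ) {I : Ideal (𝓞 K)} (hI : CoprimeTo m I) :
    φ.char k j I = ZMod.stdAddChar (k * φ.toFun I) * normSign I ^ j := if_pos hI

lemma char_of_not_coprime (k : ZMod p) (j : ℕ) {I : Ideal (𝓞 K)} (hI : ¬ CoprimeTo m I) :
    φ.char k j I = 0 := if_neg hI

lemma norm_stdAddChar (x : ZMod p) : ‖(ZMod.stdAddChar x : ℂ)‖ = 1 := by
  rw [ZMod.stdAddChar_apply]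
  exact Circle.norm_coe _

lemma norm_char (hm3 : (3 : 𝓞 K) ∣ m) (k : ZMod p) (j : ℕ) {I : Ideal (𝓞 K)}
    (hI : CoprimeTo m I) : ‖φ.char k j I‖ = 1 := by
  rw [φ.char_of_coprime k j hI, norm_mul, norm_stdAddChar, one_mul, norm_pow]
  have h := congrArg norm (normSign_sq hm3 hI)
  rw [norm_pow, norm_one, pow_eq_one_iff_of_nonneg (norm_nonneg _) two_ne_zero] at h
  rw [h, one_pow]

lemma norm_char_le (hm3 : (3 : 𝓞 K) ∣ m) (k : ZMod p) (j : ℕ) (I : Ideal (𝓞 K)) :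
    ‖φ.char k j I‖ ≤ 1 := by
  by_cases hI : CoprimeTo m I
  · exact (φ.norm_char hm3 k j hI).le
  · rw [φ.char_of_not_coprime k j hI, norm_zero]
    exact zero_le_one

lemma char_sq (hm3 : (3 : 𝓞 K) ∣ m) (k : ZMod p) (j : ℕ) (I : Ideal (𝓞 K)) :
    φ.char k j I ^ 2 = φ.char (2 * k) 0 I := by
  by_cases hI : CoprimeTo m I
  · rw [φ.char_of_coprime k j hI, φ.char_of_coprime _ 0 hI, pow_zero, mul_one, mul_pow, ← pow_mul,
      mul_comm j, pow_mul, normSign_sq hm3 hI, one_pow, mul_one, ← AddChar.map_nsmul_eq_pow]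
    congr 1
    rw [nsmul_eq_mul]
    push_cast
    ring
  · rw [φ.char_of_not_coprime k j hI, φ.char_of_not_coprime _ 0 hI, zero_pow two_ne_zero]

lemma char_congr {A : 𝓞 K →+* ℝ}
    (hφ : ∀ x y, m ∣ x - y → 0 < A x → 0 < A y → CoprimeTo m (Ideal.span {x}) →
      φ.toFun (Ideal.span {x}) = φ.toFun (Ideal.span {y}))
    (hN : ∀ x y, m ∣ x - y → 0 < A x → 0 < A y →
      Ideal.absNorm (Ideal.span {x}) ≡ Ideal.absNorm (Ideal.span {y}) [MOD 3])
    (k : ZMod p) (j : ℕ) (x y : 𝓞 K) (h : m ∣ x - y) (hx : 0 < A x) (hy : 0 < A y) :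
    φ.char k j (Ideal.span {x}) = φ.char k j (Ideal.span {y}) := by
  have hx0 : x ≠ 0 := by rintro rfl; simp at hx
  have hy0 : y ≠ 0 := by rintro rfl; simp at hy
  by_cases hc : CoprimeTo m (Ideal.span {x})
  · rw [φ.char_of_coprime k j hc, φ.char_of_coprime k j ((coprimeTo_span_congr h hx0 hy0).mp hc),
      hφ x y h hx hy hc, normSign, normSign,
      (ZMod.natCast_eq_natCast_iff _ _ 3).mpr (hN x y h hx hy)]
  · rw [φ.char_of_not_coprime k j hc, φ.char_of_not_coprime k j fun h' ↦
      hc ((coprimeTo_span_congr h hx0 hy0).mpr h')]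

end IdealLog
end
end PureCubic

namespace PureCubic
open NumberField Filter Topology

variable {K : Type*} [Field K] [NumberField K]

namespace IdealLog
variable {m : 𝓞 K} {p : ℕ} (φ : IdealLog m p)

/-- The conditions on an additive function `φ` needed to study its distribution on primes. -/
structure Admissible (D : CubicData K) : Prop where
  ne_zero : m ≠ 0
  three_dvd : (3 : 𝓞 K) ∣ m
  congr : ∀ x y, m ∣ x - y → 0 < D.A x → 0 < D.A y → CoprimeTo m (Ideal.span {x}) →
    φ.toFun (Ideal.span {x}) = φ.toFun (Ideal.span {y})
  norm_congr : ∀ x y, m ∣ x - y → 0 < D.A x → 0 < D.A y →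
    Ideal.absNorm (Ideal.span {x}) ≡ Ideal.absNorm (Ideal.span {y}) [MOD 3]
  exists_ne_zero : ∃ 𝔠, CoprimeTo m 𝔠 ∧ φ.toFun 𝔠 ≠ 0
  exists_norm : ∃ 𝔠, CoprimeTo m 𝔠 ∧ Ideal.absNorm 𝔠 % 3 = 2

variable {φ} {D : CubicData K} [Fact p.Prime]

lemma Admissible.tendsto_of_ne_one (h : φ.Admissible D) {k : ZMod p} {j : ℕ} {𝔠 : Ideal (𝓞 K)}
    (h𝔠 : CoprimeTo m 𝔠) (h1 : φ.char k j 𝔠 ≠ 1) :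
    ∃ r : ℕ, Tendsto (fun σ : ℝ ↦ ((σ : ℂ) - 1) * idealΛ (φ.char k j) σ) (𝓝[>] 1) (𝓝 (-(r : ℂ))) :=
  D.tendsto_sub_one_mul_idealΛ_of_ne_one (φ.norm_char_le h.three_dvd k j) h.ne_zero
    (φ.char_congr h.congr h.norm_congr k j) (fun 𝔟 h0 h' ↦ by
      rw [← norm_ne_zero_iff, φ.norm_char h.three_dvd k j ⟨h0, h'⟩]
      exact one_ne_zero) h𝔠.1 h𝔠.2 h1

lemma Admissible.tendsto_of_ne_zero_aux (h : φ.Admissible D) (hp : p ≠ 2) {k : ZMod p} (hk : k ≠ 0)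
    (j : ℕ) :
    ∃ r : ℕ, Tendsto (fun σ : ℝ ↦ ((σ : ℂ) - 1) * idealΛ (φ.char k j) σ) (𝓝[>] 1) (𝓝 (-(r : ℂ))) := by
  obtain ⟨𝔠, h𝔠, hφ⟩ := h.exists_ne_zero
  refine h.tendsto_of_ne_one h𝔠 fun h1 ↦ ?_
  have h2 := φ.char_sq h.three_dvd k j 𝔠
  rw [h1, one_pow, φ.char_of_coprime _ 0 h𝔠, pow_zero, mul_one, ← AddChar.map_zero_eq_one
    (ZMod.stdAddChar (N := p))] at h2
  have h3 := ZMod.injective_stdAddChar h2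
  have h4 : (2 : ZMod p) ≠ 0 := fun h4 ↦ by
    have := (ZMod.natCast_eq_zero_iff 2 p).mp (by exact_mod_cast h4)
    exact hp ((Nat.prime_dvd_prime_iff_eq Fact.out Nat.prime_two).mp this)
  exact mul_ne_zero (mul_ne_zero h4 hk) hφ h3.symm

lemma tendsto_char_zero_zero (h : φ.Admissible D) :
    Tendsto (fun σ : ℝ ↦ ((σ : ℂ) - 1) * idealΛ (φ.char 0 0) σ) (𝓝[>] 1) (𝓝 1) := by
  obtain ⟨𝔠, h𝔠, hN⟩ := h.exists_norm
  have h1 := D.tendsto_sub_one_mul_tsum_primePow (𝔠 := 𝔠) (by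
    have : Ideal.absNorm 𝔠 ≠ 0 := by
      rw [Ne, Ideal.absNorm_eq_zero_iff]
      exact h𝔠.1
    omega)
  set S : Set (Ideal (𝓞 K) × ℕ) := {q | ¬ CoprimeTo m (q.1 ^ (q.2 + 1))} with hS
  have h2 : Tendsto (fun σ : ℝ ↦ (σ - 1) * ∑' q, S.indicator (primePow σ) q) (𝓝[>] 1) (𝓝 0) := by
    refine tendsto_sub_one_mul_tsum_indicator (summable_of_hasFiniteSupport ?_)
    have hfin : {v : IsDedekindDomain.HeightOneSpectrum (𝓞 K) | v.asIdeal ∣ Ideal.span {m}}.Finite :=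
      Ideal.finite_factors (by simpa using h.ne_zero)
    refine (hfin.image fun v ↦ v.asIdeal).subset fun v hv ↦ ?_
    rw [Function.mem_support] at hv
    have hvS : (v, 0) ∈ S := Set.mem_of_indicator_ne_zero hv
    have hvp : Prime v := by
      by_contra hvp
      rw [Set.indicator_of_mem hvS, primePow_of_not_prime 1 hvp] at hv
      exact hv rfl
    have : v.IsPrime := Ideal.isPrime_of_prime hvp
    refine ⟨⟨v, this, hvp.ne_zero⟩, ?_, rfl⟩
    by_contra hdvd
    refine hvS ?_
    rw [zero_add, pow_one]
    refine ⟨hvp.ne_zero, ?_⟩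
    rw [Ideal.isCoprime_iff_sup_eq]
    exact (this.isMaximal hvp.ne_zero).out.2 _
      (left_lt_sup.mpr fun hle ↦ hdvd (Ideal.dvd_iff_le.mpr hle))
  have h3 := (Complex.continuous_ofReal.tendsto _).comp (h1.sub h2)
  rw [sub_zero, Complex.ofReal_one] at h3
  refine h3.congr' ?_
  filter_upwards [self_mem_nhdsWithin] with σ (hσ : 1 < σ)
  rw [Function.comp_apply, ← mul_sub, ← Summable.tsum_sub (summable_primePow hσ)
    ((summable_primePow hσ).indicator S), Complex.ofReal_mul, Complex.ofReal_sub, Complex.ofReal_one,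
    Complex.ofReal_tsum, idealΛ_ofReal]
  congr 1
  refine tsum_congr fun q ↦ ?_
  by_cases hq : CoprimeTo m (q.1 ^ (q.2 + 1))
  · rw [φ.char_of_coprime 0 0 hq, Set.indicator_of_notMem (by simpa [hS] using hq), zero_mul,
      AddChar.map_zero_eq_one, pow_zero, mul_one, mul_one, sub_zero]
  · rw [φ.char_of_not_coprime 0 0 hq, Set.indicator_of_mem (by simpa [hS] using hq), sub_self,
      Complex.ofReal_zero, mul_zero]

lemma Admissible.tendsto_of_ne_zero (h : φ.Admissible D) (hp : p ≠ 2) {k : ZMod p} (hk : k ≠ 0)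
    (j : ℕ) :
    Tendsto (fun σ : ℝ ↦ ((σ : ℂ) - 1) * idealΛ (φ.char k j) σ) (𝓝[>] 1) (𝓝 0) := by
  obtain ⟨r, hr⟩ := h.tendsto_of_ne_zero_aux hp hk j
  have h4 : (2 : ZMod p) ≠ 0 := fun h4 ↦ by
    have := (ZMod.natCast_eq_zero_iff 2 p).mp (by exact_mod_cast h4)
    exact hp ((Nat.prime_dvd_prime_iff_eq Fact.out Nat.prime_two).mp this)
  obtain ⟨r', hr'⟩ := h.tendsto_of_ne_zero_aux hp (mul_ne_zero h4 hk) 0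
  have h0 := tendsto_char_zero_zero h
  have key := (Complex.continuous_re.tendsto _).comp
    (((h0.const_mul 3).add (hr.const_mul 4)).add hr')
  have hnn : 0 ≤ (3 * 1 + 4 * (-(r : ℂ)) + (-(r' : ℂ))).re := by
    refine ge_of_tendsto key ?_
    filter_upwards [self_mem_nhdsWithin] with σ (hσ : 1 < σ)
    have H : HasSum (fun q : Ideal (𝓞 K) × ℕ ↦ (primePow σ q : ℂ) *
        (3 * φ.char 0 0 (q.1 ^ (q.2 + 1)) + 4 * φ.char k j (q.1 ^ (q.2 + 1)) +
          φ.char (2 * k) 0 (q.1 ^ (q.2 + 1))))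
        (3 * idealΛ (φ.char 0 0) σ + 4 * idealΛ (φ.char k j) σ + idealΛ (φ.char (2 * k) 0) σ) := by
      rw [idealΛ_ofReal, idealΛ_ofReal, idealΛ_ofReal]
      refine ((((summable_primePow_mul (φ.norm_char_le h.three_dvd 0 0) hσ).hasSum.mul_left 3).add
        ((summable_primePow_mul (φ.norm_char_le h.three_dvd k j) hσ).hasSum.mul_left 4)).add
        (summable_primePow_mul (φ.norm_char_le h.three_dvd (2 * k) 0) hσ).hasSum).congr_fun fun q ↦ ?_
      ring
    have e : 3 * (((σ : ℂ) - 1) * idealΛ (φ.char 0 0) σ) + 4 * (((σ : ℂ) - 1) * idealΛ (φ.char k j) σ)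
        + ((σ : ℂ) - 1) * idealΛ (φ.char (2 * k) 0) σ = ((σ - 1 : ℝ) : ℂ) *
        (3 * idealΛ (φ.char 0 0) σ + 4 * idealΛ (φ.char k j) σ + idealΛ (φ.char (2 * k) 0) σ) := by
      push_cast
      ring
    rw [Function.comp_apply, e, Complex.re_ofReal_mul]
    refine mul_nonneg (by linarith) ?_
    refine (Complex.hasSum_re H).nonneg fun q ↦ ?_
    rw [Complex.re_ofReal_mul]
    refine mul_nonneg (primePow_nonneg _ _) ?_
    rw [← φ.char_sq h.three_dvd k j]
    by_cases hq : CoprimeTo m (q.1 ^ (q.2 + 1))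
    · have hz := φ.norm_char h.three_dvd k j hq
      rw [φ.char_of_coprime 0 0 hq, zero_mul, AddChar.map_zero_eq_one, pow_zero, mul_one, mul_one]
      set z := φ.char k j (q.1 ^ (q.2 + 1))
      have hz2 : z.re ^ 2 + z.im ^ 2 = 1 := by
        rw [← Complex.sq_norm_sub_sq_re, hz]
        ring
      simp only [Complex.add_re, pow_two, Complex.mul_re, Complex.re_ofNat, Complex.im_ofNat]
      nlinarith [sq_nonneg (z.re + 1)]
    · rw [φ.char_of_not_coprime 0 0 hq, φ.char_of_not_coprime k j hq]
      simp
  have hr0 : r = 0 := by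
    simp only [Complex.add_re, Complex.mul_re, Complex.neg_re, Complex.natCast_re, Complex.one_re,
      Complex.re_ofNat, Complex.im_ofNat, zero_mul, sub_zero] at hnn
    have : 4 * r + r' ≤ 3 := by
      have : (4 * r + r' : ℝ) ≤ 3 := by linarith
      exact_mod_cast this
    omega
  simpa [hr0] using hr

end IdealLog
end PureCubic

namespace PureCubic
open NumberField Filter Topology

section
variable {K : Type*} [Field K] [NumberField K]

namespace IdealLog
variable {m : 𝓞 K} {p : ℕ} (φ : IdealLog m p)

/-- The pairs `(v, k)` for which `I = v ^ (k + 1)` satisfies `φ(I) = c` and `N(I) ≡ 2 (mod 3)`. -/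
def fiber (c : ZMod p) : Set (Ideal (𝓞 K) × ℕ) :=
  {q | CoprimeTo m (q.1 ^ (q.2 + 1)) ∧ φ.toFun (q.1 ^ (q.2 + 1)) = c ∧
    Ideal.absNorm (q.1 ^ (q.2 + 1)) % 3 = 2}

variable {φ} {D : CubicData K} [Fact p.Prime]

lemma sum_char_eq (h3 : (3 : 𝓞 K) ∣ m) (c : ZMod p) (q : Ideal (𝓞 K) × ℕ) :
    ∑ k : ZMod p, ZMod.stdAddChar (-(k * c)) *
      (φ.char k 0 (q.1 ^ (q.2 + 1)) - φ.char k 1 (q.1 ^ (q.2 + 1))) =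
      (2 * p : ℂ) * (φ.fiber c).indicator 1 q := by
  by_cases hI : CoprimeTo m (q.1 ^ (q.2 + 1))
  · have e : ∀ k : ZMod p, (ZMod.stdAddChar (-(k * c)) : ℂ) *
        (φ.char k 0 (q.1 ^ (q.2 + 1)) - φ.char k 1 (q.1 ^ (q.2 + 1))) =
        ZMod.stdAddChar (k * (φ.toFun (q.1 ^ (q.2 + 1)) - c)) * (1 - normSign (q.1 ^ (q.2 + 1))) := by
      intro k
      rw [φ.char_of_coprime k 0 hI, φ.char_of_coprime k 1 hI,
        show k * (φ.toFun (q.1 ^ (q.2 + 1)) - c) = -(k * c) + k * φ.toFun (q.1 ^ (q.2 + 1)) by ring,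
        AddChar.map_add_eq_mul]
      ring
    rw [Finset.sum_congr rfl fun k _ ↦ e k, ← Finset.sum_mul,
      AddChar.sum_mulShift _ (ZMod.isPrimitive_stdAddChar p), ZMod.card]
    by_cases hc : φ.toFun (q.1 ^ (q.2 + 1)) = c
    · have := absNorm_mod_three_ne_zero h3 hI
      have : Ideal.absNorm (q.1 ^ (q.2 + 1)) % 3 = 1 ∨ Ideal.absNorm (q.1 ^ (q.2 + 1)) % 3 = 2 := by
        omega
      rcases this with hN | hN
      · have hq : q ∉ φ.fiber c := fun h ↦ by
          have := h.2.2
          omega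
        rw [normSign_of_eq_one hN, sub_self, mul_zero, Set.indicator_of_notMem hq, mul_zero]
      · rw [normSign_of_eq_two hN, Set.indicator_of_mem (show q ∈ φ.fiber c from ⟨hI, hc, hN⟩), if_pos (sub_eq_zero.mpr hc),
          Pi.one_apply]
        ring
    · rw [if_neg (sub_ne_zero.mpr hc), Set.indicator_of_notMem fun h ↦ hc h.2.1]
      simp
  · rw [Set.indicator_of_notMem fun h ↦ hI h.1, mul_zero]
    refine Finset.sum_eq_zero fun k _ ↦ ?_
    rw [φ.char_of_not_coprime k 0 hI, φ.char_of_not_coprime k 1 hI, sub_self, mul_zero]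

lemma Admissible.not_summable_fiber (h : φ.Admissible D) (hp : p ≠ 2) (c : ZMod p) :
    ¬ Summable fun v ↦ (φ.fiber c).indicator (primePow 1) (v, 0) := by
  intro hs
  have h0 := tendsto_sub_one_mul_tsum_indicator hs
  obtain ⟨𝔠, h𝔠, hN⟩ := h.exists_norm
  obtain ⟨r, hr⟩ := h.tendsto_of_ne_one (k := 0) (j := 1) h𝔠 (by
    rw [φ.char_of_coprime _ _ h𝔠, zero_mul, AddChar.map_zero_eq_one, normSign_of_eq_two hN]
    norm_num)
  have hlim : Tendsto (fun σ : ℝ ↦ ∑ k : ZMod p, (ZMod.stdAddChar (-(k * c)) : ℂ) *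
      (((σ : ℂ) - 1) * idealΛ (φ.char k 0) σ - ((σ : ℂ) - 1) * idealΛ (φ.char k 1) σ)) (𝓝[>] 1)
      (𝓝 (∑ k : ZMod p, if k = 0 then 1 + (r : ℂ) else 0)) := by
    refine tendsto_finsetSum _ fun k _ ↦ ?_
    by_cases hk : k = 0
    · subst hk
      rw [if_pos rfl, zero_mul, neg_zero, AddChar.map_zero_eq_one]
      simpa using (tendsto_char_zero_zero h).sub hr
    · rw [if_neg hk]
      simpa using ((h.tendsto_of_ne_zero hp hk 0).sub (h.tendsto_of_ne_zero hp hk 1)).const_mul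
        (ZMod.stdAddChar (-(k * c)) : ℂ)
  rw [Finset.sum_ite_eq' Finset.univ (0 : ZMod p), if_pos (Finset.mem_univ _)] at hlim
  have hlim' := (((Complex.continuous_ofReal.tendsto 0).comp h0).const_mul (2 * p : ℂ))
  rw [Complex.ofReal_zero, mul_zero] at hlim'
  refine absurd (tendsto_nhds_unique (hlim.congr' ?_) hlim') (by exact_mod_cast (Nat.succ_ne_zero r ∘ by omega))
  filter_upwards [self_mem_nhdsWithin] with σ (hσ : 1 < σ)
  have hsum : ∀ k j, Summable fun q : Ideal (𝓞 K) × ℕ ↦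
      (primePow σ q : ℂ) * φ.char k j (q.1 ^ (q.2 + 1)) := fun k j ↦
    summable_primePow_mul (φ.norm_char_le h.three_dvd k j) hσ
  have e : ∀ k : ZMod p, (ZMod.stdAddChar (-(k * c)) : ℂ) *
      (((σ : ℂ) - 1) * idealΛ (φ.char k 0) σ - ((σ : ℂ) - 1) * idealΛ (φ.char k 1) σ) =
      ((σ : ℂ) - 1) * ∑' q : Ideal (𝓞 K) × ℕ, (primePow σ q : ℂ) * ((ZMod.stdAddChar (-(k * c)) : ℂ) *
        (φ.char k 0 (q.1 ^ (q.2 + 1)) - φ.char k 1 (q.1 ^ (q.2 + 1)))) := by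
    intro k
    rw [idealΛ_ofReal, idealΛ_ofReal, ← mul_sub, ← (hsum k 0).tsum_sub (hsum k 1), mul_left_comm,
      ← tsum_mul_left]
    congr 1
    exact tsum_congr fun q ↦ by ring
  rw [Finset.sum_congr rfl fun k _ ↦ e k, ← Finset.mul_sum, ← Summable.tsum_finsetSum]
  · rw [Function.comp_apply, Complex.ofReal_mul, Complex.ofReal_sub, Complex.ofReal_one,
      Complex.ofReal_tsum, mul_left_comm (2 * p : ℂ), ← tsum_mul_left (a := (2 * p : ℂ))]
    refine congrArg _ (tsum_congr fun q ↦ ?_)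
    rw [← Finset.mul_sum, sum_char_eq h.three_dvd c q, mul_left_comm]
    congr 1
    by_cases hq : q ∈ φ.fiber c
    · rw [Set.indicator_of_mem hq, Set.indicator_of_mem hq, Pi.one_apply, mul_one]
    · rw [Set.indicator_of_notMem hq, Set.indicator_of_notMem hq, mul_zero, Complex.ofReal_zero]
  · intro k _
    refine ((((hsum k 0).sub (hsum k 1)).mul_left (ZMod.stdAddChar (-(k * c)) : ℂ))).congr fun q ↦ ?_
    ring

end IdealLog
end
end PureCubic

namespace PureCubic
open NumberField Filter Topology

section
variable {K : Type*} [Field K] [NumberField K]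

lemma exists_prime_natCast_mem {v : Ideal (𝓞 K)} (hv : Prime v) :
    ∃ l : ℕ, l.Prime ∧ (l : 𝓞 K) ∈ v := by
  have hv' : v.IsPrime := Ideal.isPrime_of_prime hv
  have key : ∀ N : ℕ, N ≠ 0 → (N : 𝓞 K) ∈ v → ∃ l : ℕ, l.Prime ∧ (l : 𝓞 K) ∈ v := by
    intro N
    induction N using induction_on_primes with
    | zero => exact fun h ↦ absurd rfl h
    | one => exact fun _ h ↦ absurd ((Ideal.eq_top_iff_one v).mpr (by simpa using h)) hv'.ne_top
    | prime_mul q a hq ih =>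
      intro h0 h
      rw [Nat.cast_mul] at h
      rcases hv'.mem_or_mem h with h | h
      · exact ⟨q, hq, h⟩
      · exact ih (right_ne_zero_of_mul h0) h
  exact key _ (fun h ↦ hv.ne_zero (Ideal.absNorm_eq_zero_iff.mp h)) (Ideal.absNorm_mem v)

lemma eq_of_dvd_of_absNorm_eq {I J : Ideal (𝓞 K)} (hI : I ≠ 0) (h : I ∣ J)
    (hN : Ideal.absNorm I = Ideal.absNorm J) : I = J := by
  obtain ⟨H, rfl⟩ := h
  rw [map_mul] at hN
  have h0 : Ideal.absNorm I ≠ 0 := fun h0 ↦ hI (Ideal.absNorm_eq_zero_iff.mp h0)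
  have : Ideal.absNorm H = 1 := Nat.eq_of_mul_eq_mul_left (Nat.pos_of_ne_zero h0) (by rw [mul_one, ← hN])
  rw [Ideal.absNorm_eq_one_iff] at this
  rw [this, Ideal.mul_top]

lemma absNorm_mod_three_cases (hK : ∀ l : ℕ, Ideal.absNorm (Ideal.span {(l : 𝓞 K)}) = l ^ 3)
    {v : Ideal (𝓞 K)} (hv : Prime v) (h2 : Ideal.absNorm v % 3 = 2) :
    ∃ l : ℕ, l.Prime ∧ ((l % 3 = 2 ∧ Ideal.absNorm v = l) ∨ v = Ideal.span {(l : 𝓞 K)}) := by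
  obtain ⟨l, hl, hlv⟩ := exists_prime_natCast_mem hv
  have hdvd : v ∣ Ideal.span {(l : 𝓞 K)} := Ideal.dvd_span_singleton.mpr hlv
  obtain ⟨f, hf3, hf⟩ := (Nat.dvd_prime_pow hl).mp (hK l ▸ Ideal.absNorm_dvd_absNorm_of_le
    (Ideal.le_of_dvd hdvd))
  refine ⟨l, hl, ?_⟩
  interval_cases f
  · rw [hf, pow_zero] at h2
    omega
  · exact Or.inl ⟨by rwa [hf, pow_one] at h2, by rw [hf, pow_one]⟩
  · rw [hf, Nat.pow_mod] at h2
    have : l % 3 < 3 := Nat.mod_lt _ (by norm_num)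
    interval_cases l % 3 <;> omega
  · exact Or.inr (eq_of_dvd_of_absNorm_eq hv.ne_zero hdvd (by rw [hf, hK]))

namespace IdealLog
variable {m : 𝓞 K} {p : ℕ} {φ : IdealLog m p} {D : CubicData K} [Fact p.Prime]

theorem Admissible.infinite (h : φ.Admissible D) (hp : p ≠ 2) (c : ZMod p)
    (hK : ∀ l : ℕ, Ideal.absNorm (Ideal.span {(l : 𝓞 K)}) = l ^ 3) :
    {l : ℕ | l.Prime ∧ l % 3 = 2 ∧ ∃ 𝔩 : Ideal (𝓞 K), Ideal.absNorm 𝔩 = l ∧ φ.toFun 𝔩 = c}.Infinite := by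
  intro hfin
  refine h.not_summable_fiber hp c ?_
  set F : Ideal (𝓞 K) → ℝ := fun v ↦ (φ.fiber c).indicator (primePow 1) (v, 0) with hF
  have hF0 : ∀ v, 0 ≤ F v := fun v ↦ Set.indicator_nonneg (fun _ _ ↦ primePow_nonneg _ _) _
  have hFle : ∀ v, F v ≤ primePow 1 (v, 0) := fun v ↦
    Set.indicator_le_self' (fun _ _ ↦ primePow_nonneg _ _) _
  set T := ⋃ l ∈ {l : ℕ | l.Prime ∧ l % 3 = 2 ∧ ∃ 𝔩 : Ideal (𝓞 K),
    Ideal.absNorm 𝔩 = l ∧ φ.toFun 𝔩 = c}, {I : Ideal (𝓞 K) | Ideal.absNorm I = l} with hT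
  have hTfin : T.Finite := hfin.biUnion fun l _ ↦ Ideal.finite_setOfPred_absNorm_eq l
  have hsupp : ∀ v ∉ T, F v ≠ 0 → v ∈ Set.range fun l : ℕ ↦ Ideal.span {((l + 1 : ℕ) : 𝓞 K)} := by
    intro v hvT hv
    have hvf : (v, 0) ∈ φ.fiber c := Set.mem_of_indicator_ne_zero hv
    have hvp : Prime v := by
      by_contra hvp
      exact hv (le_antisymm ((hFle v).trans (primePow_of_not_prime 1 hvp).le) (hF0 v))
    obtain ⟨-, hc, hN⟩ := hvf
    rw [zero_add, pow_one] at hc hN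
    obtain ⟨l, hl, ⟨hl3, hlv⟩ | hlv⟩ := absNorm_mod_three_cases hK hvp hN
    · exact absurd (Set.mem_biUnion (show l ∈ {l : ℕ | l.Prime ∧ l % 3 = 2 ∧ ∃ 𝔩 : Ideal (𝓞 K),
        Ideal.absNorm 𝔩 = l ∧ φ.toFun 𝔩 = c} from ⟨hl, hl3, v, hlv, hc⟩) hlv) hvT
    · exact ⟨l - 1, by rw [hlv]; simp only [Nat.sub_add_cancel hl.one_le]⟩
  have hinj : Function.Injective fun l : ℕ ↦ Ideal.span {((l + 1 : ℕ) : 𝓞 K)} := by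
    intro a b hab
    have := congrArg Ideal.absNorm hab
    simp only [hK] at this
    have := Nat.pow_left_injective (n := 3) (by norm_num) this
    omega
  have h1 : Summable (T.indicator F) :=
    summable_of_hasFiniteSupport (hTfin.subset Set.support_indicator_subset)
  have h2 : Summable (Tᶜ.indicator F) := by
    rw [← hinj.summable_iff]
    · refine Summable.of_nonneg_of_le (fun l ↦ Set.indicator_nonneg (fun _ _ ↦ hF0 _) _) (fun l ↦ ?_)
        (((summable_nat_add_iff 1).mpr (Real.summable_nat_pow_inv.mpr one_lt_two)).mul_left 3)
      refine (Set.indicator_le_self' (fun _ _ ↦ hF0 _) _).trans ((hFle _).trans ?_)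
      have hl : (0 : ℝ) < ((l + 1 : ℕ) : ℝ) := by positivity
      have hlog : Real.log ((l + 1 : ℕ) : ℝ) ≤ ((l + 1 : ℕ) : ℝ) := Real.log_le_self hl.le
      by_cases hv : Prime (Ideal.span {((l + 1 : ℕ) : 𝓞 K)})
      · rw [primePow, primeWeight, if_pos hv, zero_add, pow_one, hK, Nat.cast_pow, Real.log_pow,
          Real.rpow_neg_one]
        push_cast at hlog hl ⊢
        calc 3 * Real.log (l + 1) * (((l : ℝ) + 1) ^ 3)⁻¹ ≤ 3 * (l + 1) * (((l : ℝ) + 1) ^ 3)⁻¹ := by gcongr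
          _ = 3 * (((l : ℝ) + 1) ^ 2)⁻¹ := by field_simp
      · rw [primePow_of_not_prime 1 hv]
        positivity
    · intro v hv
      by_contra hne
      have hvT : v ∈ Tᶜ := Set.mem_of_indicator_ne_zero hne
      rw [Set.indicator_of_mem hvT] at hne
      exact hv (hsupp v hvT hne)
  refine (h1.add h2).congr fun v ↦ ?_
  exact (Set.indicator_self_add_compl_apply T F v).symm ▸ rfl

end IdealLog
end
end PureCubic

namespace PureCubic
open NumberField Polynomial

section
variable {L : Type*} [Field L] [NumberField L] {P : ℕ} {x : L}

/-- The polynomial `(X + s)³ - P` is Eisenstein at `q`. -/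
lemma isEisensteinAt_shift {P s q : ℤ} (hq : Prime q) (h3 : q ∣ 3 * s) (h : q ∣ s ^ 3 - P)
    (h2 : ¬ q ^ 2 ∣ s ^ 3 - P) :
    (Cubic.toPoly ⟨1, 3 * s, 3 * s ^ 2, s ^ 3 - P⟩).IsEisensteinAt (Ideal.span {q}) where
  leading := by
    rw [Cubic.leadingCoeff_of_a_ne_zero' one_ne_zero, ← Ideal.eq_top_iff_one,
      Ideal.span_singleton_eq_top]
    exact hq.not_isUnit
  mem {n} hn := by
    rw [Cubic.natDegree_of_a_ne_zero' one_ne_zero] at hn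
    rw [Ideal.mem_span_singleton]
    interval_cases n
    · rwa [Cubic.coeff_eq_d]
    · rw [Cubic.coeff_eq_c]
      exact h3.trans ⟨s, by ring⟩
    · rwa [Cubic.coeff_eq_b]
  notMem := by
    rwa [Cubic.coeff_eq_d, Ideal.span_singleton_pow, Ideal.mem_span_singleton]

lemma irreducible_shift {P s q : ℤ} (hq : Prime q) (h3 : q ∣ 3 * s) (h : q ∣ s ^ 3 - P)
    (h2 : ¬ q ^ 2 ∣ s ^ 3 - P) :
    Irreducible (Cubic.toPoly (R := ℤ) ⟨1, 3 * s, 3 * s ^ 2, s ^ 3 - P⟩) :=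
  (isEisensteinAt_shift hq h3 h h2).irreducible
    ((Ideal.span_singleton_prime hq.ne_zero).mpr hq) (Cubic.monic_of_a_eq_one').isPrimitive
    (by rw [Cubic.natDegree_of_a_ne_zero' one_ne_zero]; norm_num)

omit [NumberField L] in
lemma isIntegral_of_pow_three (hx : x ^ 3 = P) : IsIntegral ℤ x :=
  IsIntegral.of_pow (n := 3) (by norm_num) (by rw [hx]; exact_mod_cast isIntegral_algebraMap (R := ℤ) (A := L) (x := (P : ℤ)))

lemma minpoly_shift (hx : x ^ 3 = P) {s q : ℤ} (hq : Prime q) (h3 : q ∣ 3 * s)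
    (h : q ∣ s ^ 3 - P) (h2 : ¬ q ^ 2 ∣ s ^ 3 - P) :
    minpoly ℤ (x - s) = Cubic.toPoly ⟨1, 3 * s, 3 * s ^ 2, s ^ 3 - P⟩ := by
  have hxint : IsIntegral ℤ (x - s) :=
    (isIntegral_of_pow_three hx).sub (isIntegral_algebraMap (x := s))
  refine eq_of_monic_of_associated (minpoly.monic hxint) Cubic.monic_of_a_eq_one' ?_
  refine (minpoly.irreducible hxint).associated_of_dvd (irreducible_shift hq h3 h h2)
    (minpoly.isIntegrallyClosed_dvd hxint ?_)
  simp only [Cubic.toPoly, map_add, map_mul, aeval_X, map_pow, aeval_C, algebraMap_int_eq,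
    Int.coe_castRingHom]
  push_cast
  linear_combination hx

omit [NumberField L] in
lemma adjoin_sub_intCast (R : Type*) [CommRing R] [Algebra R L] (s : ℤ) :
    Algebra.adjoin R {x - (s : L)} = Algebra.adjoin R {x} := by
  apply le_antisymm <;> rw [Algebra.adjoin_le_iff, Set.singleton_subset_iff]
  · exact sub_mem (Algebra.self_mem_adjoin_singleton R x) (intCast_mem _ s)
  · have := add_mem (Algebra.self_mem_adjoin_singleton R (x - (s : L)))
      (intCast_mem (Algebra.adjoin R {x - (s : L)}) s)
    rwa [sub_add_cancel] at this

lemma mem_adjoin_of_prime_pow_smul_mem (hx : x ^ 3 = P) (htop : Algebra.adjoin ℚ {x} = ⊤) {s q : ℤ}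
    (hq : Prime q) (h3 : q ∣ 3 * s) (h : q ∣ s ^ 3 - P) (h2 : ¬ q ^ 2 ∣ s ^ 3 - P) {n : ℕ} {z : L}
    (hz : IsIntegral ℤ z) (hmem : q ^ n • z ∈ Algebra.adjoin ℤ {x}) : z ∈ Algebra.adjoin ℤ {x} := by
  have hxint : IsIntegral ℤ (x - s) :=
    (isIntegral_of_pow_three hx).sub (isIntegral_algebraMap (x := s))
  have htop' : Algebra.adjoin ℚ {x - (s : L)} = ⊤ := by rw [adjoin_sub_intCast, htop]
  rw [← adjoin_sub_intCast ℤ s] at hmem ⊢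
  refine mem_adjoin_of_smul_prime_pow_smul_of_minpoly_isEisensteinAt (K := ℚ)
    (B := PowerBasis.ofAdjoinEqTop (hxint.tower_top) htop') hq hxint hz hmem ?_
  rw [PowerBasis.ofAdjoinEqTop_gen, minpoly_shift hx hq h3 h h2]
  exact isEisensteinAt_shift hq h3 h h2

lemma finrank_eq_three (hx : x ^ 3 = P) (htop : Algebra.adjoin ℚ {x} = ⊤) {q : ℤ} (hq : Prime q)
    (h : q ∣ P) (h2 : ¬ q ^ 2 ∣ P) : Module.finrank ℚ L = 3 := by
  have hm := minpoly_shift hx (s := 0) hq (by simp) (by simpa using h) (by simpa using h2)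
  rw [Int.cast_zero, sub_zero] at hm
  have hxint := isIntegral_of_pow_three hx
  rw [(PowerBasis.ofAdjoinEqTop hxint.tower_top htop).finrank, PowerBasis.ofAdjoinEqTop_dim,
    minpoly.isIntegrallyClosed_eq_field_fractions' ℚ hxint, hm,
    (Cubic.monic_of_a_eq_one').natDegree_map, Cubic.natDegree_of_a_ne_zero' one_ne_zero]

lemma discr_smul_mem (hx : x ^ 3 = P) (htop : Algebra.adjoin ℚ {x} = ⊤) {q : ℤ} (hq : Prime q)
    (h : q ∣ P) (h2 : ¬ q ^ 2 ∣ P) {z : L} (hz : IsIntegral ℤ z) :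
    ((27 * P ^ 2 : ℕ) : ℤ) • z ∈ Algebra.adjoin ℤ {x} := by
  have hxint := isIntegral_of_pow_three hx
  have hfin := finrank_eq_three hx htop hq h h2
  have hm := minpoly_shift hx (s := 0) hq (by simp) (by simpa using h) (by simpa using h2)
  rw [Int.cast_zero, sub_zero] at hm
  have hN : Algebra.norm ℚ x = P := by
    have e := congrArg (Algebra.norm ℚ) hx
    rw [map_pow, ← map_natCast (algebraMap ℚ L), Algebra.norm_algebraMap, hfin] at e
    exact (Odd.strictMono_pow (R := ℚ) (by decide : Odd 3)).injective e
  have := Algebra.discr_mul_isIntegral_mem_adjoin ℚ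
    (B := PowerBasis.ofAdjoinEqTop hxint.tower_top htop) hxint hz
  rw [Algebra.discr_powerBasis_eq_norm, PowerBasis.ofAdjoinEqTop_gen, hfin,
    minpoly.isIntegrallyClosed_eq_field_fractions' ℚ hxint, hm] at this
  have e : aeval x (derivative (Polynomial.map (algebraMap ℤ ℚ)
      (Cubic.toPoly ⟨1, 3 * 0, 3 * 0 ^ 2, 0 ^ 3 - (P : ℤ)⟩))) = algebraMap ℚ L 3 * x ^ 2 := by
    simp [Cubic.toPoly]
    norm_num
  rw [e, map_mul, Algebra.norm_algebraMap, map_pow, hN, hfin] at this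
  have := neg_mem this
  rw [← neg_smul] at this
  convert this using 1
  rw [← Int.cast_smul_eq_zsmul ℚ]
  congr 1
  push_cast
  norm_num

lemma mem_adjoin_of_isIntegral {p : ℕ} (hp : p.Prime) (hp3 : 3 ≤ p) (hP : P = 2 * p ∨ P = p)
    (hP9 : P % 9 ≠ 1 ∧ P % 9 ≠ 8) (hx : x ^ 3 = P) (htop : Algebra.adjoin ℚ {x} = ⊤) {z : L}
    (hz : IsIntegral ℤ z) : z ∈ Algebra.adjoin ℤ {x} := by
  have hpp : Prime (p : ℤ) := Nat.prime_iff_prime_int.mp hp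
  have h2p : ¬ p ∣ 2 := fun h ↦ by
    have := Nat.le_of_dvd (by norm_num) h
    omega
  have hpP : p ∣ P := by rcases hP with rfl | rfl <;> simp
  have hp2P : ¬ p ^ 2 ∣ P := by
    rw [pow_two]
    rcases hP with rfl | rfl
    · rwa [Nat.mul_dvd_mul_iff_right hp.pos]
    · intro h
      have := Nat.le_of_dvd hp.pos h
      nlinarith
  have h1 := discr_smul_mem hx htop hpp (by exact_mod_cast hpP) (by exact_mod_cast hp2P) hz
  have hstep : ∀ k : ℤ, (p : ℤ) ^ 2 • (k • z) ∈ Algebra.adjoin ℤ {x} → k • z ∈ Algebra.adjoin ℤ {x} :=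
    fun k ↦ mem_adjoin_of_prime_pow_smul_mem hx htop hpp (s := 0) (n := 2) (by simp)
      (by simpa using (by exact_mod_cast hpP : (p : ℤ) ∣ P))
      (by simpa using (by exact_mod_cast hp2P : ¬ (p : ℤ) ^ 2 ∣ P)) (hz.smul k)
  have h3 : (3 : ℤ) ^ 3 • z ∈ Algebra.adjoin ℤ {x} := by
    rcases hP with rfl | rfl
    · refine mem_adjoin_of_prime_pow_smul_mem hx htop Int.prime_two (s := 0) (n := 2) (by simp)
        (by simp) ?_ (hz.smul (3 ^ 3 : ℤ)) ?_
      · have : ¬ 2 ∣ p := fun h ↦ h2p ((Nat.prime_dvd_prime_iff_eq Nat.prime_two hp).mp h ▸ dvd_rfl)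
        simp only [ne_eq, OfNat.ofNat_ne_zero, not_false_eq_true, zero_pow, zero_sub, dvd_neg]
        omega
      · rw [smul_smul]
        refine hstep _ ?_
        convert h1 using 1
        rw [smul_smul]
        push_cast
        ring_nf
    · refine hstep _ ?_
      convert h1 using 1
      rw [smul_smul]
      push_cast
      ring_nf
  by_cases h3P : 3 ∣ P
  · have : ¬ 9 ∣ P := by
      have h3p : 3 ∣ p := by
        rcases hP with rfl | rfl
        · omega
        · exact h3P
      obtain rfl := (Nat.prime_dvd_prime_iff_eq Nat.prime_three hp).mp h3p
      omega
    exact mem_adjoin_of_prime_pow_smul_mem hx htop Int.prime_three (s := 0) (by simp)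
      (by simpa using (by omega : (3 : ℤ) ∣ P)) (by simpa using (by omega : ¬ (3 : ℤ) ^ 2 ∣ P)) hz h3
  · have key : ((P : ℤ) ^ 3 - P) % 9 = (((P : ℤ) % 9) ^ 3 - (P : ℤ) % 9) % 9 :=
      ((Int.mod_modEq (P : ℤ) 9).symm.pow 3).sub (Int.mod_modEq (P : ℤ) 9).symm
    have hlt : (P : ℤ) % 9 < 9 := Int.emod_lt_of_pos _ (by norm_num)
    have hnn : 0 ≤ (P : ℤ) % 9 := Int.emod_nonneg _ (by norm_num)
    have h' : (3 : ℤ) ∣ (P : ℤ) ^ 3 - P ∧ ¬ (3 : ℤ) ^ 2 ∣ (P : ℤ) ^ 3 - P := by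
      generalize (P : ℤ) ^ 3 = Q at *
      generalize hr : (P : ℤ) % 9 = r at *
      interval_cases r <;> omega
    exact mem_adjoin_of_prime_pow_smul_mem hx htop Int.prime_three (s := P) ⟨P, rfl⟩ h'.1 h'.2 hz h3

end
end PureCubic

namespace PureCubic
open NumberField Module

lemma cbrt_pow_three (P : ℕ) : cbrt P ^ 3 = P := by
  rw [cbrt, ← Real.rpow_natCast, ← Real.rpow_mul (Nat.cast_nonneg P)]
  norm_num

/-- A pure cubic field `ℚ(θ)`, `θ³ = P`, with ring of integers `ℤ[θ]`, together with a real and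
a non-real embedding. -/
structure PureCubicField (K : Type*) [Field K] [NumberField K] (P : ℕ) where
  θ : 𝓞 K
  cube : θ ^ 3 = P
  B : Basis (Fin 3) ℤ (𝓞 K)
  B_apply : ∀ i, B i = θ ^ (i : ℕ)
  A : 𝓞 K →+* ℝ
  A_θ : A θ = cbrt P
  T : 𝓞 K →+* ℂ
  T_θ : T θ = ⟨-1 / 2 * cbrt P, √3 / 2 * cbrt P⟩

lemma nonempty_pureCubicField {K : Type*} [Field K] [NumberField K] {P p : ℕ} (hp : p.Prime)
    (hp3 : 3 ≤ p) (hP : P = 2 * p ∨ P = p) (hP9 : P % 9 ≠ 1 ∧ P % 9 ≠ 8) (hpP : p ∣ P)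
    (hp2P : ¬ p ^ 2 ∣ P) {x : K} (hx : x ^ 3 = P) (htop : Algebra.adjoin ℚ {x} = ⊤) {A : K →+* ℝ}
    (hA : A x = cbrt P) {T : K →+* ℂ} (hT : T x = ⟨-1 / 2 * cbrt P, √3 / 2 * cbrt P⟩) :
    Nonempty (PureCubicField K P) := by
  have hpp : Prime (p : ℤ) := Nat.prime_iff_prime_int.mp hp
  set θ : 𝓞 K := ⟨x, isIntegral_of_pow_three hx⟩
  have hθ : θ ^ 3 = P := by
    apply RingOfIntegers.coe_injective
    rw [map_pow, map_natCast]
    exact hx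
  have hθtop : Algebra.adjoin ℤ {θ} = ⊤ := by
    refine eq_top_iff.mpr fun z _ ↦ ?_
    have hz := mem_adjoin_of_isIntegral hp hp3 hP hP9 hx htop (RingOfIntegers.isIntegral_coe z)
    have e : Algebra.adjoin ℤ {x} = (Algebra.adjoin ℤ {θ}).map (IsScalarTower.toAlgHom ℤ (𝓞 K) K) := by
      rw [AlgHom.map_adjoin, Set.image_singleton]
      rfl
    rw [e] at hz
    obtain ⟨w, hw, hwz⟩ := hz
    rwa [← RingOfIntegers.coe_injective hwz]
  set pb := PowerBasis.ofAdjoinEqTop' (RingOfIntegers.isIntegral θ) hθtop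
  have hdim : pb.dim = 3 := by
    rw [← pb.finrank, RingOfIntegers.rank, finrank_eq_three hx htop hpp (by exact_mod_cast hpP)
      (by exact_mod_cast hp2P)]
  refine ⟨⟨θ, hθ, pb.basis.reindex (finCongr hdim), fun i ↦ ?_,
    A.comp (algebraMap (𝓞 K) K), hA, T.comp (algebraMap (𝓞 K) K), hT⟩⟩
  rw [Basis.reindex_apply, PowerBasis.basis_eq_pow, PowerBasis.ofAdjoinEqTop'_gen]
  rfl

lemma exists_pureCubicField {P p : ℕ} (hp : p.Prime) (hp3 : 3 ≤ p) (hP : P = 2 * p ∨ P = p)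
    (hP9 : P % 9 ≠ 1 ∧ P % 9 ≠ 8) :
    ∃ (K : Type) (_ : Field K) (_ : NumberField K), Nonempty (PureCubicField K P) := by
  have hpp : Prime (p : ℤ) := Nat.prime_iff_prime_int.mp hp
  have h2p : ¬ p ∣ 2 := fun h ↦ by
    have := Nat.le_of_dvd (by norm_num) h
    omega
  have hpP : p ∣ P := by rcases hP with rfl | rfl <;> simp
  have hp2P : ¬ p ^ 2 ∣ P := by
    rw [pow_two]
    rcases hP with rfl | rfl
    · rwa [Nat.mul_dvd_mul_iff_right hp.pos]
    · intro h
      have := Nat.le_of_dvd hp.pos h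
      nlinarith
  have hirr : Irreducible (Polynomial.X ^ 3 - Polynomial.C (P : ℚ)) := by
    have h1 := irreducible_shift (P := P) (s := 0) hpp (by simp)
      (by simpa using (by exact_mod_cast hpP : (p : ℤ) ∣ P))
      (by simpa using (by exact_mod_cast hp2P : ¬ (p : ℤ) ^ 2 ∣ P))
    rw [Polynomial.Monic.irreducible_iff_irreducible_map_fraction_map (K := ℚ)
      Cubic.monic_of_a_eq_one'] at h1
    simpa [Cubic.toPoly, sub_eq_add_neg] using h1
  have : Fact (Irreducible (Polynomial.X ^ 3 - Polynomial.C (P : ℚ))) := ⟨hirr⟩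
  let K := AdjoinRoot (Polynomial.X ^ 3 - Polynomial.C (P : ℚ))
  let x : K := AdjoinRoot.root _
  have hx : x ^ 3 = P := by
    have := AdjoinRoot.eval₂_root (Polynomial.X ^ 3 - Polynomial.C (P : ℚ))
    simpa [sub_eq_zero] using this
  have htop : Algebra.adjoin ℚ {x} = ⊤ := AdjoinRoot.adjoinRoot_eq_top
  have hA : Polynomial.eval₂ (algebraMap ℚ ℝ) (cbrt P) (Polynomial.X ^ 3 - Polynomial.C (P : ℚ)) = 0 := by
    simp [cbrt_pow_three]
  have hT : Polynomial.eval₂ (algebraMap ℚ ℂ) ⟨-1 / 2 * cbrt P, √3 / 2 * cbrt P⟩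
      (Polynomial.X ^ 3 - Polynomial.C (P : ℚ)) = 0 := by
    have h3 : (√3) ^ 2 = 3 := Real.sq_sqrt (by norm_num)
    have hc := cbrt_pow_three P
    simp only [Polynomial.eval₂_sub, Polynomial.eval₂_X_pow, map_natCast,
      sub_eq_zero]
    apply Complex.ext
    · simp [pow_succ]
      linear_combination hc * (-1 / 8 + 3 / 8 * √3 ^ 2) + 3 / 8 * P * h3
    · simp [pow_succ]
      linear_combination hc * (3 / 8 * √3 - √3 ^ 3 / 8) - √3 / 8 * P * h3
  exact ⟨K, inferInstance, inferInstance, nonempty_pureCubicField hp hp3 hP hP9 hpP hp2P hx htop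
    (AdjoinRoot.lift_root hA) (AdjoinRoot.lift_root hT)⟩

namespace PureCubicField
variable {K : Type*} [Field K] [NumberField K] {P : ℕ} (F : PureCubicField K P)

/-- The element `a + bθ + cθ²`. -/
def elt (a b c : ℤ) : 𝓞 K := a + b * F.θ + c * F.θ ^ 2

lemma exists_elt (x : 𝓞 K) : ∃ a b c, x = F.elt a b c := by
  refine ⟨F.B.repr x 0, F.B.repr x 1, F.B.repr x 2, ?_⟩
  conv_lhs => rw [← F.B.sum_repr x]
  simp [Fin.sum_univ_three, F.B_apply, elt]

lemma repr_elt (a b c : ℤ) : ⇑(F.B.repr (F.elt a b c)) = ![a, b, c] := by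
  have e : F.elt a b c = ∑ i, ![a, b, c] i • F.B i := by
    simp [Fin.sum_univ_three, F.B_apply, elt]
  rw [e, F.B.repr_sum_self]

lemma elt_inj {a b c a' b' c' : ℤ} :
    F.elt a b c = F.elt a' b' c' ↔ a = a' ∧ b = b' ∧ c = c' := by
  refine ⟨fun h ↦ ?_, by rintro ⟨rfl, rfl, rfl⟩; rfl⟩
  have := congrArg (fun z ↦ ⇑(F.B.repr z)) h
  simp only [repr_elt] at this
  simpa using this

lemma elt_mul (a b c a' b' c' : ℤ) : F.elt a b c * F.elt a' b' c' =
    F.elt (a * a' + P * (b * c' + c * b')) (a * b' + b * a' + P * (c * c'))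
      (a * c' + b * b' + c * a') := by
  have h := F.cube
  unfold elt
  push_cast
  linear_combination ((b * c' + c * b' : 𝓞 K) + c * c' * F.θ) * h

lemma intCast_eq_elt (a : ℤ) : (a : 𝓞 K) = F.elt a 0 0 := by simp [elt]

lemma norm_elt (a b c : ℤ) :
    Algebra.norm ℤ (F.elt a b c) = a ^ 3 + P * b ^ 3 + P ^ 2 * c ^ 3 - 3 * P * a * b * c := by
  have e : Algebra.leftMulMatrix F.B (F.elt a b c) =
      !![a, P * c, P * b; b, a, P * c; c, b, a] := by
    ext i j
    rw [Algebra.leftMulMatrix_eq_repr_mul, F.B_apply]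
    have e0 : F.θ ^ ((0 : Fin 3) : ℕ) = F.elt 1 0 0 := by simp [elt]
    have e1 : F.θ ^ ((1 : Fin 3) : ℕ) = F.elt 0 1 0 := by simp [elt]
    have e2 : F.θ ^ ((2 : Fin 3) : ℕ) = F.elt 0 0 1 := by simp [elt]
    fin_cases j
    · rw [show (⟨0, by norm_num⟩ : Fin 3) = 0 from rfl, e0, elt_mul, repr_elt]
      fin_cases i <;> simp
    · rw [show (⟨1, by norm_num⟩ : Fin 3) = 1 from rfl, e1, elt_mul, repr_elt]
      fin_cases i <;> simp
    · rw [show (⟨2, by norm_num⟩ : Fin 3) = 2 from rfl, e2, elt_mul, repr_elt]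
      fin_cases i <;> simp
  rw [Algebra.norm_eq_matrix_det F.B, e, Matrix.det_fin_three]
  simp
  ring

lemma A_elt (a b c : ℤ) : F.A (F.elt a b c) = a + b * cbrt P + c * cbrt P ^ 2 := by
  simp [elt, F.A_θ]

lemma re_T_elt (a b c : ℤ) :
    (F.T (F.elt a b c)).re = a - b * cbrt P / 2 - c * cbrt P ^ 2 / 2 := by
  have h3 : (√3) ^ 2 = 3 := Real.sq_sqrt (by norm_num)
  simp [elt, F.T_θ, pow_two]
  linear_combination -c * cbrt P ^ 2 / 4 * h3

lemma im_T_elt (a b c : ℤ) :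
    (F.T (F.elt a b c)).im = √3 / 2 * (b * cbrt P - c * cbrt P ^ 2) := by
  simp [elt, F.T_θ, pow_two]
  ring

lemma absNorm_span_elt (a b c : ℤ) : (Ideal.absNorm (Ideal.span {F.elt a b c}) : ℤ) =
    |a ^ 3 + P * b ^ 3 + P ^ 2 * c ^ 3 - 3 * P * a * b * c| := by
  rw [Ideal.absNorm_span_singleton, norm_elt, Int.natCast_natAbs]

lemma absNorm_span (x : 𝓞 K) :
    (Ideal.absNorm (Ideal.span {x}) : ℝ) = |F.A x| * ‖F.T x‖ ^ 2 := by
  obtain ⟨a, b, c, rfl⟩ := F.exists_elt x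
  have h3 : (√3) ^ 2 = 3 := Real.sq_sqrt (by norm_num)
  have hc := cbrt_pow_three P
  rw [← Int.cast_natCast, absNorm_span_elt, ← abs_of_nonneg (sq_nonneg ‖F.T (F.elt a b c)‖), ← abs_mul,
    Int.cast_abs, ← Complex.normSq_eq_norm_sq, Complex.normSq_apply, re_T_elt, im_T_elt, A_elt]
  congr 1
  push_cast
  rw [← hc]
  linear_combination -(a + b * cbrt P + c * cbrt P ^ 2) / 4 * (b * cbrt P - c * cbrt P ^ 2) ^ 2 * h3

end PureCubicField
end PureCubic

namespace PureCubic
open NumberField Module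

lemma summable_one_add_abs_rpow {s : ℝ} (hs : 1 < s) :
    Summable fun n : ℤ ↦ (1 + |(n : ℝ)|) ^ (-s) := by
  refine Summable.of_nonneg_of_le (fun n ↦ by positivity) (fun n ↦ ?_)
    ((Real.summable_abs_int_rpow hs).add
      (summable_of_hasFiniteSupport (f := fun n : ℤ ↦ if n = 0 then (1 : ℝ) else 0)
        ((Set.finite_singleton 0).subset fun n hn ↦ by simpa using hn)))
  by_cases hn : n = 0
  · subst hn
    simp only [Int.cast_zero, abs_zero, add_zero, Real.one_rpow, if_true, le_add_iff_nonneg_left]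
    positivity
  · rw [if_neg hn, add_zero]
    exact Real.rpow_le_rpow_of_nonpos (by positivity) (by linarith) (by linarith)

lemma one_le_cbrt {P : ℕ} (hP : 1 ≤ P) : 1 ≤ cbrt P :=
  Real.one_le_rpow (by exact_mod_cast hP) (by norm_num)

namespace PureCubicField
variable {K : Type*} [Field K] [NumberField K] {P : ℕ} (F : PureCubicField K P)

lemma A_injective : Function.Injective F.A := by
  rw [injective_iff_map_eq_zero]
  intro x hx
  have := F.absNorm_span x
  rw [hx, abs_zero, zero_mul, Nat.cast_eq_zero, Ideal.absNorm_eq_zero_iff] at this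
  simpa using this

lemma summable_rpow (hP : 1 ≤ P) {τ : ℝ} (hτ : 3 < τ) :
    Summable fun x ↦ (1 + |F.A x| + ‖F.T x‖) ^ (-τ) := by
  set e : ℤ × ℤ × ℤ → 𝓞 K := fun v ↦ F.elt v.1 v.2.1 v.2.2
  have he : Function.Bijective e := by
    refine ⟨fun v w h ↦ ?_, fun x ↦ ?_⟩
    · obtain ⟨h1, h2, h3⟩ := F.elt_inj.mp h
      ext <;> assumption
    · obtain ⟨a, b, c, rfl⟩ := F.exists_elt x
      exact ⟨(a, b, c), rfl⟩
  rw [← (Equiv.ofBijective e he).summable_iff]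
  have h1 := summable_one_add_abs_rpow (s := τ / 3) (by linarith)
  have h2 := h1.mul_of_nonneg (h1.mul_of_nonneg h1 (fun _ ↦ by positivity) (fun _ ↦ by positivity))
    (fun _ ↦ by positivity) (fun _ ↦ mul_nonneg (by positivity) (by positivity))
  refine Summable.of_nonneg_of_le (fun v ↦ by dsimp only [Function.comp_apply]; positivity) (fun v ↦ ?_)
    (h2.mul_left (8⁻¹ ^ (-(τ / 3))))
  obtain ⟨a, b, c⟩ := v
  simp only [Function.comp_apply, Equiv.ofBijective_apply, e]
  have hA := F.A_elt a b c
  have hr := F.re_T_elt a b c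
  have hi := F.im_T_elt a b c
  have ht := one_le_cbrt hP
  have hre := Complex.abs_re_le_norm (F.T (F.elt a b c))
  have him := Complex.abs_im_le_norm (F.T (F.elt a b c))
  set S := 1 + |F.A (F.elt a b c)| + ‖F.T (F.elt a b c)‖ with hS
  have hnn := norm_nonneg (F.T (F.elt a b c))
  have hs3 : (√3) ^ 2 = 3 := Real.sq_sqrt (by norm_num)
  have hs1 : 1 ≤ √3 := Real.one_le_sqrt.mpr (by norm_num)
  have hA' := abs_le.mp (le_refl |F.A (F.elt a b c)|)
  have hre' := abs_le.mp hre
  have hdiff : |b * cbrt P - c * cbrt P ^ 2| ≤ 2 * ‖F.T (F.elt a b c)‖ := by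
    rw [hi, abs_mul, abs_of_nonneg (by positivity)] at him
    nlinarith [abs_nonneg (b * cbrt P - c * cbrt P ^ 2)]
  have hdiff' := abs_le.mp hdiff
  have ha : 1 + |(a : ℝ)| ≤ 2 * S := by
    have : |(a : ℝ)| ≤ 2 * S - 1 := by
      rw [abs_le]
      constructor <;> linarith
    linarith
  have hb : 1 + |(b : ℝ)| ≤ 2 * S := by
    have : |b * cbrt P| ≤ 2 * S - 1 := by
      rw [abs_le]
      constructor <;> linarith
    rw [abs_mul, abs_of_nonneg (by linarith : 0 ≤ cbrt P)] at this
    nlinarith [abs_nonneg (b : ℝ)]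
  have hc : 1 + |(c : ℝ)| ≤ 2 * S := by
    have : |c * cbrt P ^ 2| ≤ 2 * S - 1 := by
      rw [abs_le]
      constructor <;> linarith
    rw [abs_mul, abs_of_nonneg (by positivity : 0 ≤ cbrt P ^ 2)] at this
    have h1 : 1 ≤ cbrt P ^ 2 := one_le_pow₀ ht
    nlinarith [abs_nonneg (c : ℝ)]
  have hS0 : 0 < S := by positivity
  have hS3 : 8⁻¹ * ((1 + |(a : ℝ)|) * ((1 + |(b : ℝ)|) * (1 + |(c : ℝ)|))) ≤ S ^ 3 := by
    calc _ ≤ 8⁻¹ * (2 * S * (2 * S * (2 * S))) := by gcongr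
      _ = S ^ 3 := by ring
  calc S ^ (-τ) = (S ^ 3) ^ (-(τ / 3)) := by
        rw [← Real.rpow_natCast, ← Real.rpow_mul hS0.le]
        congr 1
        push_cast
        ring
    _ ≤ _ := Real.rpow_le_rpow_of_nonpos (by positivity) hS3 (by linarith)
    _ = _ := by
      rw [Real.mul_rpow (by positivity) (by positivity), Real.mul_rpow (by positivity) (by positivity),
        Real.mul_rpow (by positivity) (by positivity)]

lemma inOrder_A (x : 𝓞 K) : InOrder P (F.A x) := by
  obtain ⟨a, b, c, rfl⟩ := F.exists_elt x
  exact ⟨a, b, c, F.A_elt a b c⟩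

lemma isUnitOfOrder_A (u : (𝓞 K)ˣ) : IsUnitOfOrder P (F.A u) :=
  ⟨F.inOrder_A _, F.A ↑u⁻¹, F.inOrder_A _, by rw [← map_mul, Units.mul_inv, map_one]⟩

lemma exists_unit_of_isUnitOfOrder {v : ℝ} (hv : IsUnitOfOrder P v) : ∃ u : (𝓞 K)ˣ, F.A u = v := by
  obtain ⟨⟨a, b, c, rfl⟩, w, ⟨a', b', c', rfl⟩, h⟩ := hv
  rw [← F.A_elt, ← F.A_elt, ← map_mul, ← map_one F.A] at h
  refine ⟨Units.mkOfMulEqOne _ _ (F.A_injective h), ?_⟩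
  rw [Units.val_mkOfMulEqOne, F.A_elt]

lemma exists_zpow {e : (𝓞 K)ˣ} (he : IsFundamentalUnit P (F.A e)) (u : (𝓞 K)ˣ) (hu : 0 < F.A u) :
    ∃ k : ℤ, u = e ^ k := by
  obtain ⟨k, hk1, hk2⟩ := exists_mem_Ico_zpow hu he.2.1
  have he0 : 0 < F.A e := zero_lt_one.trans he.2.1
  have hz : ∀ j : ℤ, F.A ↑(e ^ j) = F.A e ^ j := fun j ↦ by
    have := congrArg Units.val (map_zpow (Units.map (F.A : 𝓞 K →* ℝ)) e j)
    rwa [Units.val_zpow_eq_zpow_val] at this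
  have hv : F.A ↑(u * (e ^ k)⁻¹) = F.A u / F.A e ^ k := by
    rw [← zpow_neg, Units.val_mul, map_mul, hz, zpow_neg, div_eq_mul_inv]
  have h1 : 1 ≤ F.A ↑(u * (e ^ k)⁻¹) := by
    rwa [hv, one_le_div (zpow_pos he0 k)]
  have h2 : F.A ↑(u * (e ^ k)⁻¹) < F.A e := by
    rwa [hv, div_lt_iff₀ (zpow_pos he0 k), ← zpow_one_add₀ he0.ne', add_comm]
  refine ⟨k, ?_⟩
  rcases h1.eq_or_lt with h1 | h1
  · rw [← map_one F.A] at h1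
    rw [← mul_inv_eq_one]
    exact Units.ext (F.A_injective h1).symm
  · exact absurd (he.2.2 _ (F.isUnitOfOrder_A _) h1) (not_le.mpr h2)

/-- The analytic data attached to a pure cubic field. -/
def cubicData (hP : 1 ≤ P) {e : (𝓞 K)ˣ} (he : IsFundamentalUnit P (F.A e)) : CubicData K where
  A := F.A
  T := F.T
  ε := e
  absNorm_span := F.absNorm_span
  summable_rpow _ := F.summable_rpow hP
  one_lt := he.2.1
  exists_zpow := F.exists_zpow he

end PureCubicField
end PureCubic

namespace PureCubic
open NumberField Module

lemma two_ne_zero_zmod {p : ℕ} [Fact p.Prime] (hp : p ≠ 2) : (2 : ZMod p) ≠ 0 := fun h ↦ by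
  have := (ZMod.natCast_eq_zero_iff 2 p).mp (by exact_mod_cast h)
  exact hp ((Nat.prime_dvd_prime_iff_eq Fact.out Nat.prime_two).mp this)

lemma intCast_norm_mem {K : Type*} [Field K] [NumberField K] (x : 𝓞 K) :
    ((Algebra.norm ℤ x : ℤ) : 𝓞 K) ∈ Ideal.span {x} := by
  have := Ideal.absNorm_mem (Ideal.span {x})
  rw [Ideal.absNorm_span_singleton] at this
  generalize Algebra.norm ℤ x = N at this
  obtain ⟨k, rfl | rfl⟩ := Int.eq_nat_or_neg N
  · simpa using this
  · simpa using neg_mem this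

namespace PureCubicField
variable {K : Type*} [Field K] [NumberField K] {P : ℕ} (F : PureCubicField K P) (p : ℕ)

/-- The `i`-th coordinate modulo `p`. -/
noncomputable def coord (x : 𝓞 K) (i : Fin 3) : ZMod p := (F.B.repr x i : ℤ)

lemma coord_elt (a b c : ℤ) (i : Fin 3) : F.coord p (F.elt a b c) i = (![a, b, c] i : ℤ) := by
  rw [coord, repr_elt]

variable {p}

lemma coord_congr {x y : 𝓞 K} (h : (p : 𝓞 K) ∣ x - y) (i : Fin 3) :
    F.coord p x i = F.coord p y i := by
  obtain ⟨d, hd⟩ := h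
  rw [← sub_eq_zero, coord, coord, ← Int.cast_sub, ← Finsupp.sub_apply, ← map_sub, hd,
    ← nsmul_eq_mul, map_nsmul, Finsupp.smul_apply, nsmul_eq_mul, Int.cast_mul, Int.cast_natCast,
    ZMod.natCast_self, zero_mul]

lemma coord_mul (hpP : p ∣ P) (x y : 𝓞 K) :
    F.coord p (x * y) 0 = F.coord p x 0 * F.coord p y 0 ∧
    F.coord p (x * y) 1 = F.coord p x 0 * F.coord p y 1 + F.coord p x 1 * F.coord p y 0 ∧
    F.coord p (x * y) 2 = F.coord p x 0 * F.coord p y 2 + F.coord p x 1 * F.coord p y 1 +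
      F.coord p x 2 * F.coord p y 0 := by
  obtain ⟨a, b, c, rfl⟩ := F.exists_elt x
  obtain ⟨a', b', c', rfl⟩ := F.exists_elt y
  have hP : ((P : ℤ) : ZMod p) = 0 := by
    rw [Int.cast_natCast]
    exact (ZMod.natCast_eq_zero_iff P p).mpr hpP
  rw [elt_mul]
  simp only [coord_elt]
  refine ⟨?_, ?_, ?_⟩ <;> simp <;> (push_cast at hP; simp [hP])

lemma coord_one : F.coord p 1 0 = 1 ∧ F.coord p 1 1 = 0 ∧ F.coord p 1 2 = 0 := by
  have : (1 : 𝓞 K) = F.elt 1 0 0 := by simp [elt]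
  rw [this]
  simp [coord_elt]

lemma coord_ne_zero_of_coprimeTo [Fact p.Prime] (hpP : p ∣ P) {x : 𝓞 K}
    (hx : CoprimeTo (p : 𝓞 K) (Ideal.span {x})) : F.coord p x 0 ≠ 0 := by
  intro h
  obtain ⟨u, v, huv⟩ := (Ideal.isCoprime_span_singleton_iff x (p : 𝓞 K)).mp hx.2
  have h1 := (F.coord_mul hpP u x).1
  rw [h, mul_zero, F.coord_congr (y := 1) ⟨-v, by linear_combination huv⟩, F.coord_one.1] at h1
  exact one_ne_zero h1

lemma coprimeTo_elt {m : ℕ} {a b c : ℤ}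
    (h : IsCoprime (a ^ 3 + P * b ^ 3 + P ^ 2 * c ^ 3 - 3 * P * a * b * c) (m : ℤ))
    (h0 : F.elt a b c ≠ 0) : CoprimeTo (m : 𝓞 K) (Ideal.span {F.elt a b c}) := by
  refine ⟨by simpa using h0, ?_⟩
  rw [Ideal.isCoprime_span_singleton_iff]
  obtain ⟨u, v, huv⟩ := h
  rw [← norm_elt F] at huv
  obtain ⟨d, hd⟩ := Ideal.mem_span_singleton.mp (intCast_norm_mem (F.elt a b c))
  refine ⟨u * d, v, ?_⟩
  have := congrArg (Int.cast : ℤ → 𝓞 K) huv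
  push_cast at this
  linear_combination this - (u : 𝓞 K) * hd

variable [Fact p.Prime]

/-- A linear combination of the coordinates of the `p`-adic logarithm modulo `(p, θ³)`. -/
noncomputable def lg (s t : ZMod p) (x : 𝓞 K) : ZMod p :=
  s * (F.coord p x 1 / F.coord p x 0) +
    t * (F.coord p x 2 / F.coord p x 0 - (F.coord p x 1 / F.coord p x 0) ^ 2 / 2)

variable (s t : ZMod p)

lemma lg_congr {x y : 𝓞 K} (h : (p : 𝓞 K) ∣ x - y) : F.lg s t x = F.lg s t y := by
  simp only [lg, F.coord_congr h]

lemma lg_mul (hp : p ≠ 2) (hpP : p ∣ P) {x y : 𝓞 K} (hx : F.coord p x 0 ≠ 0)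
    (hy : F.coord p y 0 ≠ 0) : F.lg s t (x * y) = F.lg s t x + F.lg s t y := by
  obtain ⟨h0, h1, h2⟩ := F.coord_mul hpP x y
  have := two_ne_zero_zmod hp
  rw [lg, lg, lg, h0, h1, h2]
  field_simp
  ring

lemma lg_one : F.lg s t 1 = 0 := by
  obtain ⟨h0, h1, h2⟩ := F.coord_one (p := p)
  simp [lg, h0, h1, h2]

lemma coord_unit_ne_zero (hpP : p ∣ P) (u : (𝓞 K)ˣ) : F.coord p u 0 ≠ 0 := by
  intro h
  have := (F.coord_mul hpP u ↑u⁻¹).1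
  rw [Units.mul_inv, F.coord_one.1, h, zero_mul] at this
  exact one_ne_zero this

lemma lg_pow (hp : p ≠ 2) (hpP : p ∣ P) {x : 𝓞 K} (hx : F.coord p x 0 ≠ 0) (n : ℕ) :
    F.coord p (x ^ n) 0 ≠ 0 ∧ F.lg s t (x ^ n) = n * F.lg s t x := by
  induction n with
  | zero => simp [F.coord_one.1, lg_one]
  | succ n ih =>
    rw [pow_succ, F.lg_mul s t hp hpP ih.1 hx, ih.2, (F.coord_mul hpP _ _).1]
    exact ⟨mul_ne_zero ih.1 hx, by push_cast; ring⟩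

/-- The restriction of `lg` to units. -/
noncomputable def lgUnits (hp : p ≠ 2) (hpP : p ∣ P) : (𝓞 K)ˣ →* Multiplicative (ZMod p) where
  toFun u := Multiplicative.ofAdd (F.lg s t u)
  map_one' := by rw [Units.val_one, lg_one, ofAdd_zero]
  map_mul' u v := by
    rw [Units.val_mul, F.lg_mul s t hp hpP (F.coord_unit_ne_zero hpP u) (F.coord_unit_ne_zero hpP v),
      ofAdd_add]

lemma lg_unit (hp : p ≠ 2) (hpP : p ∣ P) {e : (𝓞 K)ˣ} (he : IsFundamentalUnit P (F.A e))
    (h : F.lg s t e = 0) (u : (𝓞 K)ˣ) : F.lg s t u = 0 := by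
  have hpos : ∀ v : (𝓞 K)ˣ, 0 < F.A v → F.lg s t v = 0 := fun v hv ↦ by
    obtain ⟨k, rfl⟩ := F.exists_zpow he v hv
    have h1 := map_zpow (F.lgUnits s t hp hpP) e k
    have h2 : F.lgUnits s t hp hpP e = 1 := by
      change Multiplicative.ofAdd (F.lg s t e) = 1
      rw [h, ofAdd_zero]
    rw [h2, one_zpow] at h1
    exact Multiplicative.ofAdd.injective h1
  have h2 : F.lg s t ↑(u * u) = 0 := by
    refine hpos _ ?_
    rw [Units.val_mul, map_mul]
    exact mul_self_pos.mpr fun h0 ↦ u.ne_zero (F.A_injective (h0.trans (map_zero F.A).symm))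
  rw [Units.val_mul, F.lg_mul s t hp hpP (F.coord_unit_ne_zero hpP u) (F.coord_unit_ne_zero hpP u),
    ← two_mul] at h2
  exact (mul_eq_zero.mp h2).resolve_left (two_ne_zero_zmod hp)

end PureCubicField
end PureCubic

namespace PureCubic
open NumberField Module

section
variable {K : Type*} [Field K] [NumberField K] {p : ℕ} [Fact p.Prime]

lemma exists_addMonoidHom_apply_ne_zero_of_module {p : ℕ} [Fact p.Prime] {V : Type*}
    [AddCommGroup V] [Module (ZMod p) V] {v : V} (hv : v ≠ 0) : ∃ f : V →+ ZMod p, f v ≠ 0 := by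
  obtain ⟨f, hf⟩ := not_forall.mp
    (mt (Module.forall_dual_apply_eq_zero_iff (ZMod p) v).mp hv)
  exact ⟨f.toAddMonoidHom, hf⟩

lemma exists_addMonoidHom_apply_ne_zero {p : ℕ} [Fact p.Prime] {V : Type*} [AddCommGroup V]
    (hV : ∀ v : V, p • v = 0) {v : V} (hv : v ≠ 0) : ∃ f : V →+ ZMod p, f v ≠ 0 :=
  @exists_addMonoidHom_apply_ne_zero_of_module p _ V _ (AddCommGroup.zmodModule hV) v hv

lemma exists_classGroup_hom_ne_one (h : p ∣ Nat.card (ClassGroup (𝓞 K))) :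
    ∃ (ψ : ClassGroup (𝓞 K) →* Multiplicative (ZMod p)) (C : ClassGroup (𝓞 K)), ψ C ≠ 1 := by
  let G := ClassGroup (𝓞 K)
  obtain ⟨g, hg⟩ := exists_prime_orderOf_dvd_card' (G := G) p h
  have hinj : ¬ Function.Injective (powMonoidHom p : G →* G) := fun hi ↦ by
    have : g = 1 := hi (by simp [← hg, pow_orderOf_eq_one])
    rw [this, orderOf_one] at hg
    exact (Fact.out : p.Prime).one_lt.ne hg
  have hsurj : ¬ Function.Surjective (powMonoidHom p : G →* G) := fun hs ↦
    hinj (Finite.injective_iff_surjective.mpr hs)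
  obtain ⟨C, hC⟩ := not_forall.mp hsurj
  let N : Subgroup G := (powMonoidHom p : G →* G).range
  let V := Additive (G ⧸ N)
  have hV : ∀ v : V, p • v = 0 := fun v ↦ by
    change (Additive.toMul v) ^ p = 1
    induction Additive.toMul v using QuotientGroup.induction_on with
    | H z => exact (QuotientGroup.eq_one_iff (z ^ p)).mpr ⟨z, rfl⟩
  have hv : (Additive.ofMul (C : G ⧸ N) : V) ≠ 0 := fun h0 ↦
    hC ((QuotientGroup.eq_one_iff C).mp h0)
  obtain ⟨f, hf⟩ := exists_addMonoidHom_apply_ne_zero hV hv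
  refine ⟨(AddMonoidHom.toMultiplicativeRight f).comp (QuotientGroup.mk' N), C,
    fun h1 ↦ hf ?_⟩
  exact h1

lemma exists_idealLog_class (h : p ∣ Nat.card (ClassGroup (𝓞 K))) {m : 𝓞 K} (hm : m ≠ 0) :
    ∃ φ : IdealLog (p : 𝓞 K) p, (∀ x, x ≠ 0 → φ.toFun (Ideal.span {x}) = 0) ∧
      ∃ 𝔠, CoprimeTo m 𝔠 ∧ φ.toFun 𝔠 ≠ 0 := by
  classical
  obtain ⟨ψ, C, hC⟩ := exists_classGroup_hom_ne_one (K := K) h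
  let f : Ideal (𝓞 K) → ZMod p := fun I ↦
    if hI : I ∈ nonZeroDivisors (Ideal (𝓞 K)) then (ψ (ClassGroup.mk0 ⟨I, hI⟩)).toAdd else 0
  have hf : ∀ I (hI : I ∈ nonZeroDivisors (Ideal (𝓞 K))),
      f I = (ψ (ClassGroup.mk0 ⟨I, hI⟩)).toAdd := fun I hI ↦ dif_pos hI
  refine ⟨⟨f, fun I J hI hJ ↦ ?_⟩, fun x hx ↦ ?_, ?_⟩
  · have hI' := mem_nonZeroDivisors_of_ne_zero hI.1
    have hJ' := mem_nonZeroDivisors_of_ne_zero hJ.1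
    rw [hf I hI', hf J hJ', hf _ (mul_mem hI' hJ'), ← toAdd_mul, ← map_mul, ← map_mul]
    rfl
  · have hx' : Ideal.span {x} ∈ nonZeroDivisors (Ideal (𝓞 K)) :=
      mem_nonZeroDivisors_of_ne_zero (by simpa using hx)
    change f _ = 0
    rw [hf _ hx', (ClassGroup.mk0_eq_one_iff hx').mpr ⟨x, rfl⟩, map_one, toAdd_one]
  · obtain ⟨𝔟, h𝔟, hcop⟩ := exists_mk0_eq_of_isCoprime (𝔪 := Ideal.span {m}) (by simpa using hm) C
    refine ⟨𝔟, ⟨nonZeroDivisors.ne_zero 𝔟.2, hcop⟩, fun h0 ↦ hC ?_⟩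
    change f _ = 0 at h0
    rw [hf _ 𝔟.2] at h0
    rw [← h𝔟]
    exact h0

end

namespace PureCubicField
variable {K : Type*} [Field K] [NumberField K] {P : ℕ} (F : PureCubicField K P) {p : ℕ}
  [Fact p.Prime] (s t : ZMod p)

lemma lg_eq_of_span_eq (hp : p ≠ 2) (hpP : p ∣ P) {e : (𝓞 K)ˣ} (he : IsFundamentalUnit P (F.A e))
    (h : F.lg s t e = 0) {x y : 𝓞 K} (hx : F.coord p x 0 ≠ 0)
    (hxy : Ideal.span {x} = Ideal.span {y}) : F.lg s t x = F.lg s t y := by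
  obtain ⟨u, rfl⟩ := Ideal.span_singleton_eq_span_singleton.mp hxy
  rw [F.lg_mul s t hp hpP hx (F.coord_unit_ne_zero hpP u), F.lg_unit s t hp hpP he h, add_zero]

lemma exists_idealLog_lg (hh : ¬ p ∣ Nat.card (ClassGroup (𝓞 K))) (hp : p ≠ 2) (hpP : p ∣ P)
    {e : (𝓞 K)ˣ} (he : IsFundamentalUnit P (F.A e)) (h : F.lg s t e = 0) :
    ∃ φ : IdealLog (p : 𝓞 K) p, ∀ x, CoprimeTo (p : 𝓞 K) (Ideal.span {x}) →
      φ.toFun (Ideal.span {x}) = F.lg s t x := by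
  set H := Nat.card (ClassGroup (𝓞 K)) with hH
  have hH0 : (H : ZMod p) ≠ 0 := fun h0 ↦ hh ((ZMod.natCast_eq_zero_iff _ _).mp h0)
  have hgen : ∀ I : Ideal (𝓞 K), ∃ g : 𝓞 K, I ≠ 0 → I ^ H = Ideal.span {g} := fun I ↦ by
    by_cases hI : I = 0
    · exact ⟨0, fun h ↦ absurd hI h⟩
    have hI' := mem_nonZeroDivisors_of_ne_zero hI
    have h1 : ClassGroup.mk0 ⟨I ^ H, pow_mem hI' H⟩ = 1 := by
      rw [← pow_card_eq_one' (x := ClassGroup.mk0 ⟨I, hI'⟩), ← map_pow]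
      rfl
    obtain ⟨g, hg⟩ := (ClassGroup.mk0_eq_one_iff _).mp h1
    exact ⟨g, fun _ ↦ hg⟩
  choose g hg using hgen
  have hco : ∀ I, CoprimeTo (p : 𝓞 K) I → F.coord p (g I) 0 ≠ 0 := fun I hI ↦ by
    refine F.coord_ne_zero_of_coprimeTo hpP ?_
    rw [← hg I hI.1]
    exact ⟨pow_ne_zero _ hI.1, hI.2.pow_left⟩
  refine ⟨⟨fun I ↦ (H : ZMod p)⁻¹ * F.lg s t (g I), fun I J hI hJ ↦ ?_⟩, fun x hx ↦ ?_⟩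
  · have hIJ := coprimeTo_mul_iff.mpr ⟨hI, hJ⟩
    rw [← mul_add, ← F.lg_mul s t hp hpP (hco I hI) (hco J hJ)]
    congr 1
    refine F.lg_eq_of_span_eq s t hp hpP he h (hco _ hIJ) ?_
    rw [← hg _ hIJ.1, mul_pow, hg I hI.1, hg J hJ.1, Ideal.span_singleton_mul_span_singleton]
  · obtain ⟨h1, h2⟩ := F.lg_pow s t hp hpP (F.coord_ne_zero_of_coprimeTo hpP hx) H
    have h3 := F.lg_eq_of_span_eq s t hp hpP he h (hco _ hx) (y := x ^ H) (by
      rw [← hg _ hx.1, Ideal.span_singleton_pow])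
    change (H : ZMod p)⁻¹ * F.lg s t (g _) = _
    rw [h3, h2, inv_mul_cancel_left₀ hH0]

end PureCubicField
end PureCubic

namespace PureCubic
open NumberField Module

lemma CoprimeTo.of_dvd {K : Type*} [Field K] [NumberField K] {m m' : 𝓞 K} {I : Ideal (𝓞 K)}
    (hI : CoprimeTo m' I) (h : m ∣ m') : CoprimeTo m I := by
  refine ⟨hI.1, hI.2.of_isCoprime_of_dvd_right ?_⟩
  rw [Ideal.dvd_span_singleton, Ideal.mem_span_singleton]
  exact h

lemma exists_forall_sq_ne {p : ℕ} [Fact p.Prime] (hp : p ≠ 2) (k : ZMod p) :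
    ∃ c : ZMod p, ∀ u : ZMod p, u ^ 2 / 2 + k * u ≠ c := by
  have h2 := two_ne_zero_zmod hp
  have hinj : ¬ Function.Injective fun u : ZMod p ↦ u ^ 2 / 2 + k * u := fun h ↦ by
    have : -k + 1 = -k - 1 := h (by
      change (-k + 1) ^ 2 / 2 + k * (-k + 1) = (-k - 1) ^ 2 / 2 + k * (-k - 1)
      field_simp
      ring)
    exact h2 (by linear_combination this)
  obtain ⟨c, hc⟩ := not_forall.mp (mt Finite.injective_iff_surjective.mpr hinj)
  exact ⟨c, not_exists.mp hc⟩

namespace PureCubicField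
variable {K : Type*} [Field K] [NumberField K] {P : ℕ} (F : PureCubicField K P) {p : ℕ}
  [Fact p.Prime]

lemma coprimeTo_add_theta_pow (hpP : p ∣ P) {ι : ℕ} (hι : ι = 1 ∨ ι = 2) {x : ℤ}
    (hx : ¬ (p : ℤ) ∣ x) (y : ℤ) :
    CoprimeTo (p : 𝓞 K) (Ideal.span {(x : 𝓞 K) + F.θ ^ ι * y}) := by
  have hpp : Prime (p : ℤ) := Nat.prime_iff_prime_int.mp Fact.out
  obtain ⟨d, hd⟩ := hpP
  have hP : (P : ℤ) = p * d := by exact_mod_cast hd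
  have hco : IsCoprime (x ^ 3) (p : ℤ) := ((hpp.coprime_iff_not_dvd.mpr hx).symm).pow_left
  rcases hι with rfl | rfl
  · have e : (x : 𝓞 K) + F.θ ^ 1 * y = F.elt x y 0 := by simp [elt]; ring
    rw [e]
    refine F.coprimeTo_elt ?_ fun h ↦ hx ?_
    · rw [show x ^ 3 + (P : ℤ) * y ^ 3 + P ^ 2 * 0 ^ 3 - 3 * P * x * y * 0 =
        x ^ 3 + p * (d * y ^ 3) by rw [hP]; ring]
      exact IsCoprime.add_mul_left_left_iff.mpr hco
    · rw [show (0 : 𝓞 K) = F.elt 0 0 0 by simp [elt], F.elt_inj] at h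
      simp [h.1]
  · have e : (x : 𝓞 K) + F.θ ^ 2 * y = F.elt x 0 y := by simp [elt]; ring
    rw [e]
    refine F.coprimeTo_elt ?_ fun h ↦ hx ?_
    · rw [show x ^ 3 + (P : ℤ) * 0 ^ 3 + P ^ 2 * y ^ 3 - 3 * P * x * 0 * y =
        x ^ 3 + p * (p * d ^ 2 * y ^ 3) by rw [hP]; ring]
      exact IsCoprime.add_mul_left_left_iff.mpr hco
    · rw [show (0 : 𝓞 K) = F.elt 0 0 0 by simp [elt], F.elt_inj] at h
      simp [h.1]

lemma exists_int_coprime (p : ℕ) [Fact p.Prime] {P : ℕ} (hpP : p ∣ P) :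
    ∃ d : ℤ, (d : ZMod p) ≠ 0 ∧ ∃ j : ℤ, P * d = 3 * j ∧ ∃ i : ℤ, (P : ℤ) = p * i := by
  obtain ⟨i, hi⟩ := hpP
  have hP : (P : ℤ) = p * i := by exact_mod_cast hi
  by_cases h3 : p = 3
  · exact ⟨1, by simp, i, by rw [hP, h3]; push_cast; ring, i, hP⟩
  · refine ⟨3, fun h ↦ h3 ?_, P, by ring, i, hP⟩
    have := (ZMod.natCast_eq_zero_iff 3 p).mp (by exact_mod_cast h)
    exact (Nat.prime_dvd_prime_iff_eq Fact.out Nat.prime_three).mp this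

lemma exists_idealLog (hp : p ≠ 2) (hpP : p ∣ P) {e : (𝓞 K)ˣ} (he : IsFundamentalUnit P (F.A e))
    {α β γ : ℤ} (heq : (e : 𝓞 K) = F.elt α β γ) {ι : ℕ}
    (hι : (ι = 1 ∧ (¬ (p : ℤ) ∣ β ∨ ((p : ℤ) ∣ β ∧ (p : ℤ) ∣ γ))) ∨
      (ι = 2 ∧ (p : ℤ) ∣ β ∧ ¬ (p : ℤ) ∣ γ)) :
    ∃ (φ : IdealLog (p : 𝓞 K) p) (c : ZMod p),
      (∀ x y, (p : 𝓞 K) ∣ x - y → CoprimeTo (p : 𝓞 K) (Ideal.span {x}) →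
        CoprimeTo (p : 𝓞 K) (Ideal.span {y}) →
        φ.toFun (Ideal.span {x}) = φ.toFun (Ideal.span {y})) ∧
      (∃ 𝔠, CoprimeTo ((3 * p : ℕ) : 𝓞 K) 𝔠 ∧ φ.toFun 𝔠 ≠ 0) ∧
      ∀ x y : ℤ, ¬ (p : ℤ) ∣ x → φ.toFun (Ideal.span {(x : 𝓞 K) + F.θ ^ ι * y}) ≠ -c := by
  have hp0 : p ≠ 0 := (Fact.out : p.Prime).ne_zero
  have hι' : ι = 1 ∨ ι = 2 := hι.imp And.left And.left
  by_cases hh : p ∣ Nat.card (ClassGroup (𝓞 K))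
  · obtain ⟨φ, h0, h1⟩ := exists_idealLog_class hh (m := ((3 * p : ℕ) : 𝓞 K))
      (by exact_mod_cast mul_ne_zero three_ne_zero hp0)
    have h0' : ∀ x, CoprimeTo (p : 𝓞 K) (Ideal.span {x}) → φ.toFun (Ideal.span {x}) = 0 :=
      fun x hx ↦ h0 x (by simpa using hx.1)
    refine ⟨φ, 1, fun x y _ hx hy ↦ by rw [h0' x hx, h0' y hy], h1, fun x y hx ↦ ?_⟩
    rw [h0' _ (F.coprimeTo_add_theta_pow hpP hι' hx y)]
    simp
  obtain ⟨d, hd, j, hj, i, hi⟩ := exists_int_coprime p hpP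
  have hcop : ∀ M : ℤ, IsCoprime (1 + P * d * M) ((3 * p : ℕ) : ℤ) := fun M ↦ by
    push_cast
    exact IsCoprime.mul_right ⟨1, -(j * M), by rw [hj]; ring⟩
      ⟨1, -(i * d * M), by rw [hi]; ring⟩
  have hne : ∀ a b : ℤ, F.elt 1 a b ≠ 0 := fun a b h ↦ by
    rw [show (0 : 𝓞 K) = F.elt 0 0 0 by simp [elt], F.elt_inj] at h
    exact one_ne_zero h.1
  suffices ∃ (s t c : ZMod p), F.lg s t e = 0 ∧
      (∃ x, CoprimeTo ((3 * p : ℕ) : 𝓞 K) (Ideal.span {x}) ∧ F.lg s t x ≠ 0) ∧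
      ∀ x y : ℤ, ¬ (p : ℤ) ∣ x → F.lg s t ((x : 𝓞 K) + F.θ ^ ι * y) ≠ -c by
    obtain ⟨s, t, c, hs, ⟨x₀, hx₀, hx₀'⟩, hc⟩ := this
    obtain ⟨φ, hφ⟩ := F.exists_idealLog_lg s t hh hp hpP he hs
    refine ⟨φ, c, fun x y h hx hy ↦ ?_, ⟨Ideal.span {x₀}, hx₀, ?_⟩, fun x y hx ↦ ?_⟩
    · rw [hφ x hx, hφ y hy, F.lg_congr s t h]
    · rw [hφ]
      · exact hx₀'
      · exact hx₀.of_dvd (by rw [Nat.cast_mul]; exact dvd_mul_left _ _)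
    · rw [hφ _ (F.coprimeTo_add_theta_pow hpP hι' hx y)]
      exact hc x y hx
  rcases hι with ⟨rfl, hβ⟩ | ⟨rfl, hβ, hγ⟩
  · set U := F.coord p e 1 / F.coord p e 0 with hU
    set V := F.coord p e 2 / F.coord p e 0 with hV
    set k := (V - U ^ 2 / 2) / U with hk
    obtain ⟨c, hc⟩ := exists_forall_sq_ne hp k
    refine ⟨-k, 1, c, ?_, ⟨F.elt 1 0 d, ?_, ?_⟩, fun x y hx ↦ ?_⟩
    · rw [lg, ← hU, ← hV, hk]
      by_cases hU0 : U = 0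
      · have h1 : F.coord p e 1 = 0 :=
          (div_eq_zero_iff.mp hU0).resolve_right (F.coord_unit_ne_zero hpP e)
        rw [heq, coord_elt] at h1
        have hβ' : (p : ℤ) ∣ β := (ZMod.intCast_zmod_eq_zero_iff_dvd β p).mp h1
        have h2 : V = 0 := by
          rw [hV, heq, coord_elt]
          have := (ZMod.intCast_zmod_eq_zero_iff_dvd γ p).mpr
            (hβ.resolve_left (not_not_intro hβ')).2
          simp [this]
        rw [hU0, h2]
        simp
      · field_simp
        ring
    · refine F.coprimeTo_elt ?_ (hne _ _)
      convert hcop (P * d ^ 2) using 1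
      ring
    · rw [lg]
      simpa [coord_elt] using hd
    · rw [show (x : 𝓞 K) + F.θ ^ 1 * y = F.elt x y 0 by simp [elt]; ring]
      clear_value k
      intro h
      refine hc (y / x) ?_
      rw [lg] at h
      simp [coord_elt] at h
      linear_combination -h
  · refine ⟨1, 0, 1, ?_, ⟨F.elt 1 d 0, ?_, ?_⟩, fun x y hx ↦ ?_⟩
    · rw [lg, heq]
      simp [coord_elt, (ZMod.intCast_zmod_eq_zero_iff_dvd β p).mpr hβ]
    · refine F.coprimeTo_elt ?_ (hne _ _)
      convert hcop (d ^ 2) using 1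
      ring
    · rw [lg]
      simpa [coord_elt] using hd
    · rw [show (x : 𝓞 K) + F.θ ^ 2 * y = F.elt x 0 y by simp [elt]; ring]
      simp [lg, coord_elt]

end PureCubicField
end PureCubic

namespace PureCubic
open NumberField Module

namespace PureCubicField
variable {K : Type*} [Field K] [NumberField K] {P : ℕ} (F : PureCubicField K P)

include F in
lemma absNorm_span_natCast (l : ℕ) : Ideal.absNorm (Ideal.span {(l : 𝓞 K)}) = l ^ 3 := by
  have := F.absNorm_span_elt l 0 0
  rw [← intCast_eq_elt, Int.cast_natCast] at this
  have h0 : (0 : ℤ) ≤ l ^ 3 := by positivity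
  have h : (Ideal.absNorm (Ideal.span {(l : 𝓞 K)}) : ℤ) = (l : ℤ) ^ 3 := by
    rw [this]
    refine Eq.trans ?_ (abs_of_nonneg h0)
    congr 1
  exact_mod_cast h

lemma norm_nonneg_of_pos {a b c : ℤ} (h : 0 < F.A (F.elt a b c)) :
    0 ≤ a ^ 3 + P * b ^ 3 + P ^ 2 * c ^ 3 - 3 * P * a * b * c := by
  rw [A_elt] at h
  have hc := cbrt_pow_three P
  have key : ((a ^ 3 + P * b ^ 3 + P ^ 2 * c ^ 3 - 3 * P * a * b * c : ℤ) : ℝ) =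
      (a + b * cbrt P + c * cbrt P ^ 2) * ((a - b * cbrt P / 2 - c * cbrt P ^ 2 / 2) ^ 2 +
        3 / 4 * (b * cbrt P - c * cbrt P ^ 2) ^ 2) := by
    push_cast
    rw [← hc]
    ring
  exact_mod_cast key ▸ (by positivity : (0 : ℝ) ≤ (a + b * cbrt P + c * cbrt P ^ 2) *
    ((a - b * cbrt P / 2 - c * cbrt P ^ 2 / 2) ^ 2 + 3 / 4 * (b * cbrt P - c * cbrt P ^ 2) ^ 2))

include F in
lemma intCast_norm_eq {n : ℕ} {x y : 𝓞 K} (h : (n : 𝓞 K) ∣ x - y) :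
    ((Algebra.norm ℤ x : ℤ) : ZMod n) = (Algebra.norm ℤ y : ℤ) := by
  have h0 := F.coord_congr h 0
  have h1 := F.coord_congr h 1
  have h2 := F.coord_congr h 2
  obtain ⟨a, b, c, rfl⟩ := F.exists_elt x
  obtain ⟨a', b', c', rfl⟩ := F.exists_elt y
  rw [coord_elt, coord_elt] at h0 h1 h2
  simp only [Matrix.cons_val] at h0 h1 h2
  rw [norm_elt, norm_elt]
  push_cast
  rw [h0, h1, h2]

lemma absNorm_modEq {n : ℕ} {x y : 𝓞 K} (h : (n : 𝓞 K) ∣ x - y) (hx : 0 < F.A x)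
    (hy : 0 < F.A y) :
    Ideal.absNorm (Ideal.span {x}) ≡ Ideal.absNorm (Ideal.span {y}) [MOD n] := by
  have hpos : ∀ z, 0 < F.A z → 0 ≤ Algebra.norm ℤ z := fun z hz ↦ by
    obtain ⟨a, b, c, rfl⟩ := F.exists_elt z
    rw [norm_elt]
    exact F.norm_nonneg_of_pos hz
  rw [← ZMod.natCast_eq_natCast_iff, Ideal.absNorm_span_singleton, Ideal.absNorm_span_singleton,
    ← Int.cast_natCast, ← Int.cast_natCast (Algebra.norm ℤ y).natAbs,
    Int.natAbs_of_nonneg (hpos x hx), Int.natAbs_of_nonneg (hpos y hy), F.intCast_norm_eq h]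

lemma exists_idealLog_infinite {p : ℕ} [Fact p.Prime] (hp : p ≠ 2) (hP0 : P ≠ 0) (hpP : p ∣ P)
    {e : (𝓞 K)ˣ} (he : IsFundamentalUnit P (F.A e))
    {α β γ : ℤ} (heq : (e : 𝓞 K) = F.elt α β γ) {ι : ℕ}
    (hι : (ι = 1 ∧ (¬ (p : ℤ) ∣ β ∨ ((p : ℤ) ∣ β ∧ (p : ℤ) ∣ γ))) ∨
      (ι = 2 ∧ (p : ℤ) ∣ β ∧ ¬ (p : ℤ) ∣ γ)) :
    ∃ (φ : IdealLog (p : 𝓞 K) p) (c : ZMod p),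
      {l : ℕ | l.Prime ∧ l % 3 = 2 ∧
        ∃ 𝔩, Ideal.absNorm 𝔩 = l ∧ φ.toFun 𝔩 = c}.Infinite ∧
      ∀ x y : ℤ, ¬ (p : ℤ) ∣ x → φ.toFun (Ideal.span {(x : 𝓞 K) + F.θ ^ ι * y}) ≠ -c := by
  obtain ⟨φ, c, h1, h2, h3⟩ := F.exists_idealLog hp hpP he heq hι
  have hd : (p : 𝓞 K) ∣ ((3 * p : ℕ) : 𝓞 K) := by
    rw [Nat.cast_mul]
    exact dvd_mul_left _ _
  have hd3 : ((3 : ℕ) : 𝓞 K) ∣ ((3 * p : ℕ) : 𝓞 K) := by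
    rw [Nat.cast_mul]
    exact dvd_mul_right _ _
  have hp0 : p ≠ 0 := (Fact.out : p.Prime).ne_zero
  let φ' : IdealLog ((3 * p : ℕ) : 𝓞 K) p :=
    ⟨φ.toFun, fun I J hI hJ ↦ φ.apply_mul I J (hI.of_dvd hd) (hJ.of_dvd hd)⟩
  let D := F.cubicData (Nat.one_le_iff_ne_zero.mpr hP0) he
  have hne : ∀ x : 𝓞 K, 0 < F.A x → x ≠ 0 := by
    rintro _ hx rfl
    simp at hx
  have hadm : φ'.Admissible D :=
    { ne_zero := by exact_mod_cast mul_ne_zero three_ne_zero hp0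
      three_dvd := by exact_mod_cast hd3
      congr := fun x y h hx hy hcop ↦ h1 x y (hd.trans h) (hcop.of_dvd hd)
        (((coprimeTo_span_congr h (hne x hx) (hne y hy)).mp hcop).of_dvd hd)
      norm_congr := fun x y h hx hy ↦ F.absNorm_modEq (hd3.trans h) hx hy
      exists_ne_zero := h2
      exists_norm := by
        refine ⟨Ideal.span {((2 : ℕ) : 𝓞 K)}, ⟨by simp, ?_⟩, by
          rw [F.absNorm_span_natCast]
          norm_num⟩
        rw [Ideal.isCoprime_span_singleton_iff]
        exact (Nat.Coprime.mul_right (by norm_num)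
          ((Nat.coprime_primes Nat.prime_two Fact.out).mpr hp.symm)).cast }
  exact ⟨φ, c, hadm.infinite hp c F.absNorm_span_natCast, h3⟩

end PureCubicField
end PureCubic

namespace PureCubic
open NumberField Module

lemma intCast_mem_iff {K : Type*} [Field K] {q : ℕ} (hq : q.Prime) {𝔮 : Ideal (𝓞 K)} (h1 : 𝔮 ≠ ⊤) (hq𝔮 : (q : 𝓞 K) ∈ 𝔮)
    (a : ℤ) : (a : 𝓞 K) ∈ 𝔮 ↔ (q : ℤ) ∣ a := by
  constructor
  · intro h
    by_contra hqa
    obtain ⟨u, v, huv⟩ := ((Nat.prime_iff_prime_int.mp hq).coprime_iff_not_dvd).mpr hqa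
    refine h1 ((Ideal.eq_top_iff_one _).mpr ?_)
    have := congrArg (Int.cast : ℤ → 𝓞 K) huv
    push_cast at this
    rw [← this]
    exact add_mem (𝔮.mul_mem_left _ hq𝔮) (𝔮.mul_mem_left _ h)
  · rintro ⟨d, rfl⟩
    rw [Int.cast_mul, Int.cast_natCast]
    exact 𝔮.mul_mem_right _ hq𝔮

namespace PureCubicField
variable {K : Type*} [Field K] [NumberField K] {P : ℕ} (F : PureCubicField K P)

lemma elt_sub_mem {𝔮 : Ideal (𝓞 K)} {ρ : ℤ} (hρ : F.θ - ρ ∈ 𝔮) (a b c : ℤ) :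
    F.elt a b c - ((a + b * ρ + c * ρ ^ 2 : ℤ) : 𝓞 K) ∈ 𝔮 := by
  have : F.elt a b c - ((a + b * ρ + c * ρ ^ 2 : ℤ) : 𝓞 K) =
      (b + c * (F.θ + ρ)) * (F.θ - ρ) := by
    simp only [elt]
    push_cast
    ring
  rw [this]
  exact 𝔮.mul_mem_left _ hρ

lemma elt_mem_iff {q : ℕ} (hq : q.Prime) {𝔮 : Ideal (𝓞 K)} (h1 : 𝔮 ≠ ⊤) (hq𝔮 : (q : 𝓞 K) ∈ 𝔮)
    {ρ : ℤ} (hρ : F.θ - ρ ∈ 𝔮) (a b c : ℤ) :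
    F.elt a b c ∈ 𝔮 ↔ (q : ℤ) ∣ a + b * ρ + c * ρ ^ 2 := by
  rw [← intCast_mem_iff hq h1 hq𝔮, ← sub_add_cancel (F.elt a b c) ((a + b * ρ + c * ρ ^ 2 : ℤ) : 𝓞 K)]
  exact Ideal.add_mem_iff_right _ (F.elt_sub_mem hρ a b c)

lemma ideal_eq {q : ℕ} (hq : q.Prime) {𝔮 𝔮' : Ideal (𝓞 K)} (h1 : 𝔮 ≠ ⊤) (hq𝔮 : (q : 𝓞 K) ∈ 𝔮)
    (h1' : 𝔮' ≠ ⊤) (hq𝔮' : (q : 𝓞 K) ∈ 𝔮') {ρ : ℤ} (hρ : F.θ - ρ ∈ 𝔮) (hρ' : F.θ - ρ ∈ 𝔮') :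
    𝔮 = 𝔮' := by
  ext x
  obtain ⟨a, b, c, rfl⟩ := F.exists_elt x
  rw [F.elt_mem_iff hq h1 hq𝔮 hρ, F.elt_mem_iff hq h1' hq𝔮' hρ']

lemma absNorm_eq {q : ℕ} (hq : q.Prime) {𝔮 : Ideal (𝓞 K)} (h1 : 𝔮 ≠ ⊤) (hq𝔮 : (q : 𝓞 K) ∈ 𝔮)
    {ρ : ℤ} (hρ : F.θ - ρ ∈ 𝔮) : Ideal.absNorm 𝔮 = q := by
  let f : ℤ →+* 𝓞 K ⧸ 𝔮 := Int.castRingHom _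
  have hf : ∀ a : ℤ, f a = Ideal.Quotient.mk 𝔮 a := fun a ↦ by simp [f]
  have hsurj : Function.Surjective f := fun z ↦ by
    obtain ⟨x, rfl⟩ := Ideal.Quotient.mk_surjective z
    obtain ⟨a, b, c, rfl⟩ := F.exists_elt x
    refine ⟨a + b * ρ + c * ρ ^ 2, ?_⟩
    rw [hf, eq_comm, Ideal.Quotient.eq]
    exact F.elt_sub_mem hρ a b c
  have hker : RingHom.ker f = Ideal.span {(q : ℤ)} := by
    ext a
    rw [RingHom.mem_ker, hf, Ideal.Quotient.eq_zero_iff_mem, intCast_mem_iff hq h1 hq𝔮,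
      Ideal.mem_span_singleton]
  have e := (Ideal.quotEquivOfEq hker).symm.trans (RingHom.quotientKerEquivOfSurjective hsurj)
  rw [Ideal.absNorm_apply, Submodule.cardQuot_apply]
  change Nat.card (𝓞 K ⧸ 𝔮) = q
  rw [← Nat.card_congr e.toEquiv, Nat.card_congr (Int.quotientSpanNatEquivZMod q).toEquiv, Nat.card_zmod]

lemma exists_theta_sub_mem {l : ℕ} (hl : l.Prime) {𝔩 : Ideal (𝓞 K)} (h : Ideal.absNorm 𝔩 = l) :
    ∃ ρ : ℤ, F.θ - ρ ∈ 𝔩 := by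
  have : Fact l.Prime := ⟨hl⟩
  have hcard : Nat.card (𝓞 K ⧸ 𝔩) = l := by
    rw [← h, Ideal.absNorm_apply, Submodule.cardQuot_apply]
  have h1 : (1 : 𝓞 K ⧸ 𝔩) ≠ 0 := by
    intro h0
    have := subsingleton_of_zero_eq_one h0.symm
    have := Nat.card_of_subsingleton (0 : 𝓞 K ⧸ 𝔩)
    exact hl.one_lt.ne' (hcard.symm.trans this)
  obtain ⟨ρ, hρ⟩ := AddSubgroup.mem_zmultiples_iff.mp
    (mem_zmultiples_of_prime_card (g' := Ideal.Quotient.mk 𝔩 F.θ) hcard h1)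
  refine ⟨ρ, Ideal.Quotient.eq.mp ?_⟩
  rw [← hρ]
  simp

lemma pow_three_sub_mem {𝔮 : Ideal (𝓞 K)} {ρ : ℤ} (hρ : F.θ - ρ ∈ 𝔮) :
    ((ρ ^ 3 - P : ℤ) : 𝓞 K) ∈ 𝔮 := by
  have : ((ρ ^ 3 - P : ℤ) : 𝓞 K) = -(F.θ ^ 2 + F.θ * ρ + ρ ^ 2) * (F.θ - ρ) := by
    push_cast
    rw [← F.cube]
    ring
  rw [this]
  exact 𝔮.mul_mem_left _ hρ

end PureCubicField

lemma dvd_sub_of_dvd_pow_three_sub {l : ℕ} (hl : l.Prime) (hl3 : l % 3 = 2) {a b : ℤ}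
    (h : (l : ℤ) ∣ a ^ 3 - b ^ 3) : (l : ℤ) ∣ a - b := by
  have : Fact l.Prime := ⟨hl⟩
  rw [← ZMod.intCast_zmod_eq_zero_iff_dvd] at h ⊢
  push_cast at h ⊢
  rw [sub_eq_zero] at h ⊢
  obtain ⟨k, hk⟩ : ∃ k, l = 3 * k + 2 := ⟨l / 3, by omega⟩
  have key : ∀ z : ZMod l, (z ^ 3) ^ (2 * k + 1) = z := fun z ↦ by
    have h1 : (z ^ 3) ^ (2 * k + 1) = z ^ l * z ^ (l - 1) := by
      rw [← pow_mul, ← pow_add]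
      congr 1
      omega
    have h2 : z ^ l * z ^ (l - 1) = z ^ l := by
      rw [ZMod.pow_card, ← pow_succ', Nat.sub_add_cancel hl.one_lt.le, ZMod.pow_card]
    rw [h1, h2, ZMod.pow_card]
  rw [← key a, ← key b, h]

end PureCubic

namespace PureCubic
open NumberField Module

/-- The completely additive function on positive integers with values `g q` at the primes `q`. -/
noncomputable def additiveSum {R : Type*} [Semiring R] (g : ℕ → R) (N : ℕ) : R :=
  N.factorization.sum fun q k ↦ (k : R) * g q

section
variable {R : Type*} [Semiring R] (g : ℕ → R)

lemma additiveSum_one : additiveSum g 1 = 0 := by simp [additiveSum]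

lemma additiveSum_mul {a b : ℕ} (ha : a ≠ 0) (hb : b ≠ 0) :
    additiveSum g (a * b) = additiveSum g a + additiveSum g b := by
  rw [additiveSum, Nat.factorization_mul ha hb]
  exact Finsupp.sum_add_index' (by simp) (by simp [add_mul])

lemma additiveSum_prime {q : ℕ} (hq : q.Prime) : additiveSum g q = g q := by
  rw [additiveSum, hq.factorization, Finsupp.sum_single_index] <;> simp

lemma additiveSum_pow {a : ℕ} (ha : a ≠ 0) (k : ℕ) :
    additiveSum g (a ^ k) = k * additiveSum g a := by
  induction k with
  | zero => simp [additiveSum_one]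
  | succ k ih =>
    rw [pow_succ, additiveSum_mul g (pow_ne_zero _ ha) ha, ih, Nat.cast_succ, add_mul, one_mul]

end

namespace PureCubicField
variable {K : Type*} [Field K] [NumberField K] {P : ℕ} (F : PureCubicField K P)

lemma norm_add_theta_pow {ι : ℕ} (hι : ι = 1 ∨ ι = 2) (x y : ℤ) :
    Algebra.norm ℤ ((x : 𝓞 K) + F.θ ^ ι * y) = x ^ 3 + P ^ ι * y ^ 3 := by
  rcases hι with rfl | rfl
  · rw [show (x : 𝓞 K) + F.θ ^ 1 * y = F.elt x y 0 by simp [elt]; ring, norm_elt]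
    ring
  · rw [show (x : 𝓞 K) + F.θ ^ 2 * y = F.elt x 0 y by simp [elt]; ring, norm_elt]
    ring

lemma exists_theta_sub_mem_of_mem {ι : ℕ} (hι : ι = 1 ∨ ι = 2) {x y : ℤ} {q : ℕ} (hq : q.Prime)
    (hx : ¬ (q : ℤ) ∣ x) (hy : ¬ (q : ℤ) ∣ y) :
    ∃ ρ : ℤ, ∀ 𝔮 : Ideal (𝓞 K), (q : 𝓞 K) ∈ 𝔮 → (x : 𝓞 K) + F.θ ^ ι * y ∈ 𝔮 → F.θ - ρ ∈ 𝔮 := by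
  have hinv : ∀ a : ℤ, ¬ (q : ℤ) ∣ a → ∃ u v : ℤ, (u : 𝓞 K) * q + v * a = 1 := fun a ha ↦ by
    obtain ⟨u, v, huv⟩ := ((Nat.prime_iff_prime_int.mp hq).coprime_iff_not_dvd).mpr ha
    have := congrArg (Int.cast : ℤ → 𝓞 K) huv
    push_cast at this
    exact ⟨u, v, this⟩
  have hc := F.cube
  rcases hι with rfl | rfl
  · obtain ⟨u, v, h⟩ := hinv y hy
    refine ⟨-(v * x), fun 𝔮 h1 h2 ↦ ?_⟩
    have : F.θ - ((-(v * x) : ℤ) : 𝓞 K) = F.θ * u * q + v * (x + F.θ ^ 1 * y) := by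
      push_cast
      linear_combination -F.θ * h
    rw [this]
    exact add_mem (𝔮.mul_mem_left _ h1) (𝔮.mul_mem_left _ h2)
  · obtain ⟨u, v, h⟩ := hinv x hx
    refine ⟨-(P * v * y), fun 𝔮 h1 h2 ↦ ?_⟩
    have : F.θ - ((-(P * v * y) : ℤ) : 𝓞 K) = F.θ * u * q + F.θ * v * (x + F.θ ^ 2 * y) := by
      push_cast
      linear_combination -F.θ * h - v * y * hc
    rw [this]
    exact add_mem (𝔮.mul_mem_left _ h1) (𝔮.mul_mem_left _ h2)

variable {p : ℕ} {φ : IdealLog (p : 𝓞 K) p} {ι : ℕ}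

lemma toFun_eq_additiveSum (hι : ι = 1 ∨ ι = 2) {x y : ℤ}
    (hcop : CoprimeTo (p : 𝓞 K) (Ideal.span {(x : 𝓞 K) + F.θ ^ ι * y}))
    (hN : ∀ q : ℕ, q.Prime → (q : ℤ) ∣ x ^ 3 + P ^ ι * y ^ 3 → ¬ (q : ℤ) ∣ x ∧ ¬ (q : ℤ) ∣ y)
    (I : Ideal (𝓞 K)) (hI : I ∣ Ideal.span {(x : 𝓞 K) + F.θ ^ ι * y}) :
    φ.toFun I = additiveSum
      (fun q ↦ φ.toFun (Ideal.span {(q : 𝓞 K), (x : 𝓞 K) + F.θ ^ ι * y})) (Ideal.absNorm I) := by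
  have hdvd : ∀ J, J ∣ Ideal.span {(x : 𝓞 K) + F.θ ^ ι * y} → CoprimeTo (p : 𝓞 K) J := by
    rintro J ⟨J', hJ'⟩
    exact (coprimeTo_mul_iff.mp (hJ' ▸ hcop)).1
  induction I using UniqueFactorizationMonoid.induction_on_prime with
  | h₁ => exact absurd rfl (hdvd _ hI).1
  | h₂ I hu =>
    rw [Ideal.isUnit_iff.mp hu, ← Ideal.one_eq_top, map_one, additiveSum_one, φ.apply_one]
  | h₃ I 𝔮 hI0 h𝔮 ih =>
    have h2 := dvd_of_mul_left_dvd hI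
    have h1 := dvd_of_mul_right_dvd hI
    obtain ⟨q, hq, hq𝔮⟩ := exists_prime_natCast_mem h𝔮
    have hmem : (x : 𝓞 K) + F.θ ^ ι * y ∈ 𝔮 :=
      (Ideal.dvd_iff_le.mp h1) (Ideal.mem_span_singleton_self _)
    have htop : 𝔮 ≠ ⊤ := fun h ↦ h𝔮.not_isUnit (Ideal.isUnit_iff.mpr h)
    have hqN : (q : ℤ) ∣ x ^ 3 + P ^ ι * y ^ 3 := by
      rw [← intCast_mem_iff hq htop hq𝔮, ← F.norm_add_theta_pow hι]
      exact (Ideal.dvd_iff_le.mp h1) (intCast_norm_mem _)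
    obtain ⟨hqx, hqy⟩ := hN q hq hqN
    obtain ⟨ρ, hρ⟩ := F.exists_theta_sub_mem_of_mem hι hq hqx hqy
    have hle : Ideal.span {(q : 𝓞 K), (x : 𝓞 K) + F.θ ^ ι * y} ≤ 𝔮 := by
      rw [Ideal.span_le]
      rintro _ (rfl | rfl)
      exacts [hq𝔮, hmem]
    have heq : 𝔮 = Ideal.span {(q : 𝓞 K), (x : 𝓞 K) + F.θ ^ ι * y} :=
      F.ideal_eq hq htop hq𝔮 (fun h ↦ htop (top_le_iff.mp (h ▸ hle)))
        (Ideal.subset_span (Set.mem_insert _ _)) (hρ 𝔮 hq𝔮 hmem)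
        (hρ _ (Ideal.subset_span (Set.mem_insert _ _))
          (Ideal.subset_span (Set.mem_insert_of_mem _ rfl)))
    rw [φ.apply_mul _ _ (hdvd _ h1) (hdvd _ h2), map_mul, additiveSum_mul, ih h2,
      F.absNorm_eq hq htop hq𝔮 (hρ 𝔮 hq𝔮 hmem), additiveSum_prime _ hq, ← heq]
    · exact mt Ideal.absNorm_eq_zero_iff.mp h𝔮.ne_zero
    · exact mt Ideal.absNorm_eq_zero_iff.mp hI0

lemma span_natCast_pair_ne_top (hι : ι = 1 ∨ ι = 2) {x y : ℤ} {q : ℕ} (hq : q.Prime)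
    (h : (q : ℤ) ∣ x ^ 3 + P ^ ι * y ^ 3) :
    Ideal.span {(q : 𝓞 K), (x : 𝓞 K) + F.θ ^ ι * y} ≠ ⊤ := by
  have : Fact q.Prime := ⟨hq⟩
  intro htop
  obtain ⟨u, v, huv⟩ := Ideal.mem_span_pair.mp (htop ▸ Submodule.mem_top : (1 : 𝓞 K) ∈ _)
  have h1 := F.intCast_norm_eq (n := q) (x := 1) (y := v * ((x : 𝓞 K) + F.θ ^ ι * y))
    ⟨u, by linear_combination -huv⟩
  rw [map_one, map_mul, F.norm_add_theta_pow hι, Int.cast_mul,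
    (ZMod.intCast_zmod_eq_zero_iff_dvd _ q).mpr h, mul_zero, Int.cast_one] at h1
  exact one_ne_zero h1

lemma toFun_span_add_theta_pow (hp : 1 < p) (hι : ι = 1 ∨ ι = 2) {x y z : ℤ}
    (hcop : CoprimeTo (p : 𝓞 K) (Ideal.span {(x : 𝓞 K) + F.θ ^ ι * y}))
    (hN : ∀ q : ℕ, q.Prime → (q : ℤ) ∣ x ^ 3 + P ^ ι * y ^ 3 → ¬ (q : ℤ) ∣ x ∧ ¬ (q : ℤ) ∣ y)
    {l n : ℕ} (hl : l.Prime) (hl3 : l % 3 = 2) {𝔩 : Ideal (𝓞 K)} (h𝔩 : Ideal.absNorm 𝔩 = l)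
    (hn0 : n ≠ 0) (hn : p ∣ n) (heq : x ^ 3 + P ^ ι * y ^ 3 = l ^ (p - 1) * z ^ n) :
    φ.toFun (Ideal.span {(x : 𝓞 K) + F.θ ^ ι * y}) = -φ.toFun 𝔩 := by
  have hlN : (l : ℤ) ∣ x ^ 3 + P ^ ι * y ^ 3 := by
    rw [heq]
    exact (dvd_pow_self _ (by omega)).mul_right _
  have h𝔩l : (l : 𝓞 K) ∈ 𝔩 := h𝔩 ▸ Ideal.absNorm_mem 𝔩
  have h𝔩t : 𝔩 ≠ ⊤ := fun h ↦ hl.one_lt.ne (by rw [← h𝔩, h, Ideal.absNorm_top])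
  have h𝔩' : Ideal.span {(l : 𝓞 K), (x : 𝓞 K) + F.θ ^ ι * y} = 𝔩 := by
    obtain ⟨ρ, hρ⟩ := F.exists_theta_sub_mem_of_mem hι hl (hN l hl hlN).1 (hN l hl hlN).2
    obtain ⟨ρ', hρ'⟩ := F.exists_theta_sub_mem hl h𝔩
    have hm : (l : 𝓞 K) ∈ Ideal.span {(l : 𝓞 K), (x : 𝓞 K) + F.θ ^ ι * y} :=
      Ideal.subset_span (Set.mem_insert _ _)
    have hm' := hρ _ hm (Ideal.subset_span (Set.mem_insert_of_mem _ rfl))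
    have ht := F.span_natCast_pair_ne_top hι hl hlN
    have h1 := (intCast_mem_iff hl ht hm _).mp (F.pow_three_sub_mem hm')
    have h2 := (intCast_mem_iff hl h𝔩t h𝔩l _).mp (F.pow_three_sub_mem hρ')
    have h3 : (l : ℤ) ∣ ρ - ρ' := dvd_sub_of_dvd_pow_three_sub hl hl3 (by
      have := dvd_sub h1 h2
      rwa [sub_sub_sub_cancel_right] at this)
    refine F.ideal_eq hl ht hm h𝔩t h𝔩l hm' ?_
    have h4 := (intCast_mem_iff hl h𝔩t h𝔩l _).mpr h3
    have : F.θ - ρ = (F.θ - ρ') - ((ρ - ρ' : ℤ) : 𝓞 K) := by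
      push_cast
      ring
    rw [this]
    exact sub_mem hρ' h4
  have hz : z ≠ 0 := by
    rintro rfl
    rw [zero_pow hn0, mul_zero, ← F.norm_add_theta_pow hι, Algebra.norm_eq_zero_iff] at heq
    exact hcop.1 (by rw [heq]; simp)
  rw [F.toFun_eq_additiveSum hι hcop hN _ dvd_rfl, Ideal.absNorm_span_singleton,
    F.norm_add_theta_pow hι, heq, Int.natAbs_mul, Int.natAbs_pow, Int.natAbs_pow, Int.natAbs_natCast,
    additiveSum_mul _ (pow_ne_zero _ hl.ne_zero) (pow_ne_zero _ (Int.natAbs_ne_zero.mpr hz)),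
    additiveSum_pow _ hl.ne_zero, additiveSum_pow _ (Int.natAbs_ne_zero.mpr hz),
    additiveSum_prime _ hl, h𝔩', (ZMod.natCast_eq_zero_iff n p).mpr hn, Nat.cast_sub hp.le]
  simp

end PureCubicField
end PureCubic

namespace PureCubic
open NumberField

lemma not_dvd_of_dvd_pow_add {P : ℕ} (hPsq : ∀ q : ℕ, q.Prime → ¬ q ^ 2 ∣ P) {l : ℕ}
    (hl : l.Prime) (hlP : ¬ l ∣ P) {ι m n : ℕ} (hι : ι ≤ 2) (hn : 3 ≤ n) {x y z : ℤ}
    (hgcd : Int.gcd x (Int.gcd y z) = 1) (heq : x ^ 3 + (P : ℤ) ^ ι * y ^ 3 = l ^ m * z ^ n)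
    (hxy : ¬ ((l : ℤ) ∣ x ∧ (l : ℤ) ∣ y)) {q : ℕ} (hq : q.Prime)
    (hqN : (q : ℤ) ∣ x ^ 3 + P ^ ι * y ^ 3) : ¬ (q : ℤ) ∣ x ∧ ¬ (q : ℤ) ∣ y := by
  have hqp : Prime (q : ℤ) := Nat.prime_iff_prime_int.mp hq
  have hlp : Prime (l : ℤ) := Nat.prime_iff_prime_int.mp hl
  have hxy' : ¬ ((q : ℤ) ∣ x ∧ (q : ℤ) ∣ y) := by
    rintro ⟨hqx, hqy⟩
    have hqz : ¬ (q : ℤ) ∣ z := fun hqz ↦ by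
      have : (q : ℤ) ∣ Int.gcd x (Int.gcd y z) := Int.dvd_coe_gcd hqx (Int.dvd_coe_gcd hqy hqz)
      rw [hgcd] at this
      exact hqp.not_dvd_one (by exact_mod_cast this)
    have h1 : (q : ℤ) ∣ l ^ m * z ^ n := heq ▸ hqN
    have h2 : (q : ℤ) ∣ l :=
      hqp.dvd_of_dvd_pow ((hqp.dvd_or_dvd h1).resolve_right (mt hqp.dvd_of_dvd_pow hqz))
    have h3 : q = l := (Nat.prime_dvd_prime_iff_eq hq hl).mp (by exact_mod_cast h2)
    exact hxy (h3 ▸ ⟨hqx, hqy⟩)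
  have hy : ¬ (q : ℤ) ∣ y := fun hqy ↦ by
    refine hxy' ⟨hqp.dvd_of_dvd_pow ((Int.dvd_add_left ?_).mp hqN), hqy⟩
    exact (hqy.trans (dvd_pow_self _ three_ne_zero)).mul_left _
  refine ⟨fun hqx ↦ ?_, hy⟩
  have hqy3 : ¬ (q : ℤ) ∣ y ^ 3 := mt hqp.dvd_of_dvd_pow hy
  have h1 : (q : ℤ) ∣ P ^ ι * y ^ 3 :=
    (Int.dvd_add_right (hqx.trans (dvd_pow_self _ three_ne_zero))).mp hqN
  have hqP : (q : ℤ) ∣ P := hqp.dvd_of_dvd_pow ((hqp.dvd_or_dvd h1).resolve_right hqy3)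
  have hql : ¬ (q : ℤ) ∣ l := fun h ↦ hlP (by
    rw [← (Nat.prime_dvd_prime_iff_eq hq hl).mp (by exact_mod_cast h)]
    exact_mod_cast hqP)
  have hqz : (q : ℤ) ∣ z := hqp.dvd_of_dvd_pow
    ((hqp.dvd_or_dvd (heq ▸ hqN)).resolve_left (mt hqp.dvd_of_dvd_pow hql))
  have h3 : (q : ℤ) ^ 3 ∣ P ^ ι * y ^ 3 := by
    rw [← Int.dvd_add_right (pow_dvd_pow_of_dvd hqx 3), heq]
    exact ((pow_dvd_pow _ hn).trans (pow_dvd_pow_of_dvd hqz n)).mul_left _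
  have h4 : (q : ℤ) ^ 3 ∣ P ^ ι := hqp.pow_dvd_of_dvd_mul_right 3 hqy3 h3
  obtain ⟨r, hr⟩ := hqP
  have hqr : ¬ (q : ℤ) ∣ r := by
    rintro ⟨s, rfl⟩
    refine hPsq q hq ?_
    zify
    exact ⟨s, by rw [hr]; ring⟩
  have h5 : (q : ℤ) ^ 3 ∣ q ^ ι * r ^ ι := by rwa [← mul_pow, ← hr]
  have h6 : (q : ℤ) ^ 3 ∣ q ^ ι := hqp.pow_dvd_of_dvd_mul_right 3 (mt hqp.dvd_of_dvd_pow hqr) h5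
  have h7 : q ^ 3 ∣ q ^ ι := by exact_mod_cast h6
  have := (Nat.pow_dvd_pow_iff_le_right hq.one_lt).mp h7
  omega

lemma not_sq_dvd {p P : ℕ} (hp : p.Prime) (hp3 : 3 ≤ p) (hP : P = 2 * p ∨ P = p) {q : ℕ}
    (hq : q.Prime) : ¬ q ^ 2 ∣ P := by
  intro h
  have h1 : q ^ 2 ∣ 2 * p := by
    rcases hP with rfl | rfl
    exacts [h, h.mul_left 2]
  rw [pow_two] at h1
  rcases (hq.dvd_mul).mp ((dvd_mul_right q q).trans h1) with h2 | h2
  · obtain rfl := (Nat.prime_dvd_prime_iff_eq hq Nat.prime_two).mp h2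
    have := (Nat.prime_dvd_prime_iff_eq Nat.prime_two hp).mp
      (Nat.dvd_of_mul_dvd_mul_left two_pos h1)
    omega
  · obtain rfl := (Nat.prime_dvd_prime_iff_eq hq hp).mp h2
    have := Nat.le_of_dvd two_pos (Nat.dvd_of_mul_dvd_mul_right hp.pos h1)
    omega

end PureCubic

/-- **Theorem 3.1** (Fermat-type equations `x³ + P^ι y³ = l^m z^n`). -/
theorem fermat_type
    (p : ℕ) (hp : p.Prime) (hp3 : 3 ≤ p)
    (P : ℕ) (hP : P = 2 * p ∨ P = p) (hP9 : P % 9 ≠ 1 ∧ P % 9 ≠ 8)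
    (α β γ : ℤ) (ε : ℝ)
    (hε : ε = (α : ℝ) + (β : ℝ) * cbrt P + (γ : ℝ) * (cbrt P) ^ 2)
    (hfund : IsFundamentalUnit P ε)
    (ι : ℕ)
    (hι : (ι = 1 ∧ (¬ (p : ℤ) ∣ β ∨ ((p : ℤ) ∣ β ∧ (p : ℤ) ∣ γ))) ∨
          (ι = 2 ∧ (p : ℤ) ∣ β ∧ ¬ (p : ℤ) ∣ γ))
    (n : ℕ) (hn5 : 5 ≤ n) (hdvd : p ^ ι ∣ n) :
    {l : ℕ | l.Prime ∧ ∃ m : ℕ, 1 ≤ m ∧ m ≤ p - 1 ∧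
      -- (1) `l ≡ 2 (mod 3)` and `l^m ≡ 1 (mod 3)`
      (l % 3 = 2 ∧ l ^ m % 3 = 1) ∧
      -- (2) `l^m ≡ 1 (mod p)`
      (l ^ m % p = 1) ∧
      -- (3) every primitive solution of `x³ + P^ι y³ = l^m z^n` satisfies
      --     `x ≡ y ≡ 0 (mod l)`
      (∀ x y z : ℤ, Int.gcd x (Int.gcd y z) = 1 →
        x ^ 3 + (P : ℤ) ^ ι * y ^ 3 = (l : ℤ) ^ m * z ^ n →
        (l : ℤ) ∣ x ∧ (l : ℤ) ∣ y)}.Infinite := by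
  have : Fact p.Prime := ⟨hp⟩
  have hpP : p ∣ P := by
    rcases hP with rfl | rfl
    exacts [dvd_mul_left _ _, dvd_rfl]
  have hP0 : P ≠ 0 := by
    rcases hP with rfl | rfl <;> omega
  have hι' : ι = 1 ∨ ι = 2 := hι.imp And.left And.left
  have hι0 : ι ≠ 0 := by omega
  obtain ⟨K, _, _, ⟨F⟩⟩ := PureCubic.exists_pureCubicField hp hp3 hP hP9
  obtain ⟨e, rfl⟩ := F.exists_unit_of_isUnitOfOrder hfund.1
  obtain ⟨φ, c, hinf, hφ⟩ := F.exists_idealLog_infinite (by omega) hP0 hpP hfund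
    (F.A_injective (hε.trans (F.A_elt α β γ).symm)) hι
  refine (hinf.sdiff (Set.finite_le_nat P)).mono ?_
  rintro l ⟨⟨hl, hl3, 𝔩, h𝔩, rfl⟩, hlP'⟩
  have hlP : ¬ l ∣ P := fun h ↦ hlP' (Nat.le_of_dvd (Nat.pos_of_ne_zero hP0) h)
  refine ⟨hl, p - 1, by omega, le_rfl, ⟨hl3, ?_⟩, ?_, fun x y z hgcd heq ↦ ?_⟩
  · obtain ⟨k, hk⟩ := (hp.even_sub_one (by omega)).two_dvd
    rw [hk, pow_mul, Nat.pow_mod, Nat.pow_mod l, hl3]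
    norm_num
  · have h0 : (l : ZMod p) ≠ 0 := fun h0 ↦ by
      have := (Nat.prime_dvd_prime_iff_eq hp hl).mp ((ZMod.natCast_eq_zero_iff l p).mp h0)
      exact hlP (this ▸ hpP)
    have h1 : ((l ^ (p - 1) : ℕ) : ZMod p) = (1 : ℕ) := by
      rw [Nat.cast_pow, ZMod.pow_card_sub_one_eq_one h0, Nat.cast_one]
    have h2 := (ZMod.natCast_eq_natCast_iff' _ _ _).mp h1
    rwa [Nat.mod_eq_of_lt hp.one_lt] at h2
  · by_contra hxy
    have hN := fun q hq ↦ PureCubic.not_dvd_of_dvd_pow_add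
      (fun q ↦ PureCubic.not_sq_dvd hp hp3 hP) hl hlP (by omega) (by omega) hgcd heq hxy (q := q) hq
    have hx : ¬ (p : ℤ) ∣ x := fun hpx ↦ by
      refine (hN p hp (dvd_add ?_ ?_)).1 hpx
      · exact hpx.trans (dvd_pow_self _ three_ne_zero)
      · exact ((Int.natCast_dvd_natCast.mpr hpP).trans (dvd_pow_self _ hι0)).mul_right _
    exact hφ x y hx (F.toFun_span_add_theta_pow hp.one_lt hι'
      (F.coprimeTo_add_theta_pow hpP hι' hx y) hN hl hl3 h𝔩 (by omega)
      ((dvd_pow_self p hι0).trans hdvd) heq)
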